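/- arXiv:2305.15672 — 3 statements merged into one kernel-verified Lean document; each statement's English description precedes it below -/
import Mathlib

section
/- Let m, n ≥ 2 be integers and let G_{m,n} = Gp⟨x, y | x^m y^n x^m y^{-n} = 1⟩. Then the assignment A ↦ y x^m y^{-1}, B ↦ y^{2n}, C ↦ x^m, D ↦ x y^{2n} x^{-1} induces an injective group homomorphism from the right-angled Artin group A(P_4) into G_{m,n}. -/
/-- The single relator `x^m y^n x^m y^{-n}` of the group `G_{m,n}`, where `x` is the
generator `0` and `y` is the generator `1`. -/
def gmnRels (m n : ℕ) : Set (FreeGroup (Fin 2)) :=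
  {(FreeGroup.of 0) ^ m * (FreeGroup.of 1) ^ n * (FreeGroup.of 0) ^ m *
    ((FreeGroup.of 1) ^ n)⁻¹}

/-- The one-relator group `G_{m,n} = Gp⟨x, y | x^m y^n x^m y^{-n} = 1⟩`. -/
abbrev Gmn (m n : ℕ) := PresentedGroup (gmnRels m n)

/-- The generator `x` of `G_{m,n}`. -/
def Gmn.x (m n : ℕ) : Gmn m n := PresentedGroup.of 0

/-- The generator `y` of `G_{m,n}`. -/
def Gmn.y (m n : ℕ) : Gmn m n := PresentedGroup.of 1

/-- Relators of the right-angled Artin group `A(P_4)` of the path with four vertices: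
consecutive generators commute.  The generators `0, 1, 2, 3` play the roles of
`A, B, C, D` respectively. -/
def ap4Rels : Set (FreeGroup (Fin 4)) :=
  {r | ∃ i : Fin 3,
    r = FreeGroup.of i.castSucc * FreeGroup.of i.succ *
        (FreeGroup.of i.succ * FreeGroup.of i.castSucc)⁻¹}

/-- The right-angled Artin group `A(P_4)`. -/
abbrev AP4 := PresentedGroup ap4Rels

namespace Gmn

/-- A `k`-th root of `g`: it cycles through `k` copies of `α` and applies `g` once per turn. -/
def cyclicRoot {α : Type*} (k : ℕ) (g : Equiv.Perm α) : Equiv.Perm (Fin k × α) where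
  toFun p := if h : p.1.val + 1 < k then (⟨p.1.val + 1, h⟩, p.2)
    else (⟨0, p.1.pos⟩, g p.2)
  invFun p := if p.1.val = 0 then (⟨k - 1, Nat.sub_lt p.1.pos one_pos⟩, g⁻¹ p.2)
    else (⟨p.1.val - 1, (Nat.sub_le _ _).trans_lt p.1.isLt⟩, p.2)
  left_inv := by
    rintro ⟨⟨i, hi⟩, a⟩
    by_cases h : i + 1 < k
    · simp [h]
    · have : k - 1 = i := by omega
      simp [h, this]
  right_inv := by
    rintro ⟨⟨i, hi⟩, a⟩
    by_cases h : i = 0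
    · subst h
      have : ¬ (k - 1 + 1 < k) := by omega
      simp [this]
    · have h1 : i - 1 + 1 = i := by omega
      simp [h, h1, hi]

theorem cyclicRoot_apply {α : Type*} {k i : ℕ} (g : Equiv.Perm α) (hi : i < k) (a : α) :
    cyclicRoot k g (⟨i, hi⟩, a) =
      if h : i + 1 < k then (⟨i + 1, h⟩, a) else (⟨0, i.zero_le.trans_lt hi⟩, g a) := rfl

theorem cyclicRoot_pow_apply_of_lt {α : Type*} {k i : ℕ} (g : Equiv.Perm α) (hi : i < k)
    (a : α) (t : ℕ) (h : i + t < k) :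
    (cyclicRoot k g ^ t) (⟨i, hi⟩, a) = (⟨i + t, h⟩, a) := by
  induction t with
  | zero => rfl
  | succ t ih =>
    rw [pow_succ', Equiv.Perm.mul_apply, ih (by omega), cyclicRoot_apply, dif_pos (by omega)]
    rfl

theorem cyclicRoot_pow_apply_of_le {α : Type*} {k i : ℕ} (g : Equiv.Perm α) (hi : i < k)
    (a : α) (t : ℕ) (h : k ≤ i + t) (ht : t ≤ k) :
    (cyclicRoot k g ^ t) (⟨i, hi⟩, a) = (⟨i + t - k, by omega⟩, g a) := by
  obtain ⟨u, rfl⟩ : ∃ u, t = u + 1 + (k - 1 - i) := ⟨t - 1 - (k - 1 - i), by omega⟩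
  rw [pow_add, Equiv.Perm.mul_apply, cyclicRoot_pow_apply_of_lt g hi a _ (by omega), pow_succ,
    Equiv.Perm.mul_apply, cyclicRoot_apply, dif_neg (by omega),
    cyclicRoot_pow_apply_of_lt g _ _ _ (by omega)]
  simp only [Prod.mk.injEq, Fin.mk.injEq, and_true]
  omega

theorem cyclicRoot_pow_self_apply {α : Type*} {k : ℕ} (g : Equiv.Perm α) (p : Fin k × α) :
    (cyclicRoot k g ^ k) p = (p.1, g p.2) := by
  obtain ⟨⟨i, hi⟩, a⟩ := p
  rw [cyclicRoot_pow_apply_of_le g hi a k (by omega) le_rfl]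
  simp

/-- Multiplication on the left in the fibre `R` over `s` by `c s`. -/
def fibreMul {S R : Type*} [Group R] (c : S → R) : Equiv.Perm (S × R) where
  toFun p := (p.1, c p.1 * p.2)
  invFun p := (p.1, (c p.1)⁻¹ * p.2)
  left_inv p := by simp
  right_inv p := by simp

theorem fibreMul_apply {S R : Type*} [Group R] (c : S → R) (s : S) (r : R) :
    fibreMul c (s, r) = (s, c s * r) := rfl

/-- The value of `x ^ m` on row `j`, in the sheet `e` of `x`-orbits. -/
def rowLabel (n j : ℕ) (e : Bool) : AP4 :=
  if e then
    if j = 1 then PresentedGroup.of 2 else if j = n + 1 then (PresentedGroup.of 2)⁻¹ else 1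
  else
    if j = 0 then PresentedGroup.of 0 else if j = n then (PresentedGroup.of 0)⁻¹ else 1

/-- The value of `y ^ (2 * n)` on column `i`, in the sheet `e` of `y`-orbits. -/
def colLabel (i : ℕ) (e : Bool) : AP4 :=
  if e then
    if i = 1 then PresentedGroup.of 1 else if i = 0 then PresentedGroup.of 3 else 1
  else 1

/-- Away from the rows `1` and `n + 1`, the sheets are interchanged in column `1`. -/
def twist (n j i : ℕ) : Bool := decide (i = 1 ∧ j ≠ 1 ∧ j ≠ n + 1)

/-- The space on which `Gmn m n` acts: two copies of a `2n × m` grid, with fibre `AP4`. -/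
abbrev Grid (m n : ℕ) : Type := Fin (2 * n) × (Fin m × Bool) × AP4

/-- Rearranges the grid so that `x`-orbits run along the first coordinate. -/
def twistEquiv (m n : ℕ) : Fin m × (Fin (2 * n) × Bool) × AP4 ≃ Grid m n where
  toFun p := (p.2.1.1, (p.1, xor p.2.1.2 (twist n p.2.1.1 p.1)), p.2.2)
  invFun p := (p.2.1.1, (p.1, xor p.2.1.2 (twist n p.1 p.2.1.1)), p.2.2)
  left_inv p := by simp
  right_inv p := by simp

/-- The action of `x` on the grid. -/
def xPerm (m n : ℕ) : Equiv.Perm (Grid m n) :=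
  (twistEquiv m n).permCongrHom (cyclicRoot m (fibreMul fun s => rowLabel n s.1 s.2))

/-- The action of `y` on the grid. -/
def yPerm (m n : ℕ) : Equiv.Perm (Grid m n) :=
  cyclicRoot (2 * n) (fibreMul fun s => colLabel s.1 s.2)

theorem xPerm_pow_apply (m n : ℕ) (j : Fin (2 * n)) (i : Fin m) (e : Bool) (r : AP4) :
    (xPerm m n ^ m) (j, (i, e), r) =
      (j, (i, e), rowLabel n j (xor e (twist n j i)) * r) := by
  rw [xPerm, ← map_pow]
  simp [Equiv.permCongrHom, Equiv.permCongr_apply, twistEquiv, cyclicRoot_pow_self_apply,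
    fibreMul_apply]

theorem commute_of_castSucc_succ (i : Fin 3) :
    Commute (PresentedGroup.of i.castSucc : AP4) (PresentedGroup.of i.succ) := by
  have h : PresentedGroup.mk ap4Rels (FreeGroup.of i.castSucc * FreeGroup.of i.succ *
      (FreeGroup.of i.succ * FreeGroup.of i.castSucc)⁻¹) = 1 :=
    PresentedGroup.one_of_mem ⟨i, rfl⟩
  rw [map_mul, map_inv, mul_inv_eq_one, map_mul, map_mul] at h
  exact h

theorem commute_rowLabel_colLabel (n j i : ℕ) (e : Bool) :
    Commute (rowLabel n j (xor e (twist n j i))) (colLabel i e) := by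
  have hAB : Commute (PresentedGroup.of 0 : AP4) (PresentedGroup.of 1) :=
    commute_of_castSucc_succ 0
  have hBC : Commute (PresentedGroup.of 1 : AP4) (PresentedGroup.of 2) :=
    commute_of_castSucc_succ 1
  have hCD : Commute (PresentedGroup.of 2 : AP4) (PresentedGroup.of 3) :=
    commute_of_castSucc_succ 2
  cases e
  · simp [colLabel]
  · by_cases h1 : j = 1 ∨ j = n + 1
    · have ht : twist n j i = false := by simp only [twist, decide_eq_false_iff_not]; tauto
      simp only [ht, rowLabel, colLabel]
      split_ifs <;> simp_all [hBC.symm]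
    · push Not at h1
      by_cases hi : i = 1
      · have ht : twist n j i = true := by simp [twist, hi, h1]
        simp only [ht, rowLabel, colLabel]
        split_ifs <;> simp_all
      · simp [rowLabel, twist, h1, hi]

theorem rowLabel_add {n j : ℕ} (hn : 2 ≤ n) (hj : j < n) (e : Bool) :
    rowLabel n (j + n) e = (rowLabel n j e)⁻¹ := by
  have h1 : j + n ≠ 1 := by omega
  have h2 : j + n ≠ 0 := by omega
  have h3 : j ≠ n + 1 := by omega
  have h4 : j ≠ n := by omega
  have h5 : j + n = n + 1 ↔ j = 1 := by omega
  have h6 : j + n = n ↔ j = 0 := by omega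
  simp only [rowLabel, h1, h2, h3, h4, h5, h6, if_false]
  split_ifs <;> simp

theorem twist_add {n j : ℕ} (hn : 2 ≤ n) (hj : j < n) (i : ℕ) :
    twist n (j + n) i = twist n j i := by
  simp only [twist, decide_eq_decide]
  omega

theorem perm_relation {m n : ℕ} (hn : 2 ≤ n) :
    xPerm m n ^ m * yPerm m n ^ n * xPerm m n ^ m = yPerm m n ^ n := by
  ext1 ⟨⟨j, hj⟩, ⟨i, e⟩, r⟩
  rw [Equiv.Perm.mul_apply, Equiv.Perm.mul_apply, xPerm_pow_apply m n ⟨j, hj⟩ i e r]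
  rcases lt_or_ge j n with h | h
  · rw [yPerm, cyclicRoot_pow_apply_of_lt _ _ _ _ (by omega),
      cyclicRoot_pow_apply_of_lt _ _ _ _ (by omega), xPerm_pow_apply]
    simp [rowLabel_add hn h, twist_add hn h]
  · obtain ⟨k, rfl⟩ := Nat.exists_eq_add_of_le' h
    have hk : k < n := by omega
    have hkn : k + n + n - 2 * n = k := by omega
    rw [yPerm, cyclicRoot_pow_apply_of_le _ _ _ _ (by omega) (by omega),
      cyclicRoot_pow_apply_of_le _ _ _ _ (by omega) (by omega), fibreMul_apply, fibreMul_apply,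
      xPerm_pow_apply]
    simp only [rowLabel_add hn hk, twist_add hn hk, hkn, Prod.mk.injEq, true_and]
    rw [← mul_assoc, (commute_rowLabel_colLabel n k i e).eq]
    group

/-- The action of `Gmn m n` on the grid. -/
def toPerm {m n : ℕ} (hn : 2 ≤ n) : Gmn m n →* Equiv.Perm (Grid m n) :=
  PresentedGroup.toGroup (f := ![xPerm m n, yPerm m n]) <| by
    rintro _ rfl
    simp [perm_relation hn]

theorem toPerm_x {m n : ℕ} (hn : 2 ≤ n) : toPerm hn (x m n) = xPerm m n :=
  PresentedGroup.toGroup.of _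

theorem toPerm_y {m n : ℕ} (hn : 2 ≤ n) : toPerm hn (y m n) = yPerm m n :=
  PresentedGroup.toGroup.of _

theorem relation (m n : ℕ) : x m n ^ m * y m n ^ n * x m n ^ m * (y m n ^ n)⁻¹ = 1 := by
  have h : PresentedGroup.mk (gmnRels m n) ((FreeGroup.of 0) ^ m * (FreeGroup.of 1) ^ n *
      (FreeGroup.of 0) ^ m * ((FreeGroup.of 1) ^ n)⁻¹) = 1 :=
    PresentedGroup.one_of_mem rfl
  rwa [map_mul, map_mul, map_mul, map_inv, map_pow, map_pow] at h

theorem commute_y_pow_x_pow (m n : ℕ) : Commute (y m n ^ (2 * n)) (x m n ^ m) := by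
  have h : SemiconjBy (y m n ^ n) (x m n ^ m) (x m n ^ m)⁻¹ := by
    have := relation m n
    rw [mul_inv_eq_one, mul_assoc] at this
    exact eq_inv_mul_of_mul_eq this
  have h2 := h.inv_right.mul_left h
  rwa [inv_inv, ← pow_add, ← two_mul] at h2

/-- The images in `Gmn m n` of the generators of `AP4`. -/
def ap4Gen (m n : ℕ) : Fin 4 → Gmn m n :=
  ![y m n * x m n ^ m * (y m n)⁻¹, y m n ^ (2 * n), x m n ^ m,
    x m n * y m n ^ (2 * n) * (x m n)⁻¹]

theorem commute_ap4Gen (m n : ℕ) (i : Fin 3) :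
    Commute (ap4Gen m n i.castSucc) (ap4Gen m n i.succ) := by
  have h := commute_y_pow_x_pow m n
  fin_cases i
  · have h1 := (Commute.conj_iff (y m n)).2 h.symm
    rwa [((Commute.refl (y m n)).pow_right (2 * n)).eq, mul_inv_cancel_right] at h1
  · exact h
  · have h1 := (Commute.conj_iff (x m n)).2 h.symm
    rwa [((Commute.refl (x m n)).pow_right m).eq, mul_inv_cancel_right] at h1

/-- The homomorphism from `AP4` to `Gmn m n`. -/
def ap4Hom (m n : ℕ) : AP4 →* Gmn m n :=
  PresentedGroup.toGroup (f := ap4Gen m n) <| by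
    rintro _ ⟨i, rfl⟩
    simp only [map_mul, map_inv, FreeGroup.lift_apply_of, mul_inv_eq_one]
    exact commute_ap4Gen m n i

theorem ap4Hom_of (m n : ℕ) (i : Fin 4) : ap4Hom m n (PresentedGroup.of i) = ap4Gen m n i :=
  PresentedGroup.toGroup.of _

theorem toPerm_ap4Gen_apply {m n : ℕ} (hm : 2 ≤ m) (hn : 2 ≤ n) (k : Fin 4) (r : AP4) :
    toPerm hn (ap4Gen m n k) (⟨1, by omega⟩, (⟨1, hm⟩, true), r) =
      (⟨1, by omega⟩, (⟨1, hm⟩, true), PresentedGroup.of k * r) := by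
  have hy (r : AP4) : yPerm m n (⟨0, by omega⟩, (⟨1, hm⟩, true), r) =
      (⟨1, by omega⟩, (⟨1, hm⟩, true), r) := by
    rw [yPerm, cyclicRoot_apply, dif_pos (by omega)]
  have hx (r : AP4) : xPerm m n (⟨1, by omega⟩, (⟨0, by omega⟩, true), r) =
      (⟨1, by omega⟩, (⟨1, hm⟩, true), r) := by
    have h1 : 1 < m := hm
    simp [xPerm, Equiv.permCongrHom, Equiv.permCongr_apply, twistEquiv, cyclicRoot_apply,
      twist, h1]
  have hy2 (p : Grid m n) : (yPerm m n ^ (2 * n)) p =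
      (p.1, p.2.1, colLabel p.2.1.1 p.2.1.2 * p.2.2) :=
    cyclicRoot_pow_self_apply _ _
  fin_cases k
  · change toPerm hn (y m n * x m n ^ m * (y m n)⁻¹) _ = _
    rw [map_mul, map_mul, map_inv, map_pow, toPerm_x, toPerm_y, Equiv.Perm.mul_apply,
      Equiv.Perm.mul_apply, Equiv.Perm.inv_eq_iff_eq.2 (hy r).symm, xPerm_pow_apply, hy]
    simp [rowLabel, twist]
  · change toPerm hn (y m n ^ (2 * n)) _ = _
    rw [map_pow, toPerm_y, hy2]
    simp [colLabel]
  · change toPerm hn (x m n ^ m) _ = _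
    rw [map_pow, toPerm_x, xPerm_pow_apply]
    simp [rowLabel, twist]
  · change toPerm hn (x m n * y m n ^ (2 * n) * (x m n)⁻¹) _ = _
    rw [map_mul, map_mul, map_inv, map_pow, toPerm_x, toPerm_y, Equiv.Perm.mul_apply,
      Equiv.Perm.mul_apply, Equiv.Perm.inv_eq_iff_eq.2 (hx r).symm, hy2, hx]
    simp [colLabel]

theorem toPerm_ap4Hom_apply {m n : ℕ} (hm : 2 ≤ m) (hn : 2 ≤ n) (w r : AP4) :
    toPerm hn (ap4Hom m n w) (⟨1, by omega⟩, (⟨1, hm⟩, true), r) =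
      (⟨1, by omega⟩, (⟨1, hm⟩, true), w * r) := by
  have hw : w ∈ Subgroup.closure (Set.range (PresentedGroup.of (rels := ap4Rels))) := by
    rw [PresentedGroup.closure_range_of]
    trivial
  induction hw using Subgroup.closure_induction generalizing r with
  | mem w h =>
    obtain ⟨k, rfl⟩ := h
    rw [ap4Hom_of, toPerm_ap4Gen_apply hm hn]
  | one => simp
  | mul v w _ _ hv hw => rw [map_mul, map_mul, Equiv.Perm.mul_apply, hw, hv, mul_assoc]
  | inv w _ hw => rw [map_inv, map_inv, Equiv.Perm.inv_eq_iff_eq, hw, mul_inv_cancel_left]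

theorem ap4Hom_injective {m n : ℕ} (hm : 2 ≤ m) (hn : 2 ≤ n) :
    Function.Injective (ap4Hom m n) := by
  intro v w h
  have hv := toPerm_ap4Hom_apply hm hn v 1
  rw [h, toPerm_ap4Hom_apply hm hn w 1] at hv
  simpa using hv.symm

end Gmn

/-- For `m, n ≥ 2`, the assignment `A ↦ y x^m y^{-1}`, `B ↦ y^{2n}`, `C ↦ x^m`,
`D ↦ x y^{2n} x^{-1}` induces an injective group homomorphism `A(P_4) → G_{m,n}`. -/
theorem ap4_embeds_in_gmn (m n : ℕ) (hm : 2 ≤ m) (hn : 2 ≤ n) :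
    ∃ φ : AP4 →* Gmn m n,
      Function.Injective φ ∧
      φ (PresentedGroup.of 0) = Gmn.y m n * (Gmn.x m n) ^ m * (Gmn.y m n)⁻¹ ∧
      φ (PresentedGroup.of 1) = (Gmn.y m n) ^ (2 * n) ∧
      φ (PresentedGroup.of 2) = (Gmn.x m n) ^ m ∧
      φ (PresentedGroup.of 3) = Gmn.x m n * (Gmn.y m n) ^ (2 * n) * (Gmn.x m n)⁻¹ := by
  exact ⟨Gmn.ap4Hom m n, Gmn.ap4Hom_injective hm hn, Gmn.ap4Hom_of m n 0, Gmn.ap4Hom_of m n 1,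
    Gmn.ap4Hom_of m n 2, Gmn.ap4Hom_of m n 3⟩
end

section
/- For all integers m, n ≥ 2, the positive one-relator group M_{m,n} = Gp⟨a, b | (b a^n)^m (a^n b)^m = 1⟩ contains a fixed finitely generated submonoid in which membership is undecidable: there exists a finite subset F of M_{m,n} such that the predicate on words over {a, b, a^{-1}, b^{-1}} given by 'the element represented by the word lies in the submonoid generated by F' is not computable. -/
/-- The single positive relator `(b a^n)^m (a^n b)^m` of `M_{m,n}`, where `a` is the
generator `0` and `b` is the generator `1`. -/
def mmnRels (m n : ℕ) : Set (FreeGroup (Fin 2)) :=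
  {(FreeGroup.of 1 * (FreeGroup.of 0) ^ n) ^ m *
    ((FreeGroup.of 0) ^ n * FreeGroup.of 1) ^ m}

/-- The positive one-relator group `M_{m,n} = Gp⟨a, b | (b a^n)^m (a^n b)^m = 1⟩`. -/
abbrev Mmn (m n : ℕ) := PresentedGroup (mmnRels m n)

/-- Evaluation of a word over the generators and their formal inverses in a group:
a letter `(i, false)` is sent to `gen i` and a letter `(i, true)` to `(gen i)⁻¹`. -/
def evalGrpWord {k : ℕ} {G : Type*} [Group G] (gen : Fin k → G)
    (w : List (Fin k × Bool)) : G :=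
  (w.map fun p => if p.2 then (gen p.1)⁻¹ else gen p.1).prod

namespace AffineMembership

open Relation

/-- The affine relation `P t + r ↦ Q t + s` (`t : ℕ`) attached to `(P, r, Q, s)`. -/
def AffRel (a : ℕ × ℕ × ℕ × ℕ) (N N' : ℕ) : Prop :=
  ∃ t, N = a.1 * t + a.2.1 ∧ N' = a.2.2.1 * t + a.2.2.2

/-- A nondeterministic machine with one register and finitely many affine rules. -/
structure AffMachine where
  State : Type
  countable : Countable State
  rules : List (State × (ℕ × ℕ × ℕ × ℕ) × State)
  pos : ∀ ρ ∈ rules, 0 < ρ.2.1.2.2.1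
  init : State
  final : State

namespace AffMachine

/-- One computation step. -/
def Step (M : AffMachine) (x y : M.State × ℕ) : Prop :=
  ∃ a, (x.1, a, y.1) ∈ M.rules ∧ AffRel a x.2 y.2

/-- The input-output relation of a machine. -/
def Rel (M : AffMachine) (N N' : ℕ) : Prop :=
  ReflTransGen M.Step (M.init, N) (M.final, N')

end AffMachine

/-- Relations on `ℕ` that are input-output relations of machines. -/
def Realizable (R : ℕ → ℕ → Prop) : Prop :=
  ∃ M : AffMachine, ∀ N N', M.Rel N N' ↔ R N N'

theorem realizable_basic (L : List (ℕ × ℕ × ℕ × ℕ)) (hL : ∀ a ∈ L, 0 < a.2.2.1) :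
    Realizable fun N N' => ∃ a ∈ L, AffRel a N N' := by
  refine ⟨⟨Bool, inferInstance, L.map fun a => (false, a, true), by
    simp only [List.mem_map]
    rintro _ ⟨a, ha, rfl⟩
    exact hL a ha,
    false, true⟩, fun N N' => ⟨fun h => ?_, ?_⟩⟩
  · obtain h | ⟨⟨q, K⟩, ⟨a, ha, hs⟩, h⟩ := ReflTransGen.cases_head h
    · simp at h
    · obtain h | ⟨⟨q', K'⟩, ⟨a', ha', hs'⟩, h⟩ := ReflTransGen.cases_head h
      · simp only [Prod.mk.injEq] at h
        obtain ⟨b, hb, e⟩ := List.mem_map.1 ha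
        simp only [Prod.mk.injEq] at e
        obtain ⟨-, rfl, -⟩ := e
        exact ⟨b, hb, h.2 ▸ hs⟩
      · obtain ⟨b, -, e⟩ := List.mem_map.1 ha
        obtain ⟨b', -, e'⟩ := List.mem_map.1 ha'
        simp only [Prod.mk.injEq] at e e'
        exact absurd (e.2.2.trans e'.1.symm) (by simp)
  · rintro ⟨a, ha, hs⟩
    exact ReflTransGen.single ⟨a, List.mem_map.2 ⟨a, ha, rfl⟩, hs⟩

theorem affRel_id {N N' : ℕ} : AffRel (1, 0, 1, 0) N N' ↔ N' = N := by
  simp [AffRel]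

theorem Realizable.comp {R S : ℕ → ℕ → Prop} (hR : Realizable R) (hS : Realizable S) :
    Realizable (Comp R S) := by
  obtain ⟨M₁, h₁⟩ := hR
  obtain ⟨M₂, h₂⟩ := hS
  have := M₁.countable
  have := M₂.countable
  let M : AffMachine := ⟨M₁.State ⊕ M₂.State, inferInstance,
    M₁.rules.map (fun ρ => (.inl ρ.1, ρ.2.1, .inl ρ.2.2)) ++
    M₂.rules.map (fun ρ => (.inr ρ.1, ρ.2.1, .inr ρ.2.2)) ++
    [(.inl M₁.final, (1, 0, 1, 0), .inr M₂.init)], by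
      intro ρ hρ
      simp only [List.mem_append, List.mem_map, List.mem_singleton] at hρ
      obtain (⟨ρ, h, rfl⟩ | ⟨ρ, h, rfl⟩) | rfl := hρ
      · exact M₁.pos ρ h
      · exact M₂.pos ρ h
      · simp, .inl M₁.init, .inr M₂.final⟩
  have key : ∀ x : M.State × ℕ, ∀ K, ReflTransGen M.Step x (M.final, K) →
      match x with
      | (.inl q, N) => ∃ N', ReflTransGen M₁.Step (q, N) (M₁.final, N') ∧ M₂.Rel N' K
      | (.inr q, N) => ReflTransGen M₂.Step (q, N) (M₂.final, K) := by
    intro x K h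
    induction h using ReflTransGen.head_induction_on with
    | refl => exact ReflTransGen.refl
    | @head x y hxy _ ih =>
      obtain ⟨a, ha, hs⟩ := hxy
      obtain ⟨q | q, N⟩ := x <;> obtain ⟨q' | q', N'⟩ := y <;> simp [M] at ha
      · obtain ⟨N'', h₁, h₂⟩ := ih
        exact ⟨N'', h₁.head ⟨a, ha, hs⟩, h₂⟩
      · obtain ⟨rfl, rfl, rfl⟩ := ha
        obtain rfl := affRel_id.1 hs
        exact ⟨_, .refl, ih⟩
      · exact ReflTransGen.head ⟨a, ha, hs⟩ ih
  refine ⟨M, fun N K => ⟨fun h => ?_, ?_⟩⟩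
  · obtain ⟨N', h, h'⟩ := key _ _ h
    exact ⟨N', (h₁ _ _).1 h, (h₂ _ _).1 h'⟩
  · rintro ⟨N', h, h'⟩
    have e₁ : ReflTransGen M.Step (.inl M₁.init, N) (.inl M₁.final, N') :=
      ReflTransGen.lift (fun x : M₁.State × ℕ => ((.inl x.1, x.2) : M.State × ℕ))
        (fun x y ⟨a, ha, hs⟩ => ⟨a, by simpa [M] using ha, hs⟩) _ _ ((h₁ _ _).2 h)
    have e₂ : ReflTransGen M.Step (.inr M₂.init, N') (.inr M₂.final, K) :=
      ReflTransGen.lift (fun x : M₂.State × ℕ => ((.inr x.1, x.2) : M.State × ℕ))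
        (fun x y ⟨a, ha, hs⟩ => ⟨a, by simpa [M] using ha, hs⟩) _ _ ((h₂ _ _).2 h')
    have e : M.Step (.inl M₁.final, N') (.inr M₂.init, N') :=
      ⟨(1, 0, 1, 0), by simp [M], affRel_id.2 rfl⟩
    exact (e₁.tail e).trans e₂

theorem Realizable.star {R : ℕ → ℕ → Prop} (hR : Realizable R) :
    Realizable (ReflTransGen R) := by
  obtain ⟨M₁, h₁⟩ := hR
  have := M₁.countable
  let M : AffMachine := ⟨Option M₁.State, inferInstance,
    M₁.rules.map (fun ρ => (some ρ.1, ρ.2.1, some ρ.2.2)) ++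
    [(some M₁.final, (1, 0, 1, 0), none), (none, (1, 0, 1, 0), some M₁.init)], by
      intro ρ hρ
      simp only [List.mem_append, List.mem_map, List.mem_cons, List.not_mem_nil, or_false] at hρ
      obtain ⟨ρ, h, rfl⟩ | rfl | rfl := hρ
      · exact M₁.pos ρ h
      · simp
      · simp, none, none⟩
  have key : ∀ x : M.State × ℕ, ∀ K, ReflTransGen M.Step x (M.final, K) →
      match x with
      | (some q, N) => ∃ N', ReflTransGen M₁.Step (q, N) (M₁.final, N') ∧ ReflTransGen R N' K
      | (none, N) => ReflTransGen R N K := by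
    intro x K h
    induction h using ReflTransGen.head_induction_on with
    | refl => exact ReflTransGen.refl
    | @head x y hxy _ ih =>
      obtain ⟨a, ha, hs⟩ := hxy
      obtain ⟨_ | q, N⟩ := x <;> obtain ⟨_ | q', N'⟩ := y <;> simp [M] at ha
      · obtain ⟨rfl, rfl⟩ := ha
        obtain rfl := affRel_id.1 hs
        obtain ⟨N'', h, h'⟩ := ih
        exact h'.head ((h₁ _ _).1 h)
      · obtain ⟨rfl, rfl⟩ := ha
        obtain rfl := affRel_id.1 hs
        exact ⟨_, .refl, ih⟩
      · obtain ⟨N'', h₁, h₂⟩ := ih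
        exact ⟨N'', h₁.head ⟨a, ha, hs⟩, h₂⟩
  refine ⟨M, fun N K => ⟨key (none, N) K, fun h => ?_⟩⟩
  induction h with
  | refl => exact ReflTransGen.refl
  | @tail N' K _ hs ih =>
    have e₁ : ReflTransGen M.Step (some M₁.init, N') (some M₁.final, K) :=
      ReflTransGen.lift (fun x : M₁.State × ℕ => ((some x.1, x.2) : M.State × ℕ))
        (fun x y ⟨a, ha, hs⟩ => ⟨a, by simpa [M] using ha, hs⟩) _ _ ((h₁ _ _).2 hs)
    have e : M.Step (none, N') (some M₁.init, N') :=
      ⟨(1, 0, 1, 0), by simp [M], affRel_id.2 rfl⟩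
    have e' : M.Step (some M₁.final, K) (none, K) :=
      ⟨(1, 0, 1, 0), by simp [M], affRel_id.2 rfl⟩
    exact ((ReflTransGen.tail ih e).trans e₁).tail e'

/-- Gödel numbering of register contents. -/
noncomputable def godel (c : ℕ →₀ ℕ) : ℕ := c.prod fun i e => Nat.nth Nat.Prime i ^ e

theorem godel_add_single (c : ℕ →₀ ℕ) (i : ℕ) :
    godel (c + Finsupp.single i 1) = Nat.nth Nat.Prime i * godel c := by
  unfold godel
  rw [Finsupp.prod_add_index' (by simp) (by simp [pow_add]), Finsupp.prod_single_index (by simp)]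
  ring

theorem eq_add_single {c : ℕ →₀ ℕ} {i : ℕ} (h : c i ≠ 0) :
    c = (c - Finsupp.single i 1) + Finsupp.single i 1 := by
  ext j
  by_cases hj : i = j
  · subst hj; simp; omega
  · simp [hj]

theorem nth_prime_dvd_godel {c : ℕ →₀ ℕ} {i : ℕ} :
    Nat.nth Nat.Prime i ∣ godel c ↔ c i ≠ 0 := by
  constructor
  · intro h hc
    obtain ⟨j, hj, h⟩ := (Nat.prime_nth_prime i).prime.exists_mem_finset_dvd h
    have := (Nat.prime_dvd_prime_iff_eq (Nat.prime_nth_prime i) (Nat.prime_nth_prime j)).1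
      ((Nat.prime_nth_prime i).dvd_of_dvd_pow h)
    obtain rfl := Nat.nth_injective Nat.infinite_setOfPred_prime this
    simp [hc] at hj
  · intro h
    rw [eq_add_single h, godel_add_single]
    exact dvd_mul_right _ _

/-- Relations on register contents that are realized through the Gödel numbering. -/
def RegRealizable (R : (ℕ →₀ ℕ) → (ℕ →₀ ℕ) → Prop) : Prop :=
  ∃ R', Realizable R' ∧ ∀ c N', R' (godel c) N' ↔ ∃ c', N' = godel c' ∧ R c c'

theorem RegRealizable.comp {R S : (ℕ →₀ ℕ) → (ℕ →₀ ℕ) → Prop} (hR : RegRealizable R)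
    (hS : RegRealizable S) : RegRealizable (Comp R S) := by
  obtain ⟨R', hR', hR⟩ := hR
  obtain ⟨S', hS', hS⟩ := hS
  refine ⟨_, hR'.comp hS', fun c N' => ⟨?_, ?_⟩⟩
  · rintro ⟨N, h, h'⟩
    obtain ⟨d, rfl, hd⟩ := (hR _ _).1 h
    obtain ⟨e, rfl, he⟩ := (hS _ _).1 h'
    exact ⟨e, rfl, d, hd, he⟩
  · rintro ⟨e, rfl, d, hd, he⟩
    exact ⟨godel d, (hR _ _).2 ⟨d, rfl, hd⟩, (hS _ _).2 ⟨e, rfl, he⟩⟩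

theorem RegRealizable.star {R : (ℕ →₀ ℕ) → (ℕ →₀ ℕ) → Prop} (hR : RegRealizable R) :
    RegRealizable (ReflTransGen R) := by
  obtain ⟨R', hR', hR⟩ := hR
  refine ⟨_, hR'.star, fun c N' => ⟨fun h => ?_, ?_⟩⟩
  · induction h with
    | refl => exact ⟨c, rfl, .refl⟩
    | tail _ h ih =>
      obtain ⟨d, rfl, hd⟩ := ih
      obtain ⟨e, rfl, he⟩ := (hR _ _).1 h
      exact ⟨e, rfl, hd.tail he⟩
  · rintro ⟨d, rfl, hd⟩
    exact ReflTransGen.lift godel (fun x y h => (hR _ _).2 ⟨y, rfl, h⟩) _ _ hd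

theorem regRealizable_id : RegRealizable fun c c' => c' = c :=
  ⟨_, realizable_basic [(1, 0, 1, 0)] (by simp), fun c N' => by simp [AffRel]⟩

theorem regRealizable_inc (i : ℕ) : RegRealizable fun c c' => c' = c + Finsupp.single i 1 := by
  refine ⟨_, realizable_basic [(1, 0, Nat.nth Nat.Prime i, 0)] ?_, fun c N' => ?_⟩
  · simp [(Nat.prime_nth_prime i).pos]
  · simp [AffRel, godel_add_single]

theorem regRealizable_dec (i : ℕ) : RegRealizable fun c c' => c = c' + Finsupp.single i 1 := by
  refine ⟨_, realizable_basic [(Nat.nth Nat.Prime i, 0, 1, 0)] (by simp), fun c N' => ?_⟩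
  simp only [List.mem_singleton, AffRel, exists_eq_left, add_zero, one_mul, exists_eq_right']
  constructor
  · intro h
    have hc := eq_add_single (nth_prime_dvd_godel.1 ⟨N', h⟩)
    refine ⟨_, ?_, hc⟩
    rw [hc, godel_add_single] at h
    exact (Nat.eq_of_mul_eq_mul_left (Nat.prime_nth_prime i).pos h).symm
  · rintro ⟨c', rfl, rfl⟩
    rw [godel_add_single]

theorem regRealizable_test (i : ℕ) : RegRealizable fun c c' => c i = 0 ∧ c' = c := by
  set p := Nat.nth Nat.Prime i with hp
  have hpos : 0 < p := (Nat.prime_nth_prime i).pos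
  refine ⟨_, realizable_basic ((List.range p).filter (· ≠ 0) |>.map fun r => (p, r, p, r)) ?_,
    fun c N' => ?_⟩
  · simp only [List.mem_map]
    rintro _ ⟨r, -, rfl⟩
    exact hpos
  · simp only
    rw [← not_ne_iff (a := c i), ← nth_prime_dvd_godel, ← hp]
    simp only [AffRel, List.mem_map, List.mem_filter, List.mem_range, decide_eq_true_eq]
    constructor
    · rintro ⟨_, ⟨r, ⟨hr, hr0⟩, rfl⟩, t, h, h'⟩
      refine ⟨c, h'.trans h.symm, fun hd => hr0 ?_, rfl⟩
      rw [h] at hd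
      exact Nat.eq_zero_of_dvd_of_lt ((Nat.dvd_add_right (dvd_mul_right _ _)).1 hd) hr
    · rintro ⟨c', rfl, hd, rfl⟩
      refine ⟨_, ⟨godel c' % p, ⟨Nat.mod_lt _ hpos, fun h => hd (Nat.dvd_of_mod_eq_zero h)⟩, rfl⟩,
        godel c' / p, ?_, ?_⟩ <;> simp [Nat.div_add_mod]

/-- On register contents satisfying `P`, the function `F` is computed by a realizable relation. -/
def Computes (P : (ℕ → ℕ) → Prop) (F : (ℕ → ℕ) → ℕ → ℕ) : Prop :=
  ∃ R, RegRealizable R ∧ ∀ c : ℕ →₀ ℕ, P c → ∃ d : ℕ →₀ ℕ, ⇑d = F c ∧ ∀ c', R c c' ↔ c' = d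

namespace Computes

variable {P Q : (ℕ → ℕ) → Prop} {F G H : (ℕ → ℕ) → ℕ → ℕ}

theorem inc (i : ℕ) : Computes (fun _ => True) fun c => Function.update c i (c i + 1) :=
  ⟨_, regRealizable_inc i, fun c _ => ⟨c + Finsupp.single i 1, by
    ext j
    by_cases h : j = i
    · subst h; simp
    · simp [h], fun _ => Iff.rfl⟩⟩

theorem seq (hF : Computes P F) (hG : Computes Q G) (h : ∀ c, P c → Q (F c)) :
    Computes P fun c => G (F c) := by
  obtain ⟨R, hR, hF⟩ := hF
  obtain ⟨S, hS, hG⟩ := hG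
  refine ⟨_, hR.comp hS, fun c hc => ?_⟩
  obtain ⟨d, hd, hRd⟩ := hF c hc
  obtain ⟨e, he, hSe⟩ := hG d (hd ▸ h c hc)
  exact ⟨e, he.trans (congrArg G hd), fun c' => by simp [Comp, hRd, hSe]⟩

theorem congr (hF : Computes P F) (h : ∀ c, Q c → P c ∧ F c = G c) : Computes Q G := by
  obtain ⟨R, hR, hF⟩ := hF
  refine ⟨R, hR, fun c hc => ?_⟩
  rw [← (h c hc).2]
  exact hF c (h c hc).1

theorem loop (hG : Computes Q G) (i : ℕ)
    (h : ∀ c, P c → c i ≠ 0 → Q (Function.update c i (c i - 1)) ∧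
      P (G (Function.update c i (c i - 1))) ∧ G (Function.update c i (c i - 1)) i < c i ∧
      H (G (Function.update c i (c i - 1))) = H c)
    (h₀ : ∀ c, P c → c i = 0 → H c = c) : Computes P H := by
  obtain ⟨R, hR, hG⟩ := hG
  refine ⟨_, (((regRealizable_dec i).comp hR).star).comp (regRealizable_test i), fun c hc => ?_⟩
  induction hk : c i using Nat.strong_induction_on generalizing c with
  | _ k ih =>
    subst hk
    by_cases hci : c i = 0
    · refine ⟨c, (h₀ c hc hci).symm, fun c' => ⟨?_, ?_⟩⟩
      · rintro ⟨e, he, -, rfl⟩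
        obtain rfl | ⟨x, ⟨y, hy, -⟩, -⟩ := ReflTransGen.cases_head he
        · rfl
        · simp [hy] at hci
      · rintro rfl
        exact ⟨_, .refl, hci, rfl⟩
    · have hd : ⇑(c - Finsupp.single i 1 : ℕ →₀ ℕ) = Function.update c i (c i - 1) := by
        ext j
        by_cases hj : j = i
        · subst hj; simp
        · simp [hj]
      obtain ⟨hQ, hP, hlt, hH⟩ := h c hc hci
      rw [← hd] at hQ hP hlt hH
      obtain ⟨e, he, hRe⟩ := hG _ hQ
      rw [← he] at hP hlt hH
      obtain ⟨f, hf, hRf⟩ := ih _ hlt e hP rfl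
      refine ⟨f, hf.trans hH, fun c' => ?_⟩
      rw [← hRf]
      constructor
      · rintro ⟨x, hx, hxi, rfl⟩
        obtain rfl | ⟨z, ⟨y, hy, hyz⟩, hz⟩ := ReflTransGen.cases_head hx
        · exact absurd hxi hci
        · obtain rfl : y = c - Finsupp.single i 1 := by simp [hy]
          rw [hRe] at hyz
          exact ⟨_, hyz ▸ hz, hxi, rfl⟩
      · rintro ⟨x, hx, hxi, rfl⟩
        exact ⟨_, hx.head ⟨_, eq_add_single hci, (hRe _).2 rfl⟩, hxi, rfl⟩

theorem id : Computes (fun _ => True) fun c => c :=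
  ⟨_, regRealizable_id, fun c _ => ⟨c, rfl, fun _ => Iff.rfl⟩⟩

theorem clr (i : ℕ) : Computes (fun _ => True) fun c => Function.update c i 0 := by
  refine loop id i (P := fun _ => True) ?_ ?_
  · intro c _ hc
    simp
    omega
  · intro c _ hc
    simp [← hc]

theorem move {i o : ℕ} (hio : i ≠ o) : Computes (fun _ => True)
    fun c => Function.update (Function.update c o (c o + c i)) i 0 := by
  refine loop (inc o) i (P := fun _ => True) ?_ ?_
  · refine fun c _ hc => ⟨trivial, trivial, ?_, ?_⟩
    · grind
    · ext k
      grind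
  · intro c _ hc
    ext k
    grind

theorem move₂ {i o s : ℕ} (hio : i ≠ o) (his : i ≠ s) (hos : o ≠ s) : Computes (fun _ => True)
    fun c => Function.update (Function.update (Function.update c o (c o + c i)) s (c s + c i))
      i 0 := by
  refine loop ((inc o).seq (inc s) fun _ _ => trivial) i (P := fun _ => True) ?_ ?_
  · refine fun c _ hc => ⟨trivial, trivial, ?_, ?_⟩
    · grind
    · ext k
      grind
  · intro c _ hc
    ext k
    grind

theorem copy {i o s : ℕ} (his : i ≠ s) (hos : o ≠ s) : Computes (fun c => c s = 0)
    fun c => Function.update c o (c i) := by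
  by_cases hio : i = o
  · exact id.congr fun c _ => by simp [hio]
  · refine (((clr o).seq (move₂ hio his hos) fun _ _ => trivial).seq (move his.symm)
      fun _ _ => trivial).congr fun c hc => ⟨trivial, ?_⟩
    ext k
    grind

/-- `f` is computed by a program using only registers from `b` on as scratch space. -/
theorem primrec {n : ℕ} {f : List.Vector ℕ n → ℕ} (hf : Nat.Primrec' f) (ins : Fin n → ℕ)
    (out b : ℕ) (hins : ∀ i, ins i < b) (hout : out < b) :
    Computes (fun c => ∀ i, b ≤ i → c i = 0)
      fun c => Function.update c out (f (List.Vector.ofFn fun i => c (ins i))) := by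
  induction hf generalizing out b with
  | zero => exact (clr out).congr fun c _ => ⟨trivial, rfl⟩
  | succ =>
    refine ((copy (i := ins 0) (o := out) (s := b) ?_ ?_).seq (inc out)
      fun _ _ => trivial).congr ?_
    · exact (hins 0).ne
    · exact hout.ne
    · intro c hc
      refine ⟨hc _ le_rfl, ?_⟩
      simp
  | get i =>
    refine (copy (i := ins i) (o := out) (s := b) (hins i).ne hout.ne).congr fun c hc => ?_
    simp [hc]
  | @comp m n f g _ _ ihf ihg =>
    have args : ∀ j ≤ n, Computes (fun c => ∀ i, b ≤ i → c i = 0) fun c k =>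
        if h : b ≤ k ∧ k < b + j ∧ k < b + n then
          g ⟨k - b, by omega⟩ (List.Vector.ofFn fun i => c (ins i)) else c k := by
      intro j
      induction j with
      | zero =>
        refine fun _ => id.congr fun c _ => ⟨trivial, ?_⟩
        ext k
        rw [dif_neg (by omega)]
      | succ j ih =>
        intro hj
        refine ((ih (by omega)).seq (ihg ⟨j, hj⟩ ins (b + j) (b + n)
          (fun i => (hins i).trans_le (by omega)) (by omega)) ?_).congr fun c hc => ⟨hc, ?_⟩
        · intro c hc i hi
          beta_reduce
          rw [dif_neg (by omega)]
          exact hc i (by omega)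
        · have hv : ∀ i, ¬ (b ≤ ins i ∧ ins i < b + j ∧ ins i < b + n) :=
            fun i => by have := hins i; omega
          ext k
          simp only [hv, dite_false]
          by_cases hk : k = b + j
          · subst hk
            rw [Function.update_self, dif_pos (by omega)]
            congr
            simp
          · rw [Function.update_of_ne hk]
            split_ifs <;> first | rfl | omega
    have clean : ∀ j, Computes (fun _ => True) fun c k =>
        if b ≤ k ∧ k < b + j then 0 else c k := by
      intro j
      induction j with
      | zero =>
        refine id.congr fun c _ => ⟨trivial, ?_⟩
        ext k
        rw [if_neg (by omega)]
      | succ j ih =>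
        refine (ih.seq (clr (b + j)) fun _ _ => trivial).congr fun c _ => ⟨trivial, ?_⟩
        ext k
        grind
    refine (((args n le_rfl).seq (ihf (fun i => b + i) out (b + n) (fun i => by omega)
      (by omega)) ?_).seq (clean n) fun _ _ => trivial).congr fun c hc => ⟨hc, ?_⟩
    · intro c hc i hi
      beta_reduce
      rw [dif_neg (by omega)]
      exact hc i (by omega)
    · ext k
      by_cases hk : b ≤ k ∧ k < b + n
      · rw [if_pos hk, Function.update_of_ne (by omega), hc k hk.1]
      · rw [if_neg hk]
        by_cases hko : k = out
        · subst hko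
          rw [Function.update_self, Function.update_self]
          congr
          ext i
          beta_reduce
          rw [dif_pos (by omega)]
          congr
          simp
        · rw [Function.update_of_ne hko, Function.update_of_ne hko, dif_neg (by omega)]
  | @prec n f g _ _ ihf ihg =>
    set V : (ℕ → ℕ) → List.Vector ℕ n := fun c => List.Vector.ofFn fun i => c (ins i.succ) with hV
    have hVc : ∀ c i x, b ≤ i → V (Function.update c i x) = V c := by
      intro c i x hi
      simp only [hV]
      congr
      ext j
      exact Function.update_of_ne (by have := hins j.succ; omega) _ _
    let r : List.Vector ℕ n → ℕ → ℕ := fun v y =>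
      Nat.rec (f v) (fun y IH => g (y ::ᵥ IH ::ᵥ v)) y
    have body := (ihg (Fin.cons (b + 1) (Fin.cons (b + 2) fun i => ins i.succ)) (b + 2) (b + 3)
      (by
        refine Fin.cases ?_ (Fin.cases ?_ fun i => ?_)
        · simp
        · simp
        · have := hins i.succ
          simp
          omega) (by omega)).seq (inc (b + 1)) fun _ _ => trivial
    have hg : ∀ c : ℕ → ℕ, (List.Vector.ofFn fun i =>
        c ((Fin.cons (b + 1) (Fin.cons (b + 2) fun i => ins i.succ) : Fin (n + 2) → ℕ) i)) =
        c (b + 1) ::ᵥ c (b + 2) ::ᵥ V c := by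
      intro c
      simp [List.Vector.ofFn, hV]
    simp only [hg] at body
    have lp : Computes (fun c => (∀ i, b + 3 ≤ i → c i = 0) ∧ c (b + 2) = r (V c) (c (b + 1)))
        fun c => Function.update (Function.update (Function.update c
          (b + 2) (r (V c) (c (b + 1) + c b))) (b + 1) (c (b + 1) + c b)) b 0 := by
      refine body.loop b ?_ ?_
      · rintro c ⟨hc, hr⟩ hb
        have h₁ : ∀ x y z, V (Function.update (Function.update (Function.update c b x)
          (b + 2) y) (b + 1) z) = V c := fun x y z => by
            rw [hVc _ _ _ (by omega), hVc _ _ _ (by omega), hVc _ _ _ le_rfl]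
        have h₂ : ∀ x, V (Function.update c b x) = V c := fun x => hVc _ _ _ le_rfl
        simp only [h₁, h₂]
        refine ⟨fun i hi => ?_, ⟨fun i hi => ?_, ?_⟩, ?_, ?_⟩
        · grind
        · grind
        · simp [r, hr]
        · simp; omega
        · have e : c (b + 1) + 1 + (c b - 1) = c (b + 1) + c b := by omega
          ext k
          simp [e, Function.update_apply]
          grind
      · rintro c ⟨hc, hr⟩ hb
        ext k
        simp only [Function.update_apply, hb, add_zero]
        split_ifs <;> simp_all
    have start : Computes (fun c => ∀ i, b ≤ i → c i = 0) fun c =>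
        Function.update c b (c (ins 0)) :=
      (copy (i := ins 0) (o := b) (s := b + 1) (by have := hins 0; omega) (by omega)).congr
        fun c hc => ⟨hc _ (by omega), rfl⟩
    have main := ((((start.seq (ihf (fun i => ins i.succ) (b + 2) (b + 3)
        (fun i => by have := hins i.succ; omega) (by omega)) (by grind)).seq lp (by
          intro c hc
          rw [hVc _ _ _ (by omega), hVc _ _ _ le_rfl]
          change _ ∧ Function.update (β := fun _ => ℕ) _ _ (f (V _)) _ = _
          rw [hVc _ _ _ le_rfl]
          refine ⟨by grind, ?_⟩
          rw [Function.update_self, Function.update_of_ne (by omega),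
            Function.update_of_ne (by omega), hc _ (by omega)]
          rfl)).seq
      (copy (i := b + 2) (o := out) (s := b + 3) (by omega) (by omega)) (by
        intro c hc
        have := hc (b + 3) (by omega)
        simpa [Function.update_apply] using this)).seq
      ((clr (b + 1)).seq (clr (b + 2)) fun _ _ => trivial) fun _ _ => trivial)
    refine main.congr fun c hc => ⟨hc, ?_⟩
    have hh : List.Vector.ofFn (fun i => c (ins i)) = c (ins 0) ::ᵥ V c := by
      simp [List.Vector.ofFn, hV]
    have hf : ∀ c : ℕ → ℕ, (f (List.Vector.ofFn fun i => c (ins i.succ))) = f (V c) :=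
      fun _ => rfl
    have h₀ := hc b le_rfl
    have h₁ := hc (b + 1) (by omega)
    have h₂ := hc (b + 2) (by omega)
    rw [hh]
    simp only [hf, hVc _ _ _ le_rfl, hVc _ _ _ (Nat.le_add_right b _), List.Vector.head_cons,
      List.Vector.tail_cons]
    change _ = Function.update c out (r (V c) (c (ins 0)))
    ext k
    simp [Function.update_apply, h₁]
    grind

end Computes

theorem exists_machine : ∃ M : AffMachine, ¬ ComputablePred fun n : ℕ => M.Rel (2 ^ n) 0 := by
  let f : ℕ → ℕ → ℕ := fun n k =>
    if (Nat.Partrec.Code.evaln k (Denumerable.ofNat Nat.Partrec.Code n) 0).isSome then 0 else 1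
  have hf : Primrec₂ f := by
    have : Primrec fun a : ℕ × ℕ => ((a.2, Denumerable.ofNat Nat.Partrec.Code a.1), 0) :=
      .pair (.pair .snd ((Primrec.ofNat _).comp .fst)) (.const 0)
    exact Primrec.ite (Primrec.eq.comp (Primrec.option_isSome.comp
      (Nat.Partrec.Code.primrec_evaln.comp this)) (.const true)) (.const 0) (.const 1)
  obtain ⟨R, hR, hRf⟩ := Computes.primrec (Nat.Primrec'.prim_iff₂.2 hf) ![0, 1] 2 3
    (by simp [Fin.forall_fin_two]) (by simp)
  obtain ⟨T, hT, hTR⟩ := ((regRealizable_inc 1).star.comp hR).comp (regRealizable_test 2)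
  obtain ⟨M, hM⟩ := hT.comp (realizable_basic [(1, 1, 1, 0)] (by simp)).star
  have key : ∀ n, M.Rel (2 ^ n) 0 ↔ ∃ k, f n k = 0 := by
    intro n
    have hgo : godel (Finsupp.single 0 n) = 2 ^ n := by simp [godel]
    have hz : ∀ N : ℕ, ReflTransGen
        (fun N N' => ∃ a ∈ [(1, 1, 1, 0)], AffRel a N N') N 0 := by
      intro N
      induction N with
      | zero => rfl
      | succ N ih => exact ih.head (by simp [AffRel])
    have hpath : ∀ e, ReflTransGen (fun c c' => c' = c + Finsupp.single 1 1)
        (Finsupp.single 0 n : ℕ →₀ ℕ) e ↔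
          ∃ k, e = Finsupp.single 0 n + Finsupp.single 1 k := by
      intro e
      constructor
      · intro h
        induction h with
        | refl => exact ⟨0, by simp⟩
        | tail _ h ih =>
          obtain ⟨k, rfl⟩ := ih
          exact ⟨k + 1, by rw [h, Finsupp.single_add, add_assoc]⟩
      · rintro ⟨k, rfl⟩
        induction k with
        | zero => simp; rfl
        | succ k ih => exact ih.tail (by rw [Finsupp.single_add, add_assoc])
    have hpre : ∀ k i, 3 ≤ i → (Finsupp.single 0 n + Finsupp.single 1 k : ℕ →₀ ℕ) i = 0 := by
      intro k i hi
      simp [Finsupp.single_apply]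
      omega
    rw [hM, ← hgo]
    constructor
    · rintro ⟨N, h, -⟩
      obtain ⟨d, -, e, ⟨c, hc, hce⟩, he, -⟩ := (hTR _ _).1 h
      obtain ⟨k, rfl⟩ := (hpath _).1 hc
      obtain ⟨d', hd', hRd⟩ := hRf _ (hpre k)
      obtain rfl := (hRd _).1 hce
      refine ⟨k, ?_⟩
      rw [hd'] at he
      simpa using he
    · rintro ⟨k, hk⟩
      obtain ⟨d, hd, hRd⟩ := hRf _ (hpre k)
      refine ⟨godel d, (hTR _ _).2 ⟨d, rfl, d, ⟨_, (hpath _).2 ⟨k, rfl⟩, (hRd d).2 rfl⟩, ?_, rfl⟩,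
        hz _⟩
      rw [hd]
      simpa using hk
  refine ⟨M, fun h => ComputablePred.halting_problem 0 ?_⟩
  have hc : ManyOneReducible (fun c => (Nat.Partrec.Code.eval c 0).Dom)
      (fun n : ℕ => M.Rel (2 ^ n) 0) := by
    refine ⟨Encodable.encode, Primrec.encode.to_comp, fun c => ?_⟩
    refine Iff.trans ?_ (key _).symm
    change (c.eval 0).Dom ↔ _
    rw [Part.dom_iff_mem]
    simp only [f, Denumerable.ofNat_encode, Nat.Partrec.Code.evaln_complete, ite_eq_left_iff,
      one_ne_zero, imp_false, not_not, Option.isSome_iff_exists, Option.mem_def]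
    exact exists_comm
  exact ComputablePred.computable_of_manyOneReducible hc h

/-- Composable sequences of labelled edges, with the product of their labels. -/
inductive EdgePath {J G : Type*} [Mul G] (E : J → G → J → Prop) : J → G → J → Prop
  | single {σ g τ} : E σ g τ → EdgePath E σ g τ
  | cons {σ g τ h υ} : E σ g τ → EdgePath E τ h υ → EdgePath E σ (g * h) υ

section Block

variable {X J : Type*}

/-- The element `σ g τ⁻¹` of the free group on two kinds of letters. -/
def block (σ : J) (g : FreeGroup X) (τ : J) : FreeGroup (X ⊕ J) :=
  FreeGroup.of (.inr σ) * FreeGroup.map Sum.inl g * (FreeGroup.of (.inr τ))⁻¹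

/-- The word `σ l τ⁻¹ V`. -/
def blockWord (σ : J) (l : List (X × Bool)) (τ : J) (V : List ((X ⊕ J) × Bool)) :
    List ((X ⊕ J) × Bool) :=
  (.inr σ, true) :: (l.map (fun p => (.inl p.1, p.2)) ++ (.inr τ, false) :: V)

theorem isReduced_blockWord {σ τ : J} {l : List (X × Bool)} {V : List ((X ⊕ J) × Bool)}
    (hl : FreeGroup.IsReduced l) (h : l = [] → σ ≠ τ)
    (hV : FreeGroup.IsReduced ((Sum.inr τ, false) :: V)) :
    FreeGroup.IsReduced (blockWord σ l τ V) := by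
  cases l with
  | nil =>
    simp only [blockWord, List.map_nil, List.nil_append, FreeGroup.IsReduced,
      List.isChain_cons_cons] at hV ⊢
    exact ⟨fun e => absurd (Sum.inr_injective e) (h rfl), hV⟩
  | cons p l =>
    clear h
    simp only [blockWord, List.map_cons, List.cons_append, FreeGroup.IsReduced,
      List.isChain_cons_cons] at hV ⊢
    refine ⟨by simp, ?_⟩
    induction l generalizing p with
    | nil => simpa using hV
    | cons q l ih =>
      simp only [FreeGroup.IsReduced, List.isChain_cons_cons] at hl
      simp only [List.map_cons, List.cons_append, List.isChain_cons_cons]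
      exact ⟨fun e => hl.1 (Sum.inl_injective e), ih q hl.2⟩

theorem mk_blockWord [DecidableEq X] (σ τ : J) (g : FreeGroup X) (V : List ((X ⊕ J) × Bool)) :
    FreeGroup.mk (blockWord σ g.toWord τ V) =
      FreeGroup.of (.inr σ) * FreeGroup.map Sum.inl g * FreeGroup.mk ((.inr τ, false) :: V) := by
  conv_rhs => rw [← FreeGroup.mk_toWord (x := g)]
  rw [FreeGroup.map.mk, FreeGroup.of, FreeGroup.mul_mk, FreeGroup.mul_mk]
  rfl

theorem blockWord_eq {σ τ σ₀ τ₀ : J} {l l₀ : List (X × Bool)} {V : List ((X ⊕ J) × Bool)}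
    (h : blockWord σ l τ V = blockWord σ₀ l₀ τ₀ []) : σ = σ₀ ∧ l = l₀ ∧ τ = τ₀ ∧ V = [] := by
  simp only [blockWord, List.cons.injEq, Prod.mk.injEq, Sum.inr.injEq, and_true] at h
  refine ⟨h.1, ?_⟩
  replace h := h.2
  induction l generalizing l₀ with
  | nil =>
    cases l₀ with
    | nil => simpa using h
    | cons => simp at h
  | cons p l ih =>
    cases l₀ with
    | nil => simp at h
    | cons q l₀ =>
      simp only [List.map_cons, List.cons_append, List.cons.injEq, Prod.mk.injEq,
        Sum.inl.injEq] at h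
      obtain ⟨rfl, rfl, rfl⟩ := ih h.2
      exact ⟨by rw [Prod.ext h.1.1 h.1.2], rfl, rfl⟩

variable {G : Type*} [Group G] {E : J → FreeGroup X × G → J → Prop}

theorem edgePath_of_mem_closure
    (hE : ∀ σ g, EdgePath E σ g σ → g.1 ≠ 1) {σ₀ τ₀ : J} {g₀ : FreeGroup X} {h₀ : G}
    (hne : σ₀ ≠ τ₀)
    (hmem : (block σ₀ g₀ τ₀, h₀) ∈ Submonoid.closure
      {x : FreeGroup (X ⊕ J) × G | ∃ σ e τ, E σ e τ ∧ x = (block σ e.1 τ, e.2)}) :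
    EdgePath E σ₀ (g₀, h₀) τ₀ := by
  classical
  have hne' : ∀ σ g τ, EdgePath E σ g τ → g.1.toWord = [] → σ ≠ τ := by
    rintro σ g _ hp hg rfl
    exact hE _ _ hp (FreeGroup.toWord_eq_nil_iff.1 hg)
  have key : ∀ x ∈ Submonoid.closure
      {x : FreeGroup (X ⊕ J) × G | ∃ σ e τ, E σ e τ ∧ x = (block σ e.1 τ, e.2)},
      x = 1 ∨ ∃ σ g τ V, EdgePath E σ g τ ∧ FreeGroup.IsReduced ((Sum.inr τ, false) :: V) ∧
        x.1 = FreeGroup.mk (blockWord σ g.1.toWord τ V) ∧ (V = [] → x.2 = g.2) := by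
    intro x hx
    induction hx using Submonoid.closure_induction_left with
    | one => exact .inl rfl
    | mul_left x hx y hy ih =>
      obtain ⟨σ, e, τ, he, rfl⟩ := hx
      right
      obtain rfl | ⟨σ₁, g, τ₁, V, hp, hV, hy₁, hy₂⟩ := ih
      · refine ⟨σ, e, τ, [], .single he, FreeGroup.IsReduced.singleton, ?_, fun _ => by simp⟩
        rw [mk_blockWord]
        simp [block, FreeGroup.of, FreeGroup.inv_mk, FreeGroup.invRev]
      · by_cases hτ : τ = σ₁
        · subst hτ
          refine ⟨σ, e * g, τ₁, V, .cons he hp, hV, ?_, fun h => by simp [hy₂ h]⟩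
          rw [mk_blockWord] at hy₁ ⊢
          simp [hy₁, block, mul_assoc]
        · refine ⟨σ, e, τ, blockWord σ₁ g.1.toWord τ₁ V, .single he, ?_, ?_, ?_⟩
          · have := isReduced_blockWord FreeGroup.isReduced_toWord (hne' _ _ _ hp) hV
            simp only [blockWord, FreeGroup.IsReduced, List.isChain_cons_cons] at this ⊢
            exact ⟨fun e => absurd (Sum.inr_injective e) hτ, this⟩
          · rw [mk_blockWord, Prod.fst_mul, hy₁, block, mul_assoc _ _ (FreeGroup.mk _),
              FreeGroup.of, FreeGroup.of, FreeGroup.inv_mk, FreeGroup.mul_mk]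
            rfl
          · simp [blockWord]
  have hw : block σ₀ g₀ τ₀ = FreeGroup.mk (blockWord σ₀ g₀.toWord τ₀ []) := by
    rw [mk_blockWord]
    simp [block, FreeGroup.of, FreeGroup.inv_mk, FreeGroup.invRev]
  have hr := isReduced_blockWord (FreeGroup.isReduced_toWord (x := g₀)) (fun _ => hne)
    (FreeGroup.IsReduced.singleton (a := (Sum.inr τ₀, false)))
  obtain h | ⟨σ, g, τ, V, hp, hV, hx, hx'⟩ := key _ hmem
  · have := congrArg (fun x => x.1.toWord) h
    simp only [hw, FreeGroup.toWord_mk, hr.reduce_eq] at this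
    simp [blockWord] at this
  · have hr' := isReduced_blockWord FreeGroup.isReduced_toWord (hne' _ _ _ hp) hV
    have := congrArg FreeGroup.toWord hx
    simp only [hw, FreeGroup.toWord_mk, hr.reduce_eq, hr'.reduce_eq] at this
    obtain ⟨rfl, h, rfl, rfl⟩ := blockWord_eq this.symm
    have : (g₀, h₀) = g := Prod.ext (FreeGroup.toWord_injective h.symm) (hx' rfl)
    rw [this]
    exact hp

end Block

/-- Vertices of the graph of a machine: states, rules, and a sink. -/
abbrev AffMachine.Vertex (M : AffMachine) : Type :=
  Option (M.State ⊕ (M.State × (ℕ × ℕ × ℕ × ℕ) × M.State))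

/-- The graph of a machine, labelled by elements of a group with chosen elements `A B C D`. -/
inductive AffMachine.Edge (M : AffMachine) {W : Type*} [Group W] (A B C D : W) :
    M.Vertex → W → M.Vertex → Prop
  | enter (ρ) : ρ ∈ M.rules → Edge M A B C D (some (.inl ρ.1)) A (some (.inr ρ))
  | iterate (ρ) : ρ ∈ M.rules →
    Edge M A B C D (some (.inr ρ)) (B ^ ρ.2.1.1 * C ^ ρ.2.1.2.2.1) (some (.inr ρ))
  | leave (ρ) : ρ ∈ M.rules →
    Edge M A B C D (some (.inr ρ)) (B ^ ρ.2.1.2.1 * C ^ ρ.2.1.2.2.2 * D) (some (.inl ρ.2.2))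
  | halt : Edge M A B C D (some (.inl M.final)) 1 none
  | cancel₁ : Edge M A B C D none (B * C)⁻¹ none
  | cancel₂ : Edge M A B C D none (A * D)⁻¹ none

/-- `x ^ n y x ^ n₁ y ⋯ y x ^ nₖ`, for a head exponent and a list of further exponents. -/
def sepPow {W : Type*} [Monoid W] (x y : W) : ℕ → List ℕ → W
  | n, [] => x ^ n
  | n, k :: l => x ^ n * y * sepPow x y k l

theorem map_sepPow {V W : Type*} [Monoid V] [Monoid W] (φ : V →* W) (x y : V) (n : ℕ)
    (l : List ℕ) : φ (sepPow x y n l) = sepPow (φ x) (φ y) n l := by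
  induction l generalizing n with
  | nil => simp [sepPow]
  | cons k l ih => simp [sepPow, ih]

theorem exists_sepPow_mul_left {W : Type*} [Monoid W] (x y : W) (n : ℕ) (l : List ℕ) :
    ∃ n' l', sepPow x y n l * x = sepPow x y n' l' := by
  induction l generalizing n with
  | nil => exact ⟨n + 1, [], by simp [sepPow, pow_succ]⟩
  | cons k l ih =>
    obtain ⟨n', l', h⟩ := ih k
    exact ⟨n, n' :: l', by simp [sepPow, ← h, mul_assoc]⟩

theorem sepPow_mul_right {W : Type*} [Monoid W] (x y : W) (n : ℕ) (l : List ℕ) :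
    sepPow x y n l * y = sepPow x y n (l ++ [0]) := by
  induction l generalizing n with
  | nil => simp [sepPow]
  | cons k l ih => simp [sepPow, ← ih, mul_assoc]

theorem mk_positive_injective {X : Type*} :
    Function.Injective fun l : List X => FreeGroup.mk (l.map fun x => (x, true)) := by
  classical
  intro l l' h
  have hr : ∀ l : List X, FreeGroup.IsReduced (l.map fun x => (x, true)) := by
    intro l
    rw [FreeGroup.IsReduced, List.isChain_map]
    exact List.Pairwise.isChain (List.pairwise_of_forall fun _ _ _ => rfl)
  have := congrArg FreeGroup.toWord h
  simp only [FreeGroup.toWord_mk, (hr _).reduce_eq] at this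
  exact List.map_injective_iff.2 (fun x y h => (Prod.mk.inj h).1) this

/-- The positive word spelling `sepPow`. -/
def sepList (e f : ℕ) : ℕ → List ℕ → List Bool
  | n, [] => List.replicate (e * n) false
  | n, k :: l => List.replicate (e * n) false ++ (List.replicate f true ++ sepList e f k l)

theorem mk_sepList (e f n : ℕ) (l : List ℕ) :
    FreeGroup.mk ((sepList e f n l).map fun x => (x, true)) =
      sepPow (FreeGroup.of false ^ e) (FreeGroup.of true ^ f) n l := by
  have hp : ∀ (x : Bool) k, FreeGroup.mk (List.replicate k (x, true)) = FreeGroup.of x ^ k := by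
    intro x k
    induction k with
    | zero => rfl
    | succ k ih => rw [pow_succ', ← ih, FreeGroup.of, FreeGroup.mul_mk]; rfl
  induction l generalizing n with
  | nil => simp [sepList, sepPow, hp, pow_mul]
  | cons k l ih =>
    simp only [sepList, sepPow, List.map_append, List.map_replicate, ← FreeGroup.mul_mk, hp, ih,
      pow_mul, mul_assoc]

theorem replicate_append_inj {a b : ℕ} {l l' : List Bool} (hl : l.head? ≠ some false)
    (hl' : l'.head? ≠ some false)
    (h : List.replicate a false ++ l = List.replicate b false ++ l') : a = b ∧ l = l' := by
  induction a generalizing b with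
  | zero =>
    cases b with
    | zero => simpa using h
    | succ b =>
      rw [List.replicate_zero, List.nil_append] at h
      simp [h, List.replicate_succ] at hl
  | succ a ih =>
    cases b with
    | zero =>
      rw [List.replicate_zero, List.nil_append] at h
      simp [← h, List.replicate_succ] at hl'
    | succ b =>
      simp only [List.replicate_succ, List.cons_append, List.cons.injEq, true_and] at h
      simpa using ih h

theorem sepList_inj {e f : ℕ} (he : 0 < e) (hf : 0 < f) {n n' : ℕ} {l l' : List ℕ}
    (h : sepList e f n l = sepList e f n' l') : n = n' ∧ l = l' := by
  have hd : ∀ X : List Bool, (List.replicate f true ++ X).head? = some true := by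
    intro X
    obtain ⟨f, rfl⟩ := Nat.exists_eq_add_of_lt hf
    simp [List.replicate_succ]
  induction l generalizing n n' l' with
  | nil =>
    cases l' with
    | nil =>
      simp only [sepList] at h
      simpa [he.ne'] using congrArg List.length h
    | cons k l' =>
      rw [sepList, sepList, ← List.append_nil (List.replicate (e * n) false)] at h
      have := congrArg List.head? (replicate_append_inj (by simp) (by simp [hd]) h).2
      simp [hd] at this
  | cons k l ih =>
    cases l' with
    | nil =>
      rw [sepList, sepList, ← List.append_nil (List.replicate (e * n') false)] at h
      have := congrArg List.head? (replicate_append_inj (by simp [hd]) (by simp) h).2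
      simp [hd] at this
    | cons k' l' =>
      rw [sepList, sepList] at h
      obtain ⟨h₁, h₂⟩ := replicate_append_inj (by simp [hd]) (by simp [hd]) h
      obtain ⟨rfl, rfl⟩ := ih (List.append_cancel_left h₂)
      exact ⟨Nat.eq_of_mul_eq_mul_left he h₁, rfl⟩

theorem sepPow_inj {e f : ℕ} (he : 0 < e) (hf : 0 < f) {n n' : ℕ} {l l' : List ℕ}
    (h : sepPow (FreeGroup.of false ^ e) (FreeGroup.of true ^ f) n l =
      sepPow (FreeGroup.of false ^ e) (FreeGroup.of true ^ f) n' l') : n = n' ∧ l = l' := by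
  rw [← mk_sepList, ← mk_sepList] at h
  exact sepList_inj he hf (mk_positive_injective h)

namespace AffMachine

variable (M : AffMachine)

/-- Sequences of pairs of register contents related by successive rules leading to the final
state. -/
inductive Runs : M.State → List (ℕ × ℕ) → Prop
  | nil : Runs M.final []
  | cons {q a q' p l} : (q, a, q') ∈ M.rules → AffRel a p.1 p.2 → Runs q' l → Runs q (p :: l)

theorem Runs.reach {M : AffMachine} {q : M.State} {l : List (ℕ × ℕ)} (h : M.Runs q l) {N : ℕ}
    (hl : l.map Prod.fst ++ [0] = N :: l.map Prod.snd) :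
    ReflTransGen M.Step (q, N) (M.final, 0) := by
  induction h generalizing N with
  | nil =>
    obtain rfl : 0 = N := by simpa using hl
    exact .refl
  | @cons q a q' p l hr ha _ ih =>
    simp only [List.map_cons, List.cons_append, List.cons.injEq] at hl
    exact (ih hl.2).head ⟨a, hr, hl.1 ▸ ha⟩

/-- The labels of the graph in a product of free groups. -/
abbrev FreeEdge (m f : ℕ) : M.Vertex → FreeGroup Bool × FreeGroup Bool → M.Vertex → Prop :=
  M.Edge (FreeGroup.of true ^ m, 1) (1, FreeGroup.of false ^ f) (FreeGroup.of false, 1)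
    (1, FreeGroup.of true ^ f)

variable {M} {m f : ℕ}

theorem fst_ne_one_of_edgePath (hm : 2 ≤ m) {σ : M.Vertex} {g}
    (h : EdgePath (M.FreeEdge m f) σ g σ) : g.1 ≠ 1 := by
  let len : FreeGroup Bool →* Multiplicative ℤ := FreeGroup.lift fun _ => Multiplicative.ofAdd 1
  let pot : M.State ⊕ (M.State × (ℕ × ℕ × ℕ × ℕ) × M.State) → ℤ := Sum.elim 0 1
  let Good : M.Vertex → FreeGroup Bool × FreeGroup Bool → M.Vertex → Prop := fun σ g τ =>
    match σ, τ with
    | none, none => (len g.1).toAdd < 0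
    | none, some _ => False
    | some _, none => True
    | some x, some y => pot y < pot x + (len g.1).toAdd
  have edge : ∀ σ g τ, M.FreeEdge m f σ g τ → Good σ g τ := by
    intro σ g τ h
    cases h with
    | enter ρ h => simp [Good, pot, len]; omega
    | iterate ρ h => have := M.pos ρ h; simp [Good, pot, len]; omega
    | leave ρ h => simp [Good, pot, len]; omega
    | halt => trivial
    | cancel₁ => simp [Good, len]
    | cancel₂ => simp [Good, len]; omega
  have path : ∀ σ g τ, EdgePath (M.FreeEdge m f) σ g τ → Good σ g τ := by
    intro σ g τ h
    induction h with
    | single h => exact edge _ _ _ h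
    | @cons σ g τ h υ he _ ih =>
      have := edge _ _ _ he
      rcases σ with _ | σ <;> rcases τ with _ | τ <;> rcases υ with _ | υ <;>
        simp [Good] at this ih ⊢ <;> omega
  intro hg
  have := path _ _ _ h
  rcases σ with _ | σ <;> simp [Good, hg] at this

/-- The label of the part of a path that simulates a run. -/
def runLabel {W : Type*} [Group W] (A B C D : W) (l : List (ℕ × ℕ)) : W :=
  (l.map fun p => A * (B ^ p.1 * C ^ p.2 * D)).prod

theorem exists_runs_of_edgePath {W : Type*} [Group W] {A B C D : W} (hBC : Commute B C)
    {q : M.State} {g : W} (h : EdgePath (M.Edge A B C D) (some (.inl q)) g none) :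
    ∃ l, M.Runs q l ∧ ∃ n l', g = runLabel A B C D l * (sepPow (B * C) (A * D) n l')⁻¹ := by
  let Good : M.Vertex → W → Prop := fun σ g =>
    match σ with
    | none => ∃ n l, g = (sepPow (B * C) (A * D) n l)⁻¹
    | some (.inl q) => ∃ l, M.Runs q l ∧ ∃ n l',
        g = runLabel A B C D l * (sepPow (B * C) (A * D) n l')⁻¹
    | some (.inr ρ) => ∃ t l, M.Runs ρ.2.2 l ∧ ∃ n l', g =
        B ^ (ρ.2.1.1 * t + ρ.2.1.2.1) * C ^ (ρ.2.1.2.2.1 * t + ρ.2.1.2.2.2) * D *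
          runLabel A B C D l * (sepPow (B * C) (A * D) n l')⁻¹
  suffices good : ∀ σ g, EdgePath (M.Edge A B C D) σ g none → Good σ g from good _ _ h
  intro σ g h
  generalize hτ : (none : M.Vertex) = τ at h
  induction h with
  | single h =>
    subst hτ
    cases h with
    | halt => exact ⟨[], .nil, 0, [], by simp [runLabel, sepPow]⟩
    | cancel₁ => exact ⟨1, [], by simp [sepPow]⟩
    | cancel₂ => exact ⟨0, [0], by simp [sepPow]⟩
  | cons h _ ih =>
    replace ih := ih hτ
    cases h with
    | enter ρ h =>
      obtain ⟨t, l, hl, n, l', rfl⟩ := ih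
      refine ⟨(_, _) :: l, .cons h ⟨t, rfl, rfl⟩ hl, n, l', ?_⟩
      simp [runLabel, mul_assoc]
    | iterate ρ h =>
      obtain ⟨t, l, hl, n, l', rfl⟩ := ih
      refine ⟨t + 1, l, hl, n, l', ?_⟩
      have e : ∀ P Q r s : ℕ, B ^ P * C ^ Q * (B ^ (P * t + r) * C ^ (Q * t + s)) =
          B ^ (P * (t + 1) + r) * C ^ (Q * (t + 1) + s) := by
        intro P Q r s
        rw [(hBC.symm.pow_pow Q (P * t + r)).mul_mul_mul_comm, ← pow_add, ← pow_add]
        congr 2 <;> ring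
      rw [← e]
      simp only [mul_assoc]
    | leave ρ h =>
      obtain ⟨l, hl, n, l', rfl⟩ := ih
      exact ⟨0, l, hl, n, l', by simp [mul_assoc]⟩
    | halt =>
      obtain ⟨n, l, rfl⟩ := ih
      exact ⟨[], .nil, n, l, by simp [runLabel]⟩
    | cancel₁ =>
      obtain ⟨n, l, rfl⟩ := ih
      obtain ⟨n', l', e⟩ := exists_sepPow_mul_left (B * C) (A * D) n l
      exact ⟨n', l', by rw [← e]; group⟩
    | cancel₂ =>
      obtain ⟨n, l, rfl⟩ := ih
      exact ⟨n, l ++ [0], by rw [← sepPow_mul_right]; group⟩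

/-- The list of exponents of the second component of a run. -/
theorem exists_sepPow_eq {W : Type*} [Monoid W] (x y : W) (l : List (ℕ × ℕ)) :
    ∃ n l', l.map Prod.fst ++ [0] = n :: l' ∧
      (l.map fun p => x ^ p.1 * y).prod = sepPow x y n l' := by
  induction l with
  | nil => exact ⟨0, [], rfl, by simp [sepPow]⟩
  | cons p l ih =>
    obtain ⟨n, l', h, h'⟩ := ih
    exact ⟨p.1, n :: l', by simp [h], by simp [sepPow, h']⟩

theorem sepPow_eq_mul_prod {W : Type*} [Monoid W] (x y : W) (N : ℕ) (l : List (ℕ × ℕ)) :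
    x ^ N * (l.map fun p => y * x ^ p.2).prod = sepPow x y N (l.map Prod.snd) := by
  induction l generalizing N with
  | nil => simp [sepPow]
  | cons p l ih => simp [sepPow, ← ih, mul_assoc]

theorem reach_of_edgePath (hm : 0 < m) (hf : 0 < f) {N : ℕ}
    (h : EdgePath (M.FreeEdge m f) (some (.inl M.init)) ((FreeGroup.of false ^ N)⁻¹, 1) none) :
    M.Rel N 0 := by
  obtain ⟨l, hl, n, l', hg⟩ := exists_runs_of_edgePath (by simp [Commute, SemiconjBy]) h
  rw [eq_mul_inv_iff_mul_eq] at hg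
  have h₁ := congrArg (MonoidHom.fst _ _) hg
  have h₂ := congrArg (MonoidHom.snd _ _) hg
  simp only [runLabel, map_mul, map_sepPow, map_list_prod, List.map_map, Function.comp_def,
    MonoidHom.coe_fst, MonoidHom.coe_snd, Prod.fst_mul, Prod.snd_mul, Prod.pow_fst, Prod.pow_snd,
    one_mul, mul_one, one_pow] at h₁ h₂
  rw [inv_mul_eq_iff_eq_mul, sepPow_eq_mul_prod] at h₁
  obtain ⟨k, l'', e, e'⟩ := exists_sepPow_eq (FreeGroup.of false ^ f) (FreeGroup.of true ^ f) l
  rw [e'] at h₂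
  obtain ⟨rfl, rfl⟩ := sepPow_inj hf hf h₂
  rw [← pow_one (FreeGroup.of false)] at h₁
  obtain ⟨rfl, rfl⟩ := sepPow_inj one_pos hm h₁
  exact hl.reach e

end AffMachine

namespace AffMachine

variable {M : AffMachine} {W : Type*} [Group W] {A B C D : W} {S : M.Vertex → W}

/-- The generating set attached to the graph of a machine and a choice of vertex elements. -/
def generators (M : AffMachine) (A B C D : W) (S : M.Vertex → W) : Set W :=
  {x | ∃ σ g τ, M.Edge A B C D σ g τ ∧ x = S σ * g * (S τ)⁻¹}

theorem finite_generators : (M.generators A B C D S).Finite := by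
  let F : List (M.Vertex × W × M.Vertex) :=
    M.rules.map (fun ρ => (some (.inl ρ.1), A, some (.inr ρ))) ++
    M.rules.map (fun ρ => (some (.inr ρ), B ^ ρ.2.1.1 * C ^ ρ.2.1.2.2.1, some (.inr ρ))) ++
    M.rules.map (fun ρ => (some (.inr ρ), B ^ ρ.2.1.2.1 * C ^ ρ.2.1.2.2.2 * D,
      some (.inl ρ.2.2))) ++
    [(some (.inl M.final), 1, none), (none, (B * C)⁻¹, none), (none, (A * D)⁻¹, none)]
  have hF : ∀ σ g τ, M.Edge A B C D σ g τ → (σ, g, τ) ∈ F := by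
    intro σ g τ h
    simp only [F, List.mem_append, List.mem_map, List.mem_cons]
    cases h with
    | enter ρ h => exact .inl (.inl (.inl ⟨ρ, h, rfl⟩))
    | iterate ρ h => exact .inl (.inl (.inr ⟨ρ, h, rfl⟩))
    | leave ρ h => exact .inl (.inr ⟨ρ, h, rfl⟩)
    | halt => exact .inr (.inl rfl)
    | cancel₁ => exact .inr (.inr (.inl rfl))
    | cancel₂ => exact .inr (.inr (.inr (.inl rfl)))
  refine ((F.finite_toSet).image fun e => S e.1 * e.2.1 * (S e.2.2)⁻¹).subset ?_
  rintro _ ⟨σ, g, τ, h, rfl⟩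
  exact ⟨(σ, g, τ), hF _ _ _ h, rfl⟩

theorem mem_closure_of_rel (hAB : Commute A B) (hBC : Commute B C) (hCD : Commute C D) {N : ℕ}
    (h : M.Rel N 0) : S (some (.inl M.init)) * (C ^ N)⁻¹ * (S none)⁻¹ ∈
      Submonoid.closure (M.generators A B C D S) := by
  set K := Submonoid.closure (M.generators A B C D S) with hK
  let Good : M.Vertex → W → M.Vertex → Prop := fun σ g τ => S σ * g * (S τ)⁻¹ ∈ K
  have edge : ∀ {σ g τ}, M.Edge A B C D σ g τ → Good σ g τ :=
    fun h => Submonoid.subset_closure ⟨_, _, _, h, rfl⟩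
  have trans : ∀ {σ g τ h υ}, Good σ g τ → Good τ h υ → Good σ (g * h) υ := by
    intro σ g τ h υ h₁ h₂
    simpa [Good, mul_assoc] using K.mul_mem h₁ h₂
  have pow : ∀ {σ g} k, Good σ g σ → Good σ (g ^ k) σ := by
    intro σ g k h
    induction k with
    | zero => simp [Good]
    | succ k ih => rw [pow_succ]; exact trans ih h
  suffices key : ∀ x : M.State × ℕ, ReflTransGen M.Step x (M.final, 0) →
      Good (some (.inl x.1)) (C ^ x.2)⁻¹ none from key _ h
  intro x h
  induction h using ReflTransGen.head_induction_on with
  | refl => simpa using edge .halt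
  | @head x y hxy _ ih =>
    obtain ⟨q, N⟩ := x
    obtain ⟨q', N'⟩ := y
    obtain ⟨⟨P, r, Q, s⟩, hr, t, rfl, rfl⟩ := hxy
    have := trans (trans (trans (trans (trans (edge (.enter _ hr)) (pow t (edge (.iterate _ hr))))
      (edge (.leave _ hr))) ih) (edge .cancel₂)) (pow (P * t + r) (edge .cancel₁))
    convert this using 1
    simp only at *
    rw [(hBC.pow_pow P Q).mul_pow, ← pow_mul, ← pow_mul, inv_pow, hBC.mul_pow]
    have e : B ^ (P * t) * C ^ (Q * t) * (B ^ r * C ^ s * D) =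
        B ^ (P * t + r) * (D * C ^ (Q * t + s)) := by
      rw [← mul_assoc, (hBC.symm.pow_pow (Q * t) r).mul_mul_mul_comm, ← pow_add, ← pow_add,
        mul_assoc, (hCD.pow_left _).eq]
    rw [mul_assoc A, e]
    have e' := (hAB.pow_right (P * t + r)).eq
    rw [← mul_inv_eq_iff_eq_mul] at e'
    calc _ = (B ^ (P * t + r)) * (C ^ (P * t + r))⁻¹ * (B ^ (P * t + r))⁻¹ := by
          rw [((hBC.pow_pow (P * t + r) (P * t + r)).inv_right).eq]
          group
      _ = A * B ^ (P * t + r) * A⁻¹ * (C ^ (P * t + r))⁻¹ * (B ^ (P * t + r))⁻¹ := by rw [e']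
      _ = _ := by group

theorem rel_of_mem_closure {m f : ℕ} (hm : 2 ≤ m) (hf : 0 < f)
    (T : Subgroup (W × FreeGroup (Bool ⊕ M.Vertex) × FreeGroup Bool))
    (hT : ∀ p, (1, p) ∈ T → p = 1)
    (hA : (A, FreeGroup.of (.inl true) ^ m, 1) ∈ T) (hB : (B, 1, FreeGroup.of false ^ f) ∈ T)
    (hC : (C, FreeGroup.of (.inl false), 1) ∈ T) (hD : (D, 1, FreeGroup.of true ^ f) ∈ T)
    (hS : ∀ σ, (S σ, FreeGroup.of (.inr σ), 1) ∈ T) {N : ℕ}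
    (h : S (some (.inl M.init)) * (C ^ N)⁻¹ * (S none)⁻¹ ∈
      Submonoid.closure (M.generators A B C D S)) : M.Rel N 0 := by
  have edge : ∀ σ g τ, M.Edge A B C D σ g τ → ∃ e, M.FreeEdge m f σ e τ ∧
      (g, FreeGroup.map Sum.inl e.1, e.2) ∈ T := by
    intro σ g τ h
    cases h with
    | enter ρ h => exact ⟨_, .enter ρ h, by simpa using hA⟩
    | iterate ρ h =>
      refine ⟨_, .iterate ρ h, ?_⟩
      simpa using T.mul_mem (T.pow_mem hB _) (T.pow_mem hC _)
    | leave ρ h =>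
      refine ⟨_, .leave ρ h, ?_⟩
      simpa using T.mul_mem (T.mul_mem (T.pow_mem hB _) (T.pow_mem hC _)) hD
    | halt => exact ⟨_, .halt, by simp only [Prod.fst_one, Prod.snd_one, map_one]; exact T.one_mem⟩
    | cancel₁ =>
      refine ⟨_, .cancel₁, ?_⟩
      simpa using T.inv_mem (T.mul_mem hB hC)
    | cancel₂ =>
      refine ⟨_, .cancel₂, ?_⟩
      simpa using T.inv_mem (T.mul_mem hA hD)
  have key : ∀ x ∈ Submonoid.closure (M.generators A B C D S), ∃ p ∈ Submonoid.closure
      {x : FreeGroup (Bool ⊕ M.Vertex) × FreeGroup Bool |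
        ∃ σ e τ, M.FreeEdge m f σ e τ ∧ x = (block σ e.1 τ, e.2)}, (x, p) ∈ T := by
    intro x hx
    induction hx using Submonoid.closure_induction with
    | mem x hx =>
      obtain ⟨σ, g, τ, hg, rfl⟩ := hx
      obtain ⟨e, he, heT⟩ := edge _ _ _ hg
      refine ⟨_, Submonoid.subset_closure ⟨σ, e, τ, he, rfl⟩, ?_⟩
      simpa [block] using T.mul_mem (T.mul_mem (hS σ) heT) (T.inv_mem (hS τ))
    | one => exact ⟨1, one_mem _, T.one_mem⟩
    | mul x y _ _ hx hy =>
      obtain ⟨p, hp, hx⟩ := hx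
      obtain ⟨q, hq, hy⟩ := hy
      exact ⟨p * q, mul_mem hp hq, T.mul_mem hx hy⟩
  obtain ⟨p, hp, hpT⟩ := key _ h
  have hq := T.mul_mem (T.mul_mem (hS (some (.inl M.init))) (T.inv_mem (T.pow_mem hC N)))
    (T.inv_mem (hS none))
  obtain rfl : p = (block (some (.inl M.init)) (FreeGroup.of false ^ N)⁻¹ none, 1) := by
    rw [← mul_inv_eq_one]
    refine hT _ ?_
    simpa [block] using T.mul_mem hpT (T.inv_mem hq)
  exact reach_of_edgePath (by omega) hf
    (edgePath_of_mem_closure (fun σ g h => fst_ne_one_of_edgePath hm h) (by simp) hp)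

end AffMachine

section Words

variable {k : ℕ} {G : Type*} [Group G] (gen : Fin k → G)

theorem evalGrpWord_append (u v : List (Fin k × Bool)) :
    evalGrpWord gen (u ++ v) = evalGrpWord gen u * evalGrpWord gen v := by
  simp [evalGrpWord]

theorem exists_evalGrpWord_eq {rels : Set (FreeGroup (Fin k))} (g : PresentedGroup rels) :
    ∃ w, evalGrpWord (fun i => PresentedGroup.of (rels := rels) i) w = g := by
  obtain ⟨z, rfl⟩ := PresentedGroup.mk_surjective rels g
  induction z using FreeGroup.induction_on with
  | C1 => exact ⟨[], by simp [evalGrpWord]⟩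
  | of i => exact ⟨[(i, false)], by simp [evalGrpWord]; rfl⟩
  | inv_of i _ => exact ⟨[(i, true)], by simp [evalGrpWord]; rfl⟩
  | mul x y hx hy =>
    obtain ⟨u, hu⟩ := hx
    obtain ⟨v, hv⟩ := hy
    exact ⟨u ++ v, by rw [evalGrpWord_append, hu, hv, map_mul]⟩

theorem exists_computable_word {rels : Set (FreeGroup (Fin k))} (x c y : PresentedGroup rels) :
    ∃ W : ℕ → List (Fin k × Bool), Computable W ∧ ∀ j,
      evalGrpWord (fun i => PresentedGroup.of (rels := rels) i) (W j) = x * c ^ 2 ^ j * y := by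
  obtain ⟨u, hu⟩ := exists_evalGrpWord_eq x
  obtain ⟨w, hw⟩ := exists_evalGrpWord_eq c
  obtain ⟨v, hv⟩ := exists_evalGrpWord_eq y
  let P : ℕ → List (Fin k × Bool) := fun j => Nat.rec w (fun _ l => l ++ l) j
  have hP : Primrec P :=
    Primrec.nat_rec₁ w (Primrec.list_append.comp Primrec.snd Primrec.snd)
  refine ⟨fun j => u ++ P j ++ v, Primrec.to_comp (Primrec.list_append.comp
    (Primrec.list_append.comp (.const u) hP) (.const v)), fun j => ?_⟩
  rw [evalGrpWord_append, evalGrpWord_append, hu, hv]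
  congr 2
  induction j with
  | zero => simpa [P] using hw
  | succ j ih => rw [pow_succ, pow_mul, ← ih, pow_two, ← evalGrpWord_append]

end Words

section Presentation

variable {m n : ℕ}

/-- The generator `a`. -/
abbrev genA (m n : ℕ) : Mmn m n := PresentedGroup.of 0

/-- The element `b a ^ n`. -/
abbrev genX (m n : ℕ) : Mmn m n := PresentedGroup.of 1 * genA m n ^ n

theorem genX_pow_mul : genX m n ^ m * (genA m n ^ n * genX m n * (genA m n ^ n)⁻¹) ^ m = 1 := by
  have h := PresentedGroup.one_of_mem (rels := mmnRels m n) rfl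
  simp only [map_mul, map_pow] at h
  rw [← h]
  congr 2
  simp only [genX, ← mul_assoc, mul_inv_cancel_right]
  rfl

theorem exists_hom {H : Type*} [Group H] (a x : H) (h : x ^ m * (a ^ n * x * (a ^ n)⁻¹) ^ m = 1) :
    ∃ φ : Mmn m n →* H, φ (genA m n) = a ∧ φ (genX m n) = x := by
  refine ⟨PresentedGroup.toGroup (f := ![a, x * (a ^ n)⁻¹]) ?_, ?_, ?_⟩
  · rintro _ rfl
    simpa [← mul_assoc] using h
  · simp
  · simp

end Presentation

section Tracking

variable {m n : ℕ}

/-- The partial action of the pairs in a subgroup of `G × Perm Z` on an embedded copy of a group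
that is given by left translations. -/
def translationSubgroup {G Z F : Type*} [Group G] [Group F] (P : Subgroup (G × Equiv.Perm Z))
    (e : F → Z) : Subgroup (G × F) where
  carrier := {x | ∃ π, (x.1, π) ∈ P ∧ ∀ f, π (e f) = e (x.2 * f)}
  one_mem' := ⟨1, P.one_mem, fun f => by simp⟩
  mul_mem' := by
    rintro ⟨g, p⟩ ⟨h, q⟩ ⟨π, hπ, hp⟩ ⟨ρ, hρ, hq⟩
    exact ⟨π * ρ, P.mul_mem hπ hρ, fun f => by simp_all [mul_assoc]⟩
  inv_mem' := by
    rintro ⟨g, p⟩ ⟨π, hπ, hp⟩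
    exact ⟨π⁻¹, P.inv_mem hπ, fun f => by
      rw [Equiv.Perm.inv_eq_iff_eq, hp]; simp⟩

theorem eq_one_of_mem_translationSubgroup {G Z F : Type*} [Group G] [Group F]
    {P : Subgroup (G × Equiv.Perm Z)} {e : F → Z} (he : e.Injective)
    (hP : ∀ π, (1, π) ∈ P → π = 1) {p : F} (h : (1, p) ∈ translationSubgroup P e) : p = 1 := by
  obtain ⟨π, hπ, hp⟩ := h
  obtain rfl := hP π hπ
  simpa using (he (hp 1)).symm

/-- The pairs of permutations of `ℤ × Y` and `Y` that agree over the multiples of `N`. -/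
def agreeSubgroup {G Y : Type*} [Group G] (φ : G →* Equiv.Perm (ℤ × Y)) (N : ℤ) :
    Subgroup (G × Equiv.Perm Y) where
  carrier := {p | ∀ w z, (N ∣ (φ p.1 w).1 ∧ (φ p.1 w).2 = p.2 z) ↔ (N ∣ w.1 ∧ w.2 = z)}
  one_mem' := by simp
  mul_mem' := by
    rintro ⟨g, π⟩ ⟨h, ρ⟩ hg hh w z
    simpa using (hg (φ h w) (ρ z)).trans (hh w z)
  inv_mem' := by
    rintro ⟨g, π⟩ hg w z
    simpa using (hg ((φ g)⁻¹ w) (π⁻¹ z)).symm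

theorem exists_agreeing (hn : 2 ≤ n) {Y : Type*} (ξ η : Equiv.Perm Y) :
    ∃ P : Subgroup (Mmn m n × Equiv.Perm Y), (∀ π, (1, π) ∈ P → π = 1) ∧ (genX m n, ξ) ∈ P ∧
      (genA m n * genX m n * (genA m n)⁻¹, η) ∈ P ∧ (genA m n ^ (2 * n), 1) ∈ P := by
  let N : ℤ := 2 * n
  let β : ℤ → Equiv.Perm Y := fun i => if N ∣ i then ξ else if N ∣ i - 1 then η else 1
  let Ξ : ℤ → Equiv.Perm Y := fun i => β i * (β (i + n))⁻¹
  have hβ : ∀ i, β (i + n + n) = β i := by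
    intro i
    have h₁ : N ∣ i + n + n ↔ N ∣ i := by
      rw [show i + n + n = i + N by simp only [N]; ring]; simp
    have h₂ : N ∣ i + n + n - 1 ↔ N ∣ i - 1 := by
      rw [show i + n + n - 1 = i - 1 + N by simp only [N]; ring]; simp
    simp only [β, h₁, h₂]
  have hΞ : ∀ i, Ξ (i + n) = (Ξ i)⁻¹ := by
    intro i
    simp only [Ξ, hβ, mul_inv_rev, inv_inv]
  have hndvd : ∀ (i t : ℤ), N ∣ i → 0 < t → t < N → ¬ N ∣ i + t := by
    intro i t hi h₀ h₁ h
    have := Int.le_of_dvd h₀ ((dvd_add_right hi).1 h)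
    lia
  have hξ : ∀ i, N ∣ i → Ξ i = ξ := by
    intro i hi
    have h₁ := hndvd i n hi (by lia) (by lia)
    have h₂ := hndvd i (n - 1) hi (by lia) (by lia)
    rw [← add_sub_assoc] at h₂
    simp [Ξ, β, hi, h₁, h₂]
  have hη : ∀ i, N ∣ i → Ξ (i + 1) = η := by
    intro i hi
    have h₀ := hndvd i 1 hi (by lia) (by lia)
    have h₁ := hndvd i (1 + n) hi (by lia) (by lia)
    have h₂ := hndvd i n hi (by lia) (by lia)
    rw [← add_assoc] at h₁
    have h₃ : i + 1 + n - 1 = i + n := by ring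
    simp [Ξ, β, hi, h₀, h₁, h₂, h₃]
  let a : Equiv.Perm (ℤ × Y) := Equiv.prodCongr (Equiv.subRight 1) (Equiv.refl Y)
  let x : Equiv.Perm (ℤ × Y) := Equiv.prodShear (Equiv.refl ℤ) Ξ
  have ha : ∀ w, a w = (w.1 - 1, w.2) := fun w => rfl
  have hx : ∀ w, x w = (w.1, Ξ w.1 w.2) := fun w => rfl
  have ha_pow : ∀ (k : ℕ) w, (a ^ k) w = (w.1 - k, w.2) := by
    intro k
    induction k with
    | zero => simp
    | succ k ih => intro w; rw [pow_succ, Equiv.Perm.mul_apply, ih, ha]; simp; ring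
  have hrel : a ^ n * x * (a ^ n)⁻¹ = x⁻¹ := by
    rw [mul_inv_eq_iff_eq_mul, eq_inv_mul_iff_mul_eq]
    ext1 w
    have h := hΞ (w.1 - n)
    rw [sub_add_cancel] at h
    simp only [Equiv.Perm.mul_apply, hx, ha_pow, h]
    exact congrArg _ (Equiv.apply_symm_apply _ _)
  obtain ⟨φ, hφa, hφx⟩ := exists_hom (m := m) (n := n) a x (by rw [hrel]; simp)
  refine ⟨agreeSubgroup φ N, fun π h => ?_, ?_, ?_, ?_⟩
  · ext z
    have := (h (0, z) z).2 ⟨dvd_zero _, rfl⟩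
    simpa using this.2.symm
  · rintro ⟨i, y⟩ z
    simp only [hφx, hx]
    exact and_congr_right fun h => by simp [hξ _ h]
  · rintro ⟨i, y⟩ z
    have h₁ : (a⁻¹) (i, y) = (i + 1, y) := by
      rw [Equiv.Perm.inv_eq_iff_eq, ha]; simp
    simp only [map_mul, map_inv, hφx, hφa, Equiv.Perm.mul_apply, h₁, hx, ha, add_sub_cancel_right]
    exact and_congr_right fun h => by simp [hη _ h]
  · rintro ⟨i, y⟩ z
    simp only [map_pow, hφa, ha_pow]
    rw [show ((2 * n : ℕ) : ℤ) = N by simp [N]]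
    simp

/-- Cyclic rotation of `ZMod m`, twisted by `c` at each passage through `0`. -/
def rotation {F : Type*} [Group F] (m : ℕ) (c : ℤ → F) : Equiv.Perm (ZMod m × ℤ × F) where
  toFun y := (y.1 + 1, y.2.1, (if y.1 = -1 then c y.2.1 else 1) * y.2.2)
  invFun y := (y.1 - 1, y.2.1, (if y.1 = 0 then c y.2.1 else 1)⁻¹ * y.2.2)
  left_inv := by
    rintro ⟨j, k, f⟩
    simp only [eq_neg_iff_add_eq_zero, add_sub_cancel_right, inv_mul_cancel_left]
  right_inv := by
    rintro ⟨j, k, f⟩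
    simp [sub_eq_iff_eq_add]

/-- Translation of the integer coordinate over `1`, and of the group coordinate over `(0, 0)`. -/
def shift {F : Type*} [Group F] (m : ℕ) (v : F) : Equiv.Perm (ZMod m × ℤ × F) where
  toFun y := (y.1, y.2.1 + (if y.1 = 1 then 1 else 0),
    (if y.1 = 0 ∧ y.2.1 = 0 then v else 1) * y.2.2)
  invFun y := (y.1, y.2.1 - (if y.1 = 1 then 1 else 0),
    (if y.1 = 0 ∧ y.2.1 - (if y.1 = 1 then 1 else 0) = 0 then v else 1)⁻¹ * y.2.2)
  left_inv := by
    rintro ⟨j, k, f⟩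
    simp only [add_sub_cancel_right, inv_mul_cancel_left]
  right_inv := by
    rintro ⟨j, k, f⟩
    simp only [sub_add_cancel, mul_inv_cancel_left]

theorem rotation_apply {F : Type*} [Group F] (c : ℤ → F) (j k f) :
    rotation m c (j, k, f) = (j + 1, k, (if j = -1 then c k else 1) * f) := rfl

theorem shift_apply {F : Type*} [Group F] (v : F) (j k f) :
    shift m v (j, k, f) = (j, k + (if j = 1 then 1 else 0),
      (if j = 0 ∧ k = 0 then v else 1) * f) := rfl

theorem natCast_ne_neg_one {t : ℕ} (h : t + 1 < m) : (t : ZMod m) ≠ -1 := by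
  intro h'
  rw [eq_neg_iff_add_eq_zero, ← Nat.cast_succ, ZMod.natCast_eq_zero_iff] at h'
  exact absurd (Nat.le_of_dvd (Nat.succ_pos t) h') (by lia)

theorem rotation_pow_self {F : Type*} [Group F] (hm : 2 ≤ m) (c : ℤ → F) (k f) :
    (rotation m c ^ m) (0, k, f) = (0, k, c k * f) := by
  have key : ∀ t : ℕ, t < m → (rotation m c ^ t) (0, k, f) = ((t : ZMod m), k, f) := by
    intro t
    induction t with
    | zero => simp
    | succ t ih =>
      intro ht
      rw [pow_succ', Equiv.Perm.mul_apply, ih (by lia), rotation_apply,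
        if_neg (natCast_ne_neg_one ht)]
      simp
  obtain ⟨t, rfl⟩ : ∃ t, m = t + 1 := ⟨m - 1, by lia⟩
  have ht : (t : ZMod (t + 1)) = -1 := by
    rw [eq_neg_iff_add_eq_zero]
    exact_mod_cast ZMod.natCast_self (t + 1)
  rw [pow_succ', Equiv.Perm.mul_apply, key t (by lia), rotation_apply, if_pos ht, ht]
  simp

theorem shift_pow {F : Type*} [Group F] (hm : 2 ≤ m) (v f : F) (t : ℕ) :
    (shift m v ^ t) (0, 0, f) = (0, 0, v ^ t * f) := by
  have : Fact (1 < m) := ⟨hm⟩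
  induction t with
  | zero => simp
  | succ t ih =>
    rw [pow_succ', Equiv.Perm.mul_apply, ih, shift_apply]
    simp [pow_succ', mul_assoc]

theorem conj_shift_pow {F : Type*} [Group F] (hm : 2 ≤ m) (c : ℤ → F) (v f : F) (t : ℕ) (k : ℤ) :
    (((rotation m c)⁻¹ * shift m v * rotation m c) ^ t) (0, k, f) = (0, k + t, f) := by
  have : Fact (1 < m) := ⟨hm⟩
  induction t with
  | zero => simp
  | succ t ih =>
    rw [pow_succ', Equiv.Perm.mul_apply, ih, Equiv.Perm.mul_apply, Equiv.Perm.mul_apply,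
      Equiv.Perm.inv_eq_iff_eq, rotation_apply, rotation_apply, shift_apply]
    simp [add_assoc]

/-- The element conjugating the central powers apart. -/
abbrev genE (m n : ℕ) : Mmn m n :=
  (genX m n)⁻¹ * (genA m n * genX m n * (genA m n)⁻¹) * genX m n

theorem exists_tracking_left (hm : 2 ≤ m) (hn : 2 ≤ n) {F : Type*} [Group F] (c : ℤ → F) (v : F) :
    ∃ T : Subgroup (Mmn m n × F), (∀ p, (1, p) ∈ T → p = 1) ∧
      ((genA m n * genX m n * (genA m n)⁻¹) ^ m, v ^ m) ∈ T ∧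
      (genA m n ^ (2 * n), 1) ∈ T ∧ ((genX m n)⁻¹ * genA m n ^ (2 * n) * genX m n, 1) ∈ T ∧
      ∀ k : ℕ, (genE m n ^ k * genX m n ^ m * (genE m n ^ k)⁻¹, c (-k)) ∈ T := by
  obtain ⟨P, hP, hξ, hη, hB⟩ := exists_agreeing (m := m) hn (rotation m c) (shift m v)
  refine ⟨translationSubgroup P fun f => (0, 0, f), fun p h =>
    eq_one_of_mem_translationSubgroup (fun f g h => by simpa using h) hP h,
    ⟨_, P.pow_mem hη m, fun f => shift_pow hm v f m⟩, ⟨1, hB, by simp⟩,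
    ⟨_, P.mul_mem (P.mul_mem (P.inv_mem hξ) hB) hξ, by simp⟩, fun k => ?_⟩
  have hE := P.pow_mem (P.mul_mem (P.mul_mem (P.inv_mem hξ) hη) hξ) k
  refine ⟨_, P.mul_mem (P.mul_mem hE (P.pow_mem hξ m)) (P.inv_mem hE), fun f => ?_⟩
  have h : (((rotation m c)⁻¹ * shift m v * rotation m c) ^ k)⁻¹ (0, 0, f) = (0, -(k : ℤ), f) := by
    rw [Equiv.Perm.inv_eq_iff_eq, conj_shift_pow hm]
    simp
  change ((((rotation m c)⁻¹ * shift m v * rotation m c) ^ k) * (rotation m c) ^ m *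
    (((rotation m c)⁻¹ * shift m v * rotation m c) ^ k)⁻¹) (0, 0, f) = _
  rw [Equiv.Perm.mul_apply, h, Equiv.Perm.mul_apply, rotation_pow_self hm, conj_shift_pow hm]
  simp

theorem exists_tracking_right (hm : 2 ≤ m) {F : Type*} [Group F] (u v : F) :
    ∃ T : Subgroup (Mmn m n × F), (∀ p, (1, p) ∈ T → p = 1) ∧
      (∀ g, (g * genX m n ^ m * g⁻¹, 1) ∈ T) ∧ ∀ k : ℕ, (genA m n ^ k, u ^ k) ∈ T ∧
      ((genX m n)⁻¹ * genA m n ^ k * genX m n, v ^ k) ∈ T := by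
  have : Fact (1 < m) := ⟨hm⟩
  let x : Equiv.Perm (ZMod m × F) := Equiv.prodCongr (Equiv.addRight 1) (Equiv.refl F)
  let a : Equiv.Perm (ZMod m × F) := Equiv.prodShear (Equiv.refl _)
    fun j => Equiv.mulLeft (if j = 0 then u else if j = 1 then v else 1)
  have hx : ∀ w, x w = (w.1 + 1, w.2) := fun _ => rfl
  have ha : ∀ w, a w = (w.1, (if w.1 = 0 then u else if w.1 = 1 then v else 1) * w.2) :=
    fun _ => rfl
  have hx_pow : ∀ (t : ℕ) w, (x ^ t) w = (w.1 + t, w.2) := by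
    intro t
    induction t with
    | zero => simp
    | succ t ih => intro w; rw [pow_succ', Equiv.Perm.mul_apply, ih, hx]; simp [add_assoc]
  have hxm : x ^ m = 1 := by
    ext1 w
    simp [hx_pow]
  have ha_pow : ∀ (t : ℕ) w, (a ^ t) w =
      (w.1, (if w.1 = 0 then u else if w.1 = 1 then v else 1) ^ t * w.2) := by
    intro t
    induction t with
    | zero => simp
    | succ t ih =>
      intro w
      rw [pow_succ', Equiv.Perm.mul_apply, ih, ha]
      simp only [pow_succ', mul_assoc]
  obtain ⟨φ, hφa, hφx⟩ := exists_hom (m := m) (n := n) a x (by simp [conj_pow, hxm])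
  refine ⟨translationSubgroup φ.graph fun f => (0, f), fun p h =>
    eq_one_of_mem_translationSubgroup (fun f g h => by simpa using h)
      (fun π h => (MonoidHom.mem_graph.1 h).symm.trans (map_one φ)) h,
    fun g => ?_, fun k => ⟨?_, ?_⟩⟩
  · have h : φ (g * genX m n ^ m * g⁻¹) = 1 := by
      rw [map_mul, map_mul, map_pow, hφx, hxm, mul_one, ← map_mul, mul_inv_cancel, map_one]
    exact ⟨1, MonoidHom.mem_graph.2 h, fun f => by simp⟩
  · have h : φ (genA m n ^ k) = a ^ k := by rw [map_pow, hφa]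
    exact ⟨_, MonoidHom.mem_graph.2 h, fun f => by simp [ha_pow]⟩
  · have h : φ ((genX m n)⁻¹ * genA m n ^ k * genX m n) = x⁻¹ * a ^ k * x := by
      rw [map_mul, map_mul, map_inv, map_pow, hφa, hφx]
    refine ⟨_, MonoidHom.mem_graph.2 h, fun f => ?_⟩
    rw [Equiv.Perm.mul_apply, Equiv.Perm.mul_apply, Equiv.Perm.inv_eq_iff_eq, hx, ha_pow, hx]
    simp

end Tracking

section Reduction

variable {m n : ℕ}

theorem commute_conj_genX_pow {A B C D : Mmn m n}
    (hA : A = (genA m n * genX m n * (genA m n)⁻¹) ^ m)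
    (hB : B = genA m n ^ (2 * n)) (hC : C = genX m n ^ m)
    (hD : D = (genX m n)⁻¹ * B * genX m n) : Commute A B ∧ Commute B C ∧ Commute C D := by
  have key : genA m n ^ n * C * (genA m n ^ n)⁻¹ = C⁻¹ := by
    rw [hC, ← conj_pow, eq_inv_iff_mul_eq_one, mul_eq_one_comm]
    exact genX_pow_mul
  have hBC : Commute B C := by
    have h : B * C * B⁻¹ = C := by
      have h : B * C * B⁻¹ =
          genA m n ^ n * (genA m n ^ n * C * (genA m n ^ n)⁻¹) * (genA m n ^ n)⁻¹ := by
        rw [hB, two_mul, pow_add]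
        group
      rw [h, key, ← conj_inv, key, inv_inv]
    exact mul_inv_eq_iff_eq_mul.1 h
  have hCx : Commute (genX m n) C := hC ▸ Commute.self_pow _ _
  have hBa : Commute (genA m n) B := hB ▸ Commute.self_pow _ _
  refine ⟨?_, hBC, ?_⟩
  · rw [hA, conj_pow, ← hC]
    exact ((hBa.mul_left hBC.symm).mul_left hBa.inv_left)
  · rw [hD]
    exact (((hCx.inv_left).mul_left hBC).mul_left hCx).symm

end Reduction

theorem exists_finset_not_computablePred {m n : ℕ} (hm : 2 ≤ m) (hn : 2 ≤ n) :
    ∃ F : Finset (Mmn m n), ¬ ComputablePred fun w : List (Fin 2 × Bool) =>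
      evalGrpWord (fun i => PresentedGroup.of i) w ∈ Submonoid.closure (F : Set (Mmn m n)) := by
  obtain ⟨M, hM⟩ := exists_machine
  have := M.countable
  obtain ⟨κ, hκ⟩ := exists_injective_nat M.Vertex
  let A : Mmn m n := (genA m n * genX m n * (genA m n)⁻¹) ^ m
  let B : Mmn m n := genA m n ^ (2 * n)
  let C : Mmn m n := genX m n ^ m
  let D : Mmn m n := (genX m n)⁻¹ * B * genX m n
  let S : M.Vertex → Mmn m n := fun σ => genE m n ^ (κ σ + 1) * C * (genE m n ^ (κ σ + 1))⁻¹
  obtain ⟨hAB, hBC, hCD⟩ :=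
    commute_conj_genX_pow (A := A) (B := B) (C := C) (D := D) rfl rfl rfl rfl
  let c : ℤ → FreeGroup (Bool ⊕ M.Vertex) := Function.extend (fun σ => -((κ σ + 1 : ℕ) : ℤ))
    (fun σ => .of (.inr σ)) fun _ => .of (.inl false)
  have hc : ∀ σ, c (-((κ σ + 1 : ℕ) : ℤ)) = .of (.inr σ) := fun σ =>
    Function.Injective.extend_apply (f := fun σ => -((κ σ + 1 : ℕ) : ℤ))
      (fun σ τ h => hκ (by simpa using h)) _ _ σ
  have hc₀ : c (-((0 : ℕ) : ℤ)) = .of (.inl false) :=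
    Function.extend_apply' _ _ _ (by rintro ⟨σ, h⟩; lia)
  obtain ⟨T₁, hT₁, hA₁, hB₁, hD₁, hS₁⟩ :=
    exists_tracking_left hm hn c (.of (.inl true))
  obtain ⟨T₂, hT₂, hC₂, hB₂⟩ :=
    exists_tracking_right (n := n) hm (.of false) (.of true : FreeGroup Bool)
  let T : Subgroup (Mmn m n × FreeGroup (Bool ⊕ M.Vertex) × FreeGroup Bool) :=
    T₁.comap ((MonoidHom.fst _ _).prod ((MonoidHom.fst _ _).comp (MonoidHom.snd _ _))) ⊓
      T₂.comap ((MonoidHom.fst _ _).prod ((MonoidHom.snd _ _).comp (MonoidHom.snd _ _)))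
  have hT : ∀ p, (1, p) ∈ T → p = 1 := fun p h => Prod.ext (hT₁ _ h.1) (hT₂ _ h.2)
  have hA₂ : (A, 1) ∈ T₂ := by
    simp only [A, conj_pow]
    exact hC₂ _
  have hC₁ : (C, .of (.inl false)) ∈ T₁ := by
    have h := hS₁ 0
    rw [hc₀] at h
    simpa using h
  have hC₀ : (C, 1) ∈ T₂ := by simpa using hC₂ 1
  have rel : ∀ N, S (some (.inl M.init)) * (C ^ N)⁻¹ * (S none)⁻¹ ∈
      Submonoid.closure (M.generators A B C D S) → M.Rel N 0 := fun N =>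
    AffMachine.rel_of_mem_closure hm (f := 2 * n) (by lia) T hT
      ⟨hA₁, hA₂⟩
      ⟨hB₁, (hB₂ _).1⟩ ⟨hC₁, hC₀⟩
      ⟨hD₁, (hB₂ _).2⟩ fun σ => ⟨hc σ ▸ hS₁ _, hC₂ _⟩
  refine ⟨(AffMachine.finite_generators (M := M) (A := A) (B := B) (C := C) (D := D)
    (S := S)).toFinset, fun h => hM ?_⟩
  rw [Set.Finite.coe_toFinset] at h
  obtain ⟨W, hW, hWeq⟩ := exists_computable_word (S (some (.inl M.init))) C⁻¹ (S none)⁻¹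
  refine ComputablePred.computable_of_manyOneReducible ⟨W, hW, fun j => ?_⟩ h
  rw [hWeq, inv_pow]
  exact ⟨AffMachine.mem_closure_of_rel hAB hBC hCD, rel _⟩

end AffineMembership

/-- For all `m, n ≥ 2`, the positive one-relator group
`M_{m,n} = Gp⟨a, b | (b a^n)^m (a^n b)^m = 1⟩` contains a fixed finitely generated
submonoid in which membership is undecidable: there is a finite subset `F` of `M_{m,n}`
such that the predicate on words over `{a, b, a⁻¹, b⁻¹}` given by membership of the
represented element in the submonoid generated by `F` is not computable. -/
theorem mmn_undecidable_submonoid_membership (m n : ℕ) (hm : 2 ≤ m) (hn : 2 ≤ n) :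
    ∃ F : Finset (Mmn m n),
      ¬ ComputablePred fun w : List (Fin 2 × Bool) =>
        evalGrpWord (fun i => PresentedGroup.of i) w ∈
          Submonoid.closure (F : Set (Mmn m n)) :=
  AffineMembership.exists_finset_not_computablePred hm hn
end

section
/- There exist a finite alphabet A, a positive word w ∈ A*, and a finite subset F of the one-relation monoid M = Mon⟨A | w = 1⟩ such that the membership problem for the submonoid of M generated by F is undecidable: the predicate on words u ∈ A* given by 'the element of M represented by u lies in the submonoid generated by F' is not computable. -/
/-- The one-relation monoid `Mon⟨A | u = v⟩` over the alphabet `Fin k`: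
the quotient of the free monoid on `Fin k` by the congruence generated by `(u, v)`. -/
abbrev OneRelMonoid {k : ℕ} (u v : List (Fin k)) :=
  PresentedMonoid (fun x y : FreeMonoid (Fin k) =>
    x = FreeMonoid.ofList u ∧ y = FreeMonoid.ofList v)

/-- Evaluation of a word in the one-relation monoid. -/
def OneRelMonoid.eval {k : ℕ} (u v : List (Fin k)) (w : List (Fin k)) :
    OneRelMonoid u v :=
  PresentedMonoid.mk _ (FreeMonoid.ofList w)

open Relation

/-- Instructions of a register machine whose registers are indexed by `ℕ`. -/
inductive RegInstr : Type
  | skip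
  | inc (i : ℕ)
  | dec (i : ℕ)
  | zero (i : ℕ)

/-- The effect of an instruction on the register contents; `dec` blocks on an empty register and
`zero` blocks on a non-empty one. -/
def RegInstr.Exec : RegInstr → (ℕ →₀ ℕ) → (ℕ →₀ ℕ) → Prop
  | skip, v, w => w = v
  | inc i, v, w => w = v + Finsupp.single i 1
  | dec i, v, w => v = w + Finsupp.single i 1
  | zero i, v, w => w = v ∧ v i = 0

/-- One step of the nondeterministic register machine with transition set `T`. -/
def RegStep {σ : Type} (T : Set (σ × RegInstr × σ)) (x y : σ × (ℕ →₀ ℕ)) : Prop :=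
  ∃ c, (x.1, c, y.1) ∈ T ∧ c.Exec x.2 y.2

/-- A relation on register contents is realizable if it is the input-output relation of a
nondeterministic register machine. -/
def Realizable (R : (ℕ →₀ ℕ) → (ℕ →₀ ℕ) → Prop) : Prop :=
  ∃ (σ : Type) (_ : Finite σ) (T : Set (σ × RegInstr × σ)) (s f : σ), T.Finite ∧
    ∀ v w, ReflTransGen (RegStep T) (s, v) (f, w) ↔ R v w

theorem Realizable.instr (c : RegInstr) : Realizable c.Exec := by
  refine ⟨Bool, inferInstance, {(false, c, true)}, false, true, Set.finite_singleton _, ?_⟩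
  intro v w
  constructor
  · intro h
    have key : ∀ x, ReflTransGen (RegStep {(false, c, true)}) (false, v) x →
        x = (false, v) ∨ (x.1 = true ∧ c.Exec v x.2) := by
      intro x hx
      induction hx with
      | refl => exact Or.inl rfl
      | tail _ hs ih =>
        obtain ⟨c', hc, he⟩ := hs
        simp only [Set.mem_singleton_iff, Prod.mk.injEq] at hc
        obtain ⟨h1, rfl, h2⟩ := hc
        rcases ih with rfl | ⟨h3, _⟩
        · exact Or.inr ⟨h2, he⟩
        · simp [h1] at h3
    simpa using key _ h
  · intro h
    exact ReflTransGen.single ⟨c, rfl, h⟩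

theorem Realizable.comp {R S : (ℕ →₀ ℕ) → (ℕ →₀ ℕ) → Prop} (hR : Realizable R)
    (hS : Realizable S) : Realizable (Relation.Comp R S) := by
  obtain ⟨σ, _, T, s, f, hT, h⟩ := hR
  obtain ⟨σ', _, T', s', f', hT', h'⟩ := hS
  let U : Set ((σ ⊕ σ') × RegInstr × (σ ⊕ σ')) :=
    (Prod.map Sum.inl (Prod.map id Sum.inl) '' T ∪
      Prod.map Sum.inr (Prod.map id Sum.inr) '' T') ∪ {(Sum.inl f, RegInstr.skip, Sum.inr s')}
  have hl : ∀ x y, ReflTransGen (RegStep T) x y →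
      ReflTransGen (RegStep U) (Sum.inl x.1, x.2) (Sum.inl y.1, y.2) := by
    intro x y hxy
    refine ReflTransGen.lift (fun x : σ × (ℕ →₀ ℕ) => ((Sum.inl x.1 : σ ⊕ σ'), x.2)) ?_ x y hxy
    rintro a b ⟨c, hc, he⟩
    exact ⟨c, Or.inl (Or.inl ⟨_, hc, rfl⟩), he⟩
  have hr : ∀ x y, ReflTransGen (RegStep T') x y →
      ReflTransGen (RegStep U) (Sum.inr x.1, x.2) (Sum.inr y.1, y.2) := by
    intro x y hxy
    refine ReflTransGen.lift (fun x : σ' × (ℕ →₀ ℕ) => ((Sum.inr x.1 : σ ⊕ σ'), x.2)) ?_ x y hxy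
    rintro a b ⟨c, hc, he⟩
    exact ⟨c, Or.inl (Or.inr ⟨_, hc, rfl⟩), he⟩
  refine ⟨σ ⊕ σ', inferInstance, U, Sum.inl s, Sum.inr f',
    ((hT.image _).union (hT'.image _)).union (Set.finite_singleton _), fun v w => ⟨?_, ?_⟩⟩
  · intro hvw
    have key : ∀ x, ReflTransGen (RegStep U) (Sum.inl s, v) x →
        (∀ q, x.1 = Sum.inl q → ReflTransGen (RegStep T) (s, v) (q, x.2)) ∧
        (∀ q, x.1 = Sum.inr q → ∃ m, ReflTransGen (RegStep T) (s, v) (f, m) ∧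
          ReflTransGen (RegStep T') (s', m) (q, x.2)) := by
      intro x hx
      induction hx with
      | refl =>
        refine ⟨fun q hq => ?_, fun q hq => by simp at hq⟩
        obtain rfl : s = q := by simpa using hq
        exact .refl
      | @tail y z _ hs ih =>
        obtain ⟨c, hc, he⟩ := hs
        rcases y with ⟨yq, yv⟩
        rcases z with ⟨zq, zv⟩
        rcases hc with (⟨⟨p, c', p'⟩, hp, hpe⟩ | ⟨⟨p, c', p'⟩, hp, hpe⟩) | hc
        · simp only [Prod.map_apply, id_eq, Prod.mk.injEq] at hpe
          obtain ⟨rfl, rfl, rfl⟩ := hpe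
          refine ⟨fun q hq => ?_, fun q hq => by simp at hq⟩
          obtain rfl : p' = q := by simpa using hq
          exact (ih.1 p rfl).tail ⟨_, hp, he⟩
        · simp only [Prod.map_apply, id_eq, Prod.mk.injEq] at hpe
          obtain ⟨rfl, rfl, rfl⟩ := hpe
          refine ⟨fun q hq => by simp at hq, fun q hq => ?_⟩
          obtain rfl : p' = q := by simpa using hq
          obtain ⟨m, h1, h2⟩ := ih.2 p rfl
          exact ⟨m, h1, h2.tail ⟨_, hp, he⟩⟩
        · simp only [Set.mem_singleton_iff, Prod.mk.injEq] at hc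
          obtain ⟨rfl, rfl, rfl⟩ := hc
          refine ⟨fun q hq => by simp at hq, fun q hq => ?_⟩
          obtain rfl : s' = q := by simpa using hq
          have he' : zv = yv := he
          subst he'
          exact ⟨zv, ih.1 f rfl, .refl⟩
    obtain ⟨m, h1, h2⟩ := (key _ hvw).2 f' rfl
    exact ⟨m, (h _ _).1 h1, (h' _ _).1 h2⟩
  · rintro ⟨m, h1, h2⟩
    have hs : RegStep U (Sum.inl f, m) (Sum.inr s', m) := ⟨.skip, Or.inr rfl, rfl⟩
    exact ((hl _ _ ((h _ _).2 h1)).tail hs).trans (hr _ _ ((h' _ _).2 h2))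

theorem Realizable.star {R : (ℕ →₀ ℕ) → (ℕ →₀ ℕ) → Prop} (hR : Realizable R) :
    Realizable (ReflTransGen R) := by
  obtain ⟨σ, _, T, s, f, hT, h⟩ := hR
  let U : Set (Option σ × RegInstr × Option σ) :=
    Prod.map some (Prod.map id some) '' T ∪
      {(none, RegInstr.skip, some s), (some f, RegInstr.skip, none)}
  have hl : ∀ x y, ReflTransGen (RegStep T) x y →
      ReflTransGen (RegStep U) (some x.1, x.2) (some y.1, y.2) := by
    intro x y hxy
    refine ReflTransGen.lift (fun x : σ × (ℕ →₀ ℕ) => (some x.1, x.2)) ?_ x y hxy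
    rintro a b ⟨c, hc, he⟩
    exact ⟨c, Or.inl ⟨_, hc, rfl⟩, he⟩
  refine ⟨Option σ, inferInstance, U, none, none,
    (hT.image _).union (Set.toFinite _), fun v w => ⟨?_, ?_⟩⟩
  · intro hvw
    have key : ∀ x, ReflTransGen (RegStep U) (none, v) x →
        (x.1 = none → ReflTransGen R v x.2) ∧
        (∀ q, x.1 = some q → ∃ m, ReflTransGen R v m ∧
          ReflTransGen (RegStep T) (s, m) (q, x.2)) := by
      intro x hx
      induction hx with
      | refl => exact ⟨fun _ => .refl, fun q hq => by simp at hq⟩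
      | @tail y z _ hs ih =>
        obtain ⟨c, hc, he⟩ := hs
        rcases y with ⟨yq, yv⟩
        rcases z with ⟨zq, zv⟩
        rcases hc with ⟨⟨p, c', p'⟩, hp, hpe⟩ | hc | hc
        · simp only [Prod.map_apply, id_eq, Prod.mk.injEq] at hpe
          obtain ⟨rfl, rfl, rfl⟩ := hpe
          refine ⟨fun hq => by simp at hq, fun q hq => ?_⟩
          obtain rfl : p' = q := by simpa using hq
          obtain ⟨m, h1, h2⟩ := ih.2 p rfl
          exact ⟨m, h1, h2.tail ⟨_, hp, he⟩⟩
        · simp only [Prod.mk.injEq] at hc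
          obtain ⟨rfl, rfl, rfl⟩ := hc
          have he' : zv = yv := he
          subst he'
          refine ⟨fun hq => by simp at hq, fun q hq => ?_⟩
          obtain rfl : s = q := by simpa using hq
          exact ⟨zv, ih.1 rfl, .refl⟩
        · simp only [Set.mem_singleton_iff, Prod.mk.injEq] at hc
          obtain ⟨rfl, rfl, rfl⟩ := hc
          have he' : zv = yv := he
          subst he'
          refine ⟨fun _ => ?_, fun q hq => by simp at hq⟩
          obtain ⟨m, h1, h2⟩ := ih.2 f rfl
          exact h1.tail ((h _ _).1 h2)
    exact (key _ hvw).1 rfl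
  · intro hvw
    induction hvw with
    | refl => exact .refl
    | @tail y z _ hyz ih =>
      have hs : RegStep U (none, y) (some s, y) := ⟨.skip, Or.inr (Or.inl rfl), rfl⟩
      have hf : RegStep U (some f, z) (none, z) := ⟨.skip, Or.inr (Or.inr rfl), rfl⟩
      exact ih.trans (.head hs ((hl _ _ ((h _ _).2 hyz)).tail hf))

/-- The partial function with graph `S` is computed by a register machine: started at `v`, the
machine halts with contents `w` and no others, whenever `S v w`. -/
def RegComputes (S : (ℕ →₀ ℕ) → (ℕ →₀ ℕ) → Prop) : Prop :=
  ∃ R, Realizable R ∧ ∀ v w, S v w → ∀ u, R v u ↔ u = w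

theorem RegComputes.mono {S S' : (ℕ →₀ ℕ) → (ℕ →₀ ℕ) → Prop} (h : RegComputes S)
    (hS : ∀ v w, S' v w → S v w) : RegComputes S' := by
  obtain ⟨R, hR, h⟩ := h
  exact ⟨R, hR, fun v w hvw => h v w (hS v w hvw)⟩

theorem RegComputes.skip : RegComputes fun v w => w = v :=
  ⟨_, Realizable.instr .skip, by rintro v w rfl u; rfl⟩

theorem RegComputes.inc (i : ℕ) : RegComputes fun v w => w = v + Finsupp.single i 1 :=
  ⟨_, Realizable.instr (.inc i), by rintro v w rfl u; rfl⟩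

theorem RegComputes.comp {S S' S'' : (ℕ →₀ ℕ) → (ℕ →₀ ℕ) → Prop} (h : RegComputes S)
    (h' : RegComputes S') (hS : ∀ v w, S'' v w → ∃ u, S v u ∧ S' u w) : RegComputes S'' := by
  obtain ⟨R, hR, h⟩ := h
  obtain ⟨R', hR', h'⟩ := h'
  refine ⟨_, hR.comp hR', fun v w hvw u => ?_⟩
  obtain ⟨m, h1, h2⟩ := hS v w hvw
  constructor
  · rintro ⟨m', h3, h4⟩
    rw [h v m h1] at h3
    subst h3
    exact (h' _ _ h2 u).1 h4
  · rintro rfl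
    exact ⟨m, (h v m h1 m).2 rfl, (h' m u h2 u).2 rfl⟩

theorem RegComputes.loop {B S : (ℕ →₀ ℕ) → (ℕ →₀ ℕ) → Prop} (i : ℕ) (hB : RegComputes B)
    (hS : ∀ v w, S v w → (v i = 0 ∧ w = v) ∨
      ∃ u m, v = u + Finsupp.single i 1 ∧ B u m ∧ S m w ∧ m i = u i) : RegComputes S := by
  obtain ⟨R, hR, hRB⟩ := hB
  refine ⟨_, (((Realizable.instr (.dec i)).comp hR).star.comp (Realizable.instr (.zero i))), ?_⟩
  intro v w hvw
  induction hk : v i using Nat.strong_induction_on generalizing v with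
  | _ k ih =>
  intro x
  rcases hS v w hvw with ⟨h0, rfl⟩ | ⟨u, m, rfl, hum, hmw, hmi⟩
  · constructor
    · rintro ⟨m, h1, h2⟩
      rcases h1.cases_head with rfl | ⟨y, ⟨z, hz, _⟩, _⟩
      · exact h2.1
      · have hz' : w = z + Finsupp.single i 1 := hz
        rw [hz'] at h0
        simp at h0
    · rintro rfl
      exact ⟨x, .refl, rfl, h0⟩
  · have hlt : m i < k := by
      rw [← hk, hmi]
      simp
    rw [← ih _ hlt m hmw rfl x]
    constructor
    · rintro ⟨y, h1, h2⟩
      rcases h1.cases_head with rfl | ⟨y', ⟨z, hz, hz'⟩, h3⟩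
      · have := h2.2
        simp at this
      · have hz1 : u + Finsupp.single i 1 = z + Finsupp.single i 1 := hz
        obtain rfl := add_right_cancel hz1
        rw [hRB _ _ hum] at hz'
        subst hz'
        exact ⟨y, h3, h2⟩
    · rintro ⟨y, h1, h2⟩
      exact ⟨y, .head ⟨u, rfl, (hRB _ _ hum _).2 rfl⟩ h1, h2⟩

/-- Empty register `i`, adding `x` to the contents once for every unit removed. -/
theorem RegComputes.drain (i : ℕ) (x : ℕ →₀ ℕ) (hx : x i = 0)
    (h : RegComputes fun v w => w = v + x) :
    RegComputes fun v w => ∃ u k, u i = 0 ∧ v = u + Finsupp.single i k ∧ w = u + k • x := by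
  refine RegComputes.loop i h ?_
  rintro v w ⟨u, k, hu, rfl, rfl⟩
  cases k with
  | zero => left; simp [hu]
  | succ k =>
    right
    refine ⟨u + Finsupp.single i k, u + Finsupp.single i k + x, ?_, rfl,
      ⟨u + x, k, by simp [hu, hx], by abel, ?_⟩, by simp [hx]⟩
    · rw [Finsupp.single_add]; abel
    · rw [succ_nsmul]; abel

theorem RegComputes.clear (i : ℕ) :
    RegComputes fun v w => ∃ u k, u i = 0 ∧ v = u + Finsupp.single i k ∧ w = u :=
  (RegComputes.drain i 0 rfl (RegComputes.skip.mono (by simp))).mono (by simp)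

theorem RegComputes.clearRange (s n : ℕ) :
    RegComputes fun v w => ∃ (u : ℕ →₀ ℕ) (c : ℕ → ℕ), (∀ j, s ≤ j → u j = 0) ∧
      v = u + ∑ j ∈ Finset.range n, Finsupp.single (s + j) (c j) ∧ w = u := by
  induction n with
  | zero => exact RegComputes.skip.mono (by rintro v w ⟨u, c, -, rfl, rfl⟩; simp)
  | succ n ih =>
    refine (RegComputes.clear (s + n)).comp ih ?_
    rintro v w ⟨u, c, hu, rfl, rfl⟩
    refine ⟨_, ⟨w + ∑ j ∈ Finset.range n, Finsupp.single (s + j) (c j), c n, ?_, ?_, rfl⟩,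
      w, c, hu, rfl, rfl⟩
    · simp only [Finsupp.add_apply, hu (s + n) (by omega), Finsupp.finsetSum_apply, zero_add]
      refine Finset.sum_eq_zero fun j hj => ?_
      rw [Finsupp.single_apply_eq_zero]
      intro h
      simp at hj
      omega
    · rw [Finset.sum_range_succ, add_assoc]

theorem RegComputes.copy {i o s : ℕ} (hio : i ≠ o) (his : i ≠ s) (hos : o ≠ s) :
    RegComputes fun v w => v s = 0 ∧ w = v + Finsupp.single o (v i) := by
  have h1 := RegComputes.drain i (Finsupp.single o 1 + Finsupp.single s 1)
    (by simp [hio, his]) ((RegComputes.inc o).comp (RegComputes.inc s)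
      (by rintro v w rfl; exact ⟨_, rfl, by abel⟩))
  refine h1.comp (RegComputes.drain s (Finsupp.single i 1) (by simp [his.symm])
    (RegComputes.inc i)) ?_
  rintro v w ⟨hs, rfl⟩
  refine ⟨_, ⟨v.erase i, v i, by simp, (Finsupp.erase_add_single i v).symm, rfl⟩,
    v.erase i + Finsupp.single o (v i), v i, ?_, ?_, ?_⟩
  · simp [his.symm, hs, hos]
  · simp [add_assoc]
  · conv_lhs => rw [← Finsupp.erase_add_single i v]
    simp
    abel

theorem Finsupp.sum_range_single_add_apply (s k : ℕ) (c : ℕ → ℕ) (i : ℕ) :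
    (∑ j ∈ Finset.range k, Finsupp.single (s + j) (c j)) i =
      if s ≤ i ∧ i < s + k then c (i - s) else 0 := by
  induction k with
  | zero => simp
  | succ k ih =>
    rw [Finset.sum_range_succ, Finsupp.add_apply, ih, Finsupp.single_apply]
    by_cases h : s + k = i
    · subst h
      simp
    · rw [if_neg h, add_zero]
      refine if_congr (by omega) rfl rfl

theorem Nat.Primrec'.regComputes {n : ℕ} {f : List.Vector ℕ n → ℕ} (hf : Nat.Primrec' f) :
    ∀ (ins : Fin n → ℕ) (o s : ℕ), (∀ i, ins i < s) → (∀ i, ins i ≠ o) → o < s →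
      RegComputes fun v w => (∀ j, s ≤ j → v j = 0) ∧
        w = v + Finsupp.single o (f (List.Vector.ofFn fun i => v (ins i))) := by
  induction hf with
  | zero =>
    intro ins o s _ _ _
    exact RegComputes.skip.mono (by rintro v w ⟨_, rfl⟩; simp)
  | succ =>
    intro ins o s h1 h2 h3
    refine (RegComputes.copy (h2 0) (h1 0).ne h3.ne).comp (RegComputes.inc o) ?_
    rintro v w ⟨hv, rfl⟩
    refine ⟨_, ⟨hv s le_rfl, rfl⟩, ?_⟩
    simp [List.Vector.ofFn, add_assoc, ← Finsupp.single_add]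
  | get i =>
    intro ins o s h1 h2 h3
    refine (RegComputes.copy (h2 i) (h1 i).ne h3.ne).mono ?_
    rintro v w ⟨hv, rfl⟩
    exact ⟨hv s le_rfl, by simp⟩
  | @comp m n f g _ _ ihf ihg =>
    intro ins o s h1 h2 h3
    let G : (ℕ →₀ ℕ) → ℕ → ℕ := fun v j =>
      if h : j < n then g ⟨j, h⟩ (List.Vector.ofFn fun i => v (ins i)) else 0
    have args : ∀ k ≤ n, RegComputes fun v w => (∀ j, s ≤ j → v j = 0) ∧
        w = v + ∑ j ∈ Finset.range k, Finsupp.single (s + j) (G v j) := by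
      intro k hk
      induction k with
      | zero => exact RegComputes.skip.mono (by rintro v w ⟨-, rfl⟩; simp)
      | succ k ih =>
        refine (ih (by omega)).comp (ihg ⟨k, hk⟩ ins (s + k) (s + n)
          (fun i => (h1 i).trans_le (by omega)) (fun i => ((h1 i).trans_le (by omega)).ne)
          (by omega)) ?_
        rintro v w ⟨hv, rfl⟩
        refine ⟨_, ⟨hv, rfl⟩, ?_, ?_⟩
        · intro j hj
          rw [Finsupp.add_apply, hv j (by omega), Finsupp.sum_range_single_add_apply,
            if_neg (by omega)]
        · rw [Finset.sum_range_succ, ← add_assoc]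
          have hk' : k < n := hk
          have hi : ∀ i, (v + ∑ j ∈ Finset.range k, Finsupp.single (s + j) (G v j)) (ins i) =
              v (ins i) := fun i => by
            rw [Finsupp.add_apply, Finsupp.sum_range_single_add_apply,
              if_neg (by have := h1 i; omega), add_zero]
          simp only [hi]
          simp only [G, hk', dif_pos]
    have call := (args n le_rfl).comp (ihf (fun i => s + i) o (s + n) (fun i => by omega)
      (fun i => by omega) (by omega)) (S'' := fun v w => (∀ j, s ≤ j → v j = 0) ∧
        w = v + Finsupp.single o (f (List.Vector.ofFn fun i =>
          g i (List.Vector.ofFn fun i => v (ins i)))) +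
          ∑ j ∈ Finset.range n, Finsupp.single (s + j) (G v j)) (by
        rintro v w ⟨hv, rfl⟩
        refine ⟨_, ⟨hv, rfl⟩, ?_, ?_⟩
        · intro j hj
          rw [Finsupp.add_apply, hv j (by omega), Finsupp.sum_range_single_add_apply,
            if_neg (by omega)]
        · have hi : ∀ i : Fin n,
              (v + ∑ j ∈ Finset.range n, Finsupp.single (s + j) (G v j)) (s + i) =
                g i (List.Vector.ofFn fun i => v (ins i)) := fun i => by
            rw [Finsupp.add_apply, Finsupp.sum_range_single_add_apply,
              if_pos (by omega), hv _ (by omega)]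
            simp [G]
          simp only [hi]
          abel)
    refine call.comp (RegComputes.clearRange s n) ?_
    rintro v w ⟨hv, rfl⟩
    refine ⟨_, ⟨hv, rfl⟩, _, _, ?_, rfl, rfl⟩
    intro j hj
    rw [Finsupp.add_apply, hv j hj, Finsupp.single_eq_of_ne (by omega), add_zero]
  | @prec n f g _ _ ihf ihg =>
    intro ins o s h1 h2 h3
    let P : (ℕ →₀ ℕ) → ℕ → ℕ := fun v y =>
      Nat.rec (f (List.Vector.ofFn fun i => v (ins i.succ)))
        (fun y IH => g (y ::ᵥ IH ::ᵥ List.Vector.ofFn fun i => v (ins i.succ))) y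
    have init := (RegComputes.copy (i := ins 0) (o := s) (s := s + 1) (h1 0).ne
      ((h1 0).trans_le (by omega)).ne (by omega)).comp
      (ihf (fun i => ins i.succ) (s + 2) (s + 4) (fun i => (h1 _).trans_le (by omega))
        (fun i => ((h1 _).trans_le (by omega)).ne) (by omega))
      (S'' := fun v w => (∀ j, s ≤ j → v j = 0) ∧
        w = v + Finsupp.single s (v (ins 0)) + Finsupp.single (s + 2) (P v 0)) (by
        rintro v w ⟨hv, rfl⟩
        refine ⟨_, ⟨hv _ (by omega), rfl⟩, ?_, ?_⟩
        · intro j hj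
          rw [Finsupp.add_apply, hv j (by omega), Finsupp.single_eq_of_ne (by omega), add_zero]
        · have hi : ∀ i : Fin n, (v + Finsupp.single s (v (ins 0))) (ins i.succ) =
              v (ins i.succ) := fun i => by
            rw [Finsupp.add_apply, Finsupp.single_eq_of_ne (h1 _).ne, add_zero]
          simp only [hi, P]
          rfl)
    let cfg : (ℕ →₀ ℕ) → ℕ → ℕ → ℕ → ℕ → (ℕ →₀ ℕ) := fun u k y p q =>
      u + Finsupp.single s k + Finsupp.single (s + 1) y + Finsupp.single (s + 2) p +
        Finsupp.single (s + 3) q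
    have body : RegComputes fun v w => ∃ u k y, (∀ j, s ≤ j → u j = 0) ∧
        v = cfg u k y (P u y) 0 ∧ w = cfg u k (y + 1) (P u (y + 1)) 0 := by
      have b1 := (ihg (Fin.cons (s + 1) (Fin.cons (s + 2) fun i => ins i.succ)) (s + 3) (s + 4)
        (by
          refine Fin.cases (by simp) (Fin.cases (by simp) fun i => ?_)
          simpa using (h1 i.succ).trans_le (by omega))
        (by
          refine Fin.cases (by simp) (Fin.cases (by simp) fun i => ?_)
          simpa using ((h1 i.succ).trans_le (by omega)).ne) (by omega)).mono
        (S' := fun v w => ∃ u k y, (∀ j, s ≤ j → u j = 0) ∧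
        v = cfg u k y (P u y) 0 ∧ w = cfg u k y (P u y) (P u (y + 1))) (by
          rintro v w ⟨u, k, y, hu, rfl, rfl⟩
          refine ⟨fun j hj => ?_, ?_⟩
          · simp (disch := omega) [cfg, hu j (by omega), Finsupp.single_eq_of_ne]
          · have hi : ∀ i : Fin n, cfg u k y (P u y) 0 (ins i.succ) = u (ins i.succ) := by
              intro i
              have := h1 i.succ
              simp (disch := omega) [cfg, Finsupp.single_eq_of_ne]
            have hy : cfg u k y (P u y) 0 (s + 1) = y := by
              simp (disch := omega) [cfg, hu (s + 1), Finsupp.single_eq_of_ne]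
            have hp : cfg u k y (P u y) 0 (s + 2) = P u y := by
              simp (disch := omega) [cfg, hu (s + 2), Finsupp.single_eq_of_ne]
            simp only [List.Vector.ofFn, Fin.cons_zero, Fin.cons_succ, hi, hy, hp]
            simp [cfg, P])
      have b2 := b1.comp (RegComputes.clear (s + 2)) (S'' := fun v w => ∃ u k y,
        (∀ j, s ≤ j → u j = 0) ∧ v = cfg u k y (P u y) 0 ∧ w = cfg u k y 0 (P u (y + 1))) (by
          rintro v w ⟨u, k, y, hu, rfl, rfl⟩
          refine ⟨_, ⟨u, k, y, hu, rfl, rfl⟩, cfg u k y 0 (P u (y + 1)), P u y, ?_, ?_, rfl⟩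
          · simp (disch := omega) [cfg, hu (s + 2), Finsupp.single_eq_of_ne]
          · simp only [cfg, Finsupp.single_zero]
            abel)
      have b3 := b2.comp (RegComputes.drain (s + 3) (Finsupp.single (s + 2) 1) (by simp)
        (RegComputes.inc _)) (S'' := fun v w => ∃ u k y,
        (∀ j, s ≤ j → u j = 0) ∧ v = cfg u k y (P u y) 0 ∧ w = cfg u k y (P u (y + 1)) 0) (by
          rintro v w ⟨u, k, y, hu, rfl, rfl⟩
          refine ⟨_, ⟨u, k, y, hu, rfl, rfl⟩, cfg u k y 0 0, P u (y + 1), ?_, ?_, ?_⟩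
          · simp (disch := omega) [cfg, hu (s + 3), Finsupp.single_eq_of_ne]
          · simp only [cfg, Finsupp.single_zero]
            abel
          · simp [cfg])
      refine b3.comp (RegComputes.inc (s + 1)) ?_
      rintro v w ⟨u, k, y, hu, rfl, rfl⟩
      refine ⟨_, ⟨u, k, y, hu, rfl, rfl⟩, ?_⟩
      simp only [cfg, Finsupp.single_add]
      abel
    have main : RegComputes fun v w => ∃ u k y, (∀ j, s ≤ j → u j = 0) ∧
        v = cfg u k y (P u y) 0 ∧ w = cfg u 0 (y + k) (P u (y + k)) 0 := by
      refine body.loop s ?_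
      rintro v w ⟨u, k, y, hu, rfl, rfl⟩
      cases k with
      | zero =>
        left
        refine ⟨?_, rfl⟩
        simp (disch := omega) [cfg, hu s, Finsupp.single_eq_of_ne]
      | succ k =>
        right
        refine ⟨_, _, ?_, ⟨u, k, y, hu, rfl, rfl⟩, ⟨u, k, y + 1, hu, rfl, ?_⟩, ?_⟩
        · simp only [cfg, Finsupp.single_add]
          abel
        · rw [show y + (k + 1) = y + 1 + k by ring]
        · simp (disch := omega) [cfg, Finsupp.single_eq_of_ne]
    have fin := (main.comp (RegComputes.drain (s + 2) (Finsupp.single o 1)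
      (Finsupp.single_eq_of_ne (by omega)) (RegComputes.inc _))
      (S'' := fun v w => ∃ u k, (∀ j, s ≤ j → u j = 0) ∧ v = cfg u k 0 (P u 0) 0 ∧
        w = u + Finsupp.single o (P u k) + Finsupp.single (s + 1) k) (by
        rintro v w ⟨u, k, hu, rfl, rfl⟩
        refine ⟨_, ⟨u, k, 0, hu, rfl, rfl⟩, u + Finsupp.single (s + 1) k, P u k, ?_, ?_, ?_⟩
        · simp (disch := omega) [hu (s + 2), Finsupp.single_eq_of_ne]
        · simp [cfg]
        · simp; abel)).comp (RegComputes.clear (s + 1)) (S'' := fun v w => ∃ u k,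
        (∀ j, s ≤ j → u j = 0) ∧ v = cfg u k 0 (P u 0) 0 ∧
        w = u + Finsupp.single o (P u k)) (by
        rintro v w ⟨u, k, hu, rfl, rfl⟩
        refine ⟨_, ⟨u, k, hu, rfl, rfl⟩, _, k, ?_, rfl, rfl⟩
        simp (disch := omega) [hu (s + 1), Finsupp.single_eq_of_ne])
    refine init.comp fin ?_
    rintro v w ⟨hv, rfl⟩
    refine ⟨_, ⟨hv, rfl⟩, v, v (ins 0), hv, by simp [cfg], ?_⟩
    simp [P, List.Vector.ofFn]

/-- Every semidecidable set of the form `{n | ∃ k, f n k = 0}` with `f` primitive recursive is the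
set of inputs on which some nondeterministic register machine can halt. -/
theorem exists_realizable_iff_of_primrec {f : ℕ → ℕ → ℕ} (hf : Primrec₂ f) :
    ∃ R, Realizable R ∧ ∀ n, (∃ w, R (Finsupp.single 0 n) w) ↔ ∃ k, f n k = 0 := by
  obtain ⟨R, hR, h⟩ := (Nat.Primrec'.prim_iff₂.2 hf).regComputes (fun i => i) 2 3
    (fun i => by omega) (fun i => by omega) (by omega)
  refine ⟨_, (Realizable.instr (.inc 1)).star.comp (hR.comp (Realizable.instr (.zero 2))), ?_⟩
  have hs : ∀ n m, ReflTransGen (RegInstr.inc 1).Exec (Finsupp.single 0 n) m ↔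
      ∃ k, m = Finsupp.single 0 n + Finsupp.single 1 k := by
    intro n m
    constructor
    · intro h
      induction h with
      | refl => exact ⟨0, by simp⟩
      | tail _ hs ih =>
        obtain ⟨k, rfl⟩ := ih
        exact ⟨k + 1, by rw [show _ = _ from hs, Finsupp.single_add, add_assoc]⟩
    · rintro ⟨k, rfl⟩
      induction k with
      | zero => simpa using ReflTransGen.refl
      | succ k ih => exact ih.tail (by
          change _ = _
          rw [Finsupp.single_add, add_assoc])
  have hR' : ∀ n k w, R (Finsupp.single 0 n + Finsupp.single 1 k) w ↔
      w = Finsupp.single 0 n + Finsupp.single 1 k + Finsupp.single 2 (f n k) := by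
    intro n k w
    refine h _ _ ⟨fun j hj => ?_, ?_⟩ w
    · simp (disch := omega) [Finsupp.single_eq_of_ne]
    · simp [List.Vector.ofFn]
  intro n
  constructor
  · rintro ⟨w, m, hm, m', hm', h2⟩
    obtain ⟨k, rfl⟩ := (hs _ _).1 hm
    rw [hR'] at hm'
    subst hm'
    exact ⟨k, by simpa using h2.2⟩
  · rintro ⟨k, hk⟩
    refine ⟨_, _, (hs _ _).2 ⟨k, rfl⟩, _, (hR' _ _ _).2 rfl, rfl, ?_⟩
    simp [hk]

theorem exists_realizable_not_computablePred :
    ∃ R, Realizable R ∧ ¬ ComputablePred fun n : ℕ => ∃ w, R (Finsupp.single 0 n) w := by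
  have hT : Primrec₂ fun n k : ℕ =>
      bif (Nat.Partrec.Code.evaln k (Denumerable.ofNat Nat.Partrec.Code n) 0).isSome
        then 0 else 1 := by
    refine Primrec.cond (Primrec.option_isSome.comp ?_) (Primrec.const 0) (Primrec.const 1)
    exact Nat.Partrec.Code.primrec_evaln.comp
      ((Primrec.snd.pair ((Primrec.ofNat _).comp Primrec.fst)).pair (Primrec.const 0))
  obtain ⟨R, hR, h⟩ := exists_realizable_iff_of_primrec hT
  refine ⟨R, hR, fun hc => ComputablePred.halting_problem 0 ?_⟩
  refine ComputablePred.computable_of_manyOneReducible ⟨_, Computable.encode, fun c => ?_⟩ hc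
  change (c.eval 0).Dom ↔ _
  rw [h, Part.dom_iff_mem]
  simp only [Nat.Partrec.Code.evaln_complete, Denumerable.ofNat_encode, Bool.cond_eq_ite]
  rw [exists_comm]
  refine exists_congr fun k => ?_
  cases Nat.Partrec.Code.evaln k c 0 <;> simp

/-- One application of an affine rule `(p, r, q, s)`, which rewrites `p * k + r` to `q * k + s`. -/
def AffineStep (rules : Set (ℕ × ℕ × ℕ × ℕ)) (x y : ℕ) : Prop :=
  ∃ ρ ∈ rules, ∃ k, x = ρ.1 * k + ρ.2.1 ∧ y = ρ.2.2.1 * k + ρ.2.2.2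

/-- Gödel numbering of register contents. -/
noncomputable def regCode (v : ℕ →₀ ℕ) : ℕ :=
  v.prod fun i n => Nat.nth Nat.Prime i ^ n

theorem regCode_pos (v : ℕ →₀ ℕ) : 0 < regCode v :=
  Finset.prod_pos fun i _ => pow_pos (Nat.prime_nth_prime i).pos _

theorem regCode_add_single (v : ℕ →₀ ℕ) (i : ℕ) :
    regCode (v + Finsupp.single i 1) = Nat.nth Nat.Prime i * regCode v := by
  rw [regCode, Finsupp.prod_add_index' (by simp) (by intros; rw [pow_add]),
    Finsupp.prod_single_index (by simp), pow_one, mul_comm, regCode]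

theorem regCode_single_zero (n : ℕ) : regCode (Finsupp.single 0 n) = 2 ^ n := by
  rw [regCode, Finsupp.prod_single_index (by simp), Nat.nth_prime_zero_eq_two]

theorem nth_prime_dvd_regCode_iff (v : ℕ →₀ ℕ) (i : ℕ) :
    Nat.nth Nat.Prime i ∣ regCode v ↔ v i ≠ 0 := by
  constructor
  · intro h hv
    obtain ⟨j, hj, hd⟩ := (Nat.prime_nth_prime i).prime.exists_mem_finset_dvd h
    have := (Nat.prime_dvd_prime_iff_eq (Nat.prime_nth_prime i) (Nat.prime_nth_prime j)).1
      ((Nat.prime_nth_prime i).dvd_of_dvd_pow hd)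
    rw [Nat.nth_injective Nat.infinite_setOfPred_prime this] at hv
    exact Finsupp.mem_support_iff.1 hj hv
  · intro h
    obtain ⟨w, rfl⟩ : ∃ w, v = w + Finsupp.single i 1 :=
      ⟨v - Finsupp.single i 1, (tsub_add_cancel_of_le
        (Finsupp.single_le_iff.2 (Nat.one_le_iff_ne_zero.2 h))).symm⟩
    rw [regCode_add_single]
    exact dvd_mul_right _ _

/-- The affine rules simulating an instruction leading from state `a` to state `b`, when the
configuration with state `a < Q` and register contents `v` is coded by `Q * regCode v + a`. -/
def RegInstr.affineRules (Q a b : ℕ) : RegInstr → Set (ℕ × ℕ × ℕ × ℕ)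
  | skip => {(Q, a, Q, b)}
  | inc i => {(Q, a, Q * Nat.nth Nat.Prime i, b)}
  | dec i => {(Q * Nat.nth Nat.Prime i, a, Q, b)}
  | zero i => (fun r => (Q * Nat.nth Nat.Prime i, Q * r + a, Q * Nat.nth Nat.Prime i, Q * r + b)) ''
      Set.Ioo 0 (Nat.nth Nat.Prime i)

theorem RegInstr.finite_affineRules (Q a b : ℕ) (c : RegInstr) : (c.affineRules Q a b).Finite := by
  cases c with
  | zero i => exact (Set.finite_Ioo _ _).image _
  | _ => exact Set.finite_singleton _

theorem eq_and_eq_of_mul_add_eq {Q x y a b : ℕ} (ha : a < Q) (hb : b < Q)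
    (h : Q * x + a = Q * y + b) : x = y ∧ a = b := by
  have h1 := congrArg (· / Q) h
  have h2 := congrArg (· % Q) h
  simp only [Nat.mul_add_div (by omega : 0 < Q), Nat.div_eq_of_lt ha, Nat.div_eq_of_lt hb,
    Nat.mul_add_mod, Nat.mod_eq_of_lt ha, Nat.mod_eq_of_lt hb] at h1 h2
  omega

theorem RegInstr.affineStep_affineRules_iff {Q a b a' : ℕ} (ha : a < Q) (ha' : a' < Q)
    (c : RegInstr) (v : ℕ →₀ ℕ) (y : ℕ) :
    AffineStep (c.affineRules Q a b) (Q * regCode v + a') y ↔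
      a' = a ∧ ∃ w, c.Exec v w ∧ y = Q * regCode w + b := by
  cases c with
  | skip =>
    simp only [AffineStep, affineRules, Set.mem_singleton_iff, exists_eq_left, Exec]
    constructor
    · rintro ⟨k, h, rfl⟩
      obtain ⟨rfl, rfl⟩ := eq_and_eq_of_mul_add_eq ha' ha h
      exact ⟨rfl, rfl⟩
    · rintro ⟨rfl, rfl⟩
      exact ⟨_, rfl, rfl⟩
  | inc i =>
    simp only [AffineStep, affineRules, Set.mem_singleton_iff, exists_eq_left, Exec,
      regCode_add_single, ← mul_assoc]
    constructor
    · rintro ⟨k, h, rfl⟩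
      obtain ⟨rfl, rfl⟩ := eq_and_eq_of_mul_add_eq ha' ha h
      exact ⟨rfl, rfl⟩
    · rintro ⟨rfl, rfl⟩
      exact ⟨_, rfl, rfl⟩
  | dec i =>
    simp only [AffineStep, affineRules, Set.mem_singleton_iff, exists_eq_left, Exec, mul_assoc]
    constructor
    · rintro ⟨k, h, rfl⟩
      obtain ⟨hk, rfl⟩ := eq_and_eq_of_mul_add_eq ha' ha h
      have hd := (nth_prime_dvd_regCode_iff v i).1 ⟨k, hk⟩
      obtain ⟨w, rfl⟩ : ∃ w, v = w + Finsupp.single i 1 :=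
        ⟨v - Finsupp.single i 1, (tsub_add_cancel_of_le
          (Finsupp.single_le_iff.2 (Nat.one_le_iff_ne_zero.2 hd))).symm⟩
      rw [regCode_add_single] at hk
      rw [← Nat.eq_of_mul_eq_mul_left (Nat.prime_nth_prime i).pos hk]
      exact ⟨rfl, w, rfl, rfl⟩
    · rintro ⟨rfl, w, rfl, rfl⟩
      exact ⟨_, by rw [regCode_add_single], rfl⟩
  | zero i =>
    simp only [AffineStep, affineRules, Set.exists_mem_image, Exec]
    have e : ∀ k r t, Q * Nat.nth Nat.Prime i * k + (Q * r + t) =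
      Q * (Nat.nth Nat.Prime i * k + r) + t := fun k r t => by ring
    simp only [e]
    constructor
    · rintro ⟨r, ⟨hr, hr'⟩, k, h, rfl⟩
      obtain ⟨hk, rfl⟩ := eq_and_eq_of_mul_add_eq ha' ha h
      refine ⟨rfl, v, ⟨rfl, ?_⟩, by rw [hk]⟩
      by_contra hv
      rw [← Ne, ← nth_prime_dvd_regCode_iff, hk, Nat.dvd_add_right (dvd_mul_right _ _)] at hv
      exact absurd (Nat.le_of_dvd hr hv) (by omega)
    · rintro ⟨rfl, w, ⟨rfl, hv⟩, rfl⟩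
      refine ⟨regCode w % Nat.nth Nat.Prime i, ⟨Nat.pos_of_ne_zero fun h => ?_,
        Nat.mod_lt _ (Nat.prime_nth_prime i).pos⟩, regCode w / Nat.nth Nat.Prime i, ?_, ?_⟩
      · exact (nth_prime_dvd_regCode_iff _ _).1 (Nat.dvd_of_mod_eq_zero h) hv
      all_goals rw [Nat.div_add_mod]

theorem AffineStep.mono {S T : Set (ℕ × ℕ × ℕ × ℕ)} (h : S ⊆ T) {x y : ℕ}
    (hs : AffineStep S x y) : AffineStep T x y :=
  let ⟨ρ, hρ, hk⟩ := hs
  ⟨ρ, h hρ, hk⟩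

/-- Register machines can be simulated by affine rules. -/
theorem Realizable.exists_affineRules {R : (ℕ →₀ ℕ) → (ℕ →₀ ℕ) → Prop} (hR : Realizable R) :
    ∃ (rules : Set (ℕ × ℕ × ℕ × ℕ)) (Q q : ℕ), rules.Finite ∧ ∀ v,
      (∃ w, R v w) ↔ ReflTransGen (AffineStep rules) (Q * regCode v + q) 0 := by
  obtain ⟨σ, _, T, s, f, hT, hR⟩ := hR
  obtain ⟨Q, ⟨φ⟩⟩ := Finite.exists_equiv_fin σ
  let e : σ → ℕ := fun a => φ a
  have he : ∀ a, e a < Q := fun a => (φ a).isLt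
  have hinj : ∀ {a b}, e a = e b → a = b := fun h => φ.injective (Fin.ext h)
  let S : Set (ℕ × ℕ × ℕ × ℕ) := ⋃ t ∈ T, t.2.1.affineRules Q (e t.1) (e t.2.2)
  have step : ∀ a v y, AffineStep S (Q * regCode v + e a) y ↔
      ∃ b w, RegStep T (a, v) (b, w) ∧ y = Q * regCode w + e b := by
    intro a v y
    constructor
    · rintro ⟨ρ, hρ, hk⟩
      obtain ⟨⟨a', c, b⟩, ht, hρ⟩ := Set.mem_iUnion₂.1 hρ
      obtain ⟨h1, w, h2, h3⟩ := (RegInstr.affineStep_affineRules_iff (he a') (he a) c v y).1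
        ⟨ρ, hρ, hk⟩
      obtain rfl := hinj h1
      exact ⟨b, w, ⟨c, ht, h2⟩, h3⟩
    · rintro ⟨b, w, ⟨c, ht, h2⟩, h3⟩
      exact AffineStep.mono (Set.subset_iUnion₂_of_subset (a, c, b) ht subset_rfl)
        ((RegInstr.affineStep_affineRules_iff (he a) (he a) c v y).2 ⟨rfl, w, h2, h3⟩)
  refine ⟨insert (Q, e f, 0, 0) S, Q, e s,
    (hT.biUnion fun t _ => RegInstr.finite_affineRules _ _ _ _).insert _, fun v => ?_⟩
  simp only [← hR]
  constructor
  · rintro ⟨w, hw⟩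
    have := ReflTransGen.lift (fun x : σ × (ℕ →₀ ℕ) => Q * regCode x.2 + e x.1)
      (p := AffineStep (insert (Q, e f, 0, 0) S))
      (fun x y hxy => AffineStep.mono (Set.subset_insert _ _) ((step x.1 x.2 _).2 ⟨_, _, hxy, rfl⟩))
      _ _ hw
    exact this.tail ⟨_, Set.mem_insert _ _, _, rfl, by simp⟩
  · intro h
    have key : ∀ x, ReflTransGen (AffineStep (insert (Q, e f, 0, 0) S)) (Q * regCode v + e s) x →
        (∃ w, ReflTransGen (RegStep T) (s, v) (f, w)) ∨
        ∃ a w, x = Q * regCode w + e a ∧ ReflTransGen (RegStep T) (s, v) (a, w) := by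
      intro x hx
      induction hx with
      | refl => exact Or.inr ⟨s, v, rfl, .refl⟩
      | tail _ hs ih =>
        rcases ih with ih | ⟨a, w, rfl, hr⟩
        · exact Or.inl ih
        · obtain ⟨ρ, rfl | hρ, hk⟩ := hs
          · obtain ⟨k, hk, -⟩ := hk
            obtain ⟨-, h⟩ := eq_and_eq_of_mul_add_eq (he a) (he f) hk
            obtain rfl := hinj h
            exact Or.inl ⟨w, hr⟩
          · obtain ⟨b, w', hs, rfl⟩ := (step _ _ _).1 ⟨ρ, hρ, hk⟩
            exact Or.inr ⟨b, w', rfl, hr.tail hs⟩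
    rcases key _ h with h | ⟨a, w, h, -⟩
    · exact h
    · have := Nat.mul_pos (Nat.zero_lt_of_lt (he a)) (regCode_pos w)
      omega

theorem exists_affineRules_not_computablePred :
    ∃ (rules : Set (ℕ × ℕ × ℕ × ℕ)) (Q q : ℕ), rules.Finite ∧
      ¬ ComputablePred fun n : ℕ => ReflTransGen (AffineStep rules) (Q * 2 ^ n + q) 0 := by
  obtain ⟨R, hR, h⟩ := exists_realizable_not_computablePred
  obtain ⟨rules, Q, q, hf, hr⟩ := hR.exists_affineRules
  refine ⟨rules, Q, q, hf, ?_⟩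
  simpa only [hr, regCode_single_zero] using h

section Simulation

variable {G : Type*} [Group G] (a b c d : G)

/-- The element written by a simulation of a step from `x` to `y`. -/
def pushWord (x y : ℕ) : G :=
  b ^ x * c ^ (y + 2) * d * a

/-- The element removed by a verification of the value `y`. -/
def popWord (y : ℕ) : G :=
  d * c ^ 2 * (c * b) ^ y * a

theorem popWord_inv (y : ℕ) :
    (popWord a b c d y)⁻¹ = a⁻¹ * ((c * b)⁻¹ ^ y * (d * c ^ 2)⁻¹) := by
  rw [popWord, inv_pow, mul_inv_rev, mul_inv_rev]

variable {a b c d}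

theorem pushWord_mul_popWord_inv (hab : Commute a b) (hbc : Commute b c) (hcd : Commute c d)
    (x y : ℕ) : pushWord a b c d x y * b ^ y * (popWord a b c d y)⁻¹ = b ^ x := by
  have h1 : a * b ^ y = b ^ y * a := hab.pow_right y
  have h2 : (c * b) ^ y = c ^ y * b ^ y := hbc.symm.mul_pow y
  have h3 : c ^ (y + 2) * d = d * c ^ (y + 2) := hcd.pow_left _
  rw [mul_inv_eq_iff_eq_mul, pushWord, popWord, h2]
  calc b ^ x * c ^ (y + 2) * d * a * b ^ y = b ^ x * (c ^ (y + 2) * d) * (a * b ^ y) := by group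
    _ = b ^ x * (d * c ^ 2 * (c ^ y * b ^ y) * a) := by
      rw [h1, h3, add_comm y 2, pow_add]
      group

variable (a b c d)

/-- The state in which the rule `ρ` is being applied. -/
def ruleState (ρ : ℕ × ℕ × ℕ × ℕ) : ℕ :=
  3 + Encodable.encode ρ

/-- A finite automaton over `G` whose runs from `0` to `1` first write and then remove the
intermediate values of a computation with the given affine rules. -/
def simEdges (rules : Set (ℕ × ℕ × ℕ × ℕ)) : Set (ℕ × G × ℕ) :=
  {(0, 1, 1), (1, a⁻¹, 2), (2, (c * b)⁻¹, 2), (2, (d * c ^ 2)⁻¹, 1)} ∪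
    ⋃ ρ ∈ rules, {(0, 1, ruleState ρ), (ruleState ρ, b ^ ρ.1 * c ^ ρ.2.2.1, ruleState ρ),
      (ruleState ρ, b ^ ρ.2.1 * c ^ (ρ.2.2.2 + 2) * d * a, 0)}

theorem finite_simEdges {rules : Set (ℕ × ℕ × ℕ × ℕ)} (h : rules.Finite) :
    (simEdges a b c d rules).Finite :=
  (Set.toFinite _).union (h.biUnion fun _ _ => Set.toFinite _)

/-- Runs of an automaton over a group. -/
inductive GroupPath (E : Set (ℕ × G × ℕ)) : ℕ → G → ℕ → Prop
  | nil (e : ℕ) : GroupPath E e 1 e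
  | cons {s m e : ℕ} {g h : G} : (s, g, m) ∈ E → GroupPath E m h e → GroupPath E s (g * h) e

variable {a b c d} {rules : Set (ℕ × ℕ × ℕ × ℕ)}

theorem simEdges_induction (hab : Commute a b) (hbc : Commute b c) (hcd : Commute c d)
    {C : ℕ → G → ℕ → Prop} (hE : ∀ s g e, (s, g, e) ∈ simEdges a b c d rules → C s g e)
    (hC : ∀ s m e g h, C s g m → C m h e → C s (g * h) e) {x : ℕ}
    (hx : ReflTransGen (AffineStep rules) x 0) : C 0 (b ^ x) 1 := by
  have h01 : C 0 1 1 := hE _ _ _ (Or.inl (by simp))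
  have hpush : ∀ x y, AffineStep rules x y → C 0 (pushWord a b c d x y) 0 := by
    rintro x y ⟨ρ, hρ, k, rfl, rfl⟩
    have hmem : ∀ {e}, e ∈ ({(0, 1, ruleState ρ), (ruleState ρ, b ^ ρ.1 * c ^ ρ.2.2.1, ruleState ρ),
        (ruleState ρ, b ^ ρ.2.1 * c ^ (ρ.2.2.2 + 2) * d * a, 0)} : Set (ℕ × G × ℕ)) →
        e ∈ simEdges a b c d rules := fun he => Or.inr (Set.mem_iUnion₂.2 ⟨ρ, hρ, he⟩)
    have hk : C 0 ((b ^ ρ.1 * c ^ ρ.2.2.1) ^ k) (ruleState ρ) := by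
      induction k with
      | zero => simpa using hE _ _ _ (hmem (by simp))
      | succ k ih =>
        rw [pow_succ]
        exact hC _ _ _ _ _ ih (hE _ _ _ (hmem (by simp)))
    have := hC _ _ _ _ _ hk (hE (ruleState ρ) (b ^ ρ.2.1 * c ^ (ρ.2.2.2 + 2) * d * a) 0
      (hmem (by simp)))
    convert this using 1
    rw [(hbc.pow_pow _ _).mul_pow, ← pow_mul, ← pow_mul, pushWord]
    have h : c ^ (ρ.2.2.1 * k) * b ^ ρ.2.1 = b ^ ρ.2.1 * c ^ (ρ.2.2.1 * k) :=
      (hbc.pow_pow _ _).symm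
    calc b ^ (ρ.1 * k + ρ.2.1) * c ^ (ρ.2.2.1 * k + ρ.2.2.2 + 2) * d * a
        = b ^ (ρ.1 * k) * (b ^ ρ.2.1 * c ^ (ρ.2.2.1 * k)) * c ^ (ρ.2.2.2 + 2) * d * a := by
          rw [pow_add, add_assoc, pow_add c]
          simp only [mul_assoc]
      _ = _ := by
          rw [← h]
          simp only [mul_assoc]
  have hpop : ∀ y, C 1 (popWord a b c d y)⁻¹ 1 := by
    intro y
    have hy : C 1 (a⁻¹ * ((c * b)⁻¹) ^ y) 2 := by
      induction y with
      | zero => simpa using hE _ _ _ (Or.inl (by simp))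
      | succ k ih =>
        rw [pow_succ, ← mul_assoc]
        exact hC _ _ _ _ _ ih (hE _ _ _ (Or.inl (by simp)))
    have := hC _ _ _ _ _ hy (hE 2 (d * c ^ 2)⁻¹ 1 (Or.inl (by simp)))
    convert this using 1
    rw [popWord_inv, mul_assoc]
  induction hx using ReflTransGen.head_induction_on with
  | refl => simpa using h01
  | @head x y hxy _ ih =>
    rw [← pushWord_mul_popWord_inv hab hbc hcd x y]
    exact hC _ _ _ _ _ (hC _ _ _ _ _ (hpush _ _ hxy) ih) (hpop y)

theorem GroupPath.simEdges_shape (hbc : Commute b c) {s : ℕ} {g : G}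
    (hg : GroupPath (simEdges a b c d rules) s g 1) :
    (s = 0 → ∃ (L : List (ℕ × ℕ)) (l : List ℕ), (∀ x ∈ L, AffineStep rules x.1 x.2) ∧
      g = (L.map fun x => pushWord a b c d x.1 x.2).prod *
        (l.map fun y => (popWord a b c d y)⁻¹).prod) := by
  suffices H : ∀ e, e = 1 → GroupPath (simEdges a b c d rules) s g e →
    (s = 0 → ∃ (L : List (ℕ × ℕ)) (l : List ℕ), (∀ x ∈ L, AffineStep rules x.1 x.2) ∧
      g = (L.map fun x => pushWord a b c d x.1 x.2).prod *
        (l.map fun y => (popWord a b c d y)⁻¹).prod) ∧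
    (s = 1 → ∃ l : List ℕ, g = (l.map fun y => (popWord a b c d y)⁻¹).prod) ∧
    (s = 2 → ∃ (m : ℕ) (l : List ℕ), g = ((c * b)⁻¹) ^ m * (d * c ^ 2)⁻¹ *
      (l.map fun y => (popWord a b c d y)⁻¹).prod) ∧
    (∀ ρ, s = ruleState ρ → ∃ (k : ℕ) (L : List (ℕ × ℕ)) (l : List ℕ),
      ρ ∈ rules ∧ (∀ x ∈ L, AffineStep rules x.1 x.2) ∧
      g = pushWord a b c d (ρ.1 * k + ρ.2.1) (ρ.2.2.1 * k + ρ.2.2.2) *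
        (L.map fun x => pushWord a b c d x.1 x.2).prod *
        (l.map fun y => (popWord a b c d y)⁻¹).prod) from (H 1 rfl hg).1
  clear hg
  rintro e he hg
  have hrs : ∀ ρ, 3 ≤ ruleState ρ := fun ρ => Nat.le_add_right _ _
  have hinj : ∀ {ρ ρ'}, ruleState ρ = ruleState ρ' → ρ = ρ' := fun h =>
    Encodable.encode_injective (Nat.add_left_cancel h)
  induction hg with
  | nil e =>
    subst he
    exact ⟨by simp, fun _ => ⟨[], by simp⟩, by simp, fun ρ h => by have := hrs ρ; omega⟩
  | @cons s m e g h hmem _ ih =>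
    obtain ⟨i0, i1, i2, i3⟩ := ih he
    rcases hmem with hmem | hmem
    · simp only [Set.mem_insert_iff, Set.mem_singleton_iff, Prod.mk.injEq] at hmem
      rcases hmem with ⟨rfl, rfl, rfl⟩ | ⟨rfl, rfl, rfl⟩ | ⟨rfl, rfl, rfl⟩ | ⟨rfl, rfl, rfl⟩
      · refine ⟨fun _ => ?_, by simp, by simp, fun ρ h => by have := hrs ρ; omega⟩
        obtain ⟨l, rfl⟩ := i1 rfl
        exact ⟨[], l, by simp, by simp⟩
      · refine ⟨by simp, fun _ => ?_, by simp, fun ρ h => by have := hrs ρ; omega⟩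
        obtain ⟨k, l, rfl⟩ := i2 rfl
        refine ⟨k :: l, ?_⟩
        simp only [List.map_cons, List.prod_cons, popWord_inv, mul_assoc]
      · refine ⟨by simp, by simp, fun _ => ?_, fun ρ h => by have := hrs ρ; omega⟩
        obtain ⟨k, l, rfl⟩ := i2 rfl
        exact ⟨k + 1, l, by rw [pow_succ' (c * b)⁻¹ k]; simp only [mul_assoc]⟩
      · refine ⟨by simp, by simp, fun _ => ?_, fun ρ h => by have := hrs ρ; omega⟩
        obtain ⟨l, rfl⟩ := i1 rfl
        exact ⟨0, l, by simp⟩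
    · obtain ⟨ρ, hρ, hmem⟩ := Set.mem_iUnion₂.1 hmem
      have h3 := hrs ρ
      simp only [Set.mem_insert_iff, Set.mem_singleton_iff, Prod.mk.injEq] at hmem
      rcases hmem with ⟨rfl, rfl, rfl⟩ | ⟨rfl, rfl, rfl⟩ | ⟨rfl, rfl, rfl⟩
      · refine ⟨fun _ => ?_, by simp, by simp, fun ρ h => by have := hrs ρ; omega⟩
        obtain ⟨k, L, l, -, hL, rfl⟩ := i3 ρ rfl
        exact ⟨(_, _) :: L, l, List.forall_mem_cons.2 ⟨⟨ρ, hρ, k, rfl, rfl⟩, hL⟩, by simp⟩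
      · refine ⟨by omega, by omega, by omega, fun ρ' h => ?_⟩
        obtain rfl := hinj h
        obtain ⟨k, L, l, -, hL, rfl⟩ := i3 ρ rfl
        refine ⟨k + 1, L, l, hρ, hL, ?_⟩
        simp only [← mul_assoc]
        congr 2
        have h : c ^ ρ.2.2.1 * b ^ (ρ.1 * k + ρ.2.1) = b ^ (ρ.1 * k + ρ.2.1) * c ^ ρ.2.2.1 :=
          (hbc.pow_pow _ _).symm
        simp only [pushWord]
        calc _ = b ^ ρ.1 * (c ^ ρ.2.2.1 * b ^ (ρ.1 * k + ρ.2.1)) *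
              c ^ (ρ.2.2.1 * k + ρ.2.2.2 + 2) * d * a := by simp only [mul_assoc]
          _ = b ^ (ρ.1 + (ρ.1 * k + ρ.2.1)) * c ^ (ρ.2.2.1 + (ρ.2.2.1 * k + ρ.2.2.2 + 2)) *
              d * a := by
            rw [h, pow_add b (ρ.1), pow_add c (ρ.2.2.1)]
            simp only [mul_assoc]
          _ = _ := by
            congr 4 <;> ring
      · refine ⟨by omega, by omega, by omega, fun ρ' h => ?_⟩
        obtain rfl := hinj h
        obtain ⟨L, l, hL, rfl⟩ := i0 rfl
        exact ⟨0, L, l, hρ, hL, by simp [pushWord, mul_assoc]⟩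

end Simulation

/-- Translation of a single entry of a sequence. -/
def entryPerm (q : ℚ) : Equiv.Perm ((ℤ → ℚ) × ℤ) where
  toFun κ := (κ.1 + Pi.single 0 q, κ.2)
  invFun κ := (κ.1 - Pi.single 0 q, κ.2)
  left_inv κ := by simp
  right_inv κ := by simp

/-- A square root of a translation of the entry at `0`. -/
def flipPerm : Equiv.Perm ((ℤ → ℚ) × ℤ) where
  toFun κ := (κ.1 + Pi.single 0 (1 - 4 * κ.2 : ℚ), -κ.2)
  invFun κ := (κ.1 - Pi.single 0 (1 + 4 * κ.2 : ℚ), -κ.2)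
  left_inv κ := by simp [sub_eq_add_neg]
  right_inv κ := by simp [sub_eq_add_neg]

/-- Shift of the sequence by `± n`, with the sign depending on the parity of the counter. -/
def shiftPerm (n : ℤ) : Equiv.Perm ((ℤ → ℚ) × ℤ) where
  toFun κ := (fun j => κ.1 (j - if Even κ.2 then n else -n), κ.2 - 2 * n)
  invFun κ := (fun j => κ.1 (j + if Even κ.2 then n else -n), κ.2 + 2 * n)
  left_inv κ := by
    have : Even (κ.2 - 2 * n) ↔ Even κ.2 := by simp [Int.even_sub]
    simp [this]
  right_inv κ := by
    have : Even (κ.2 + 2 * n) ↔ Even κ.2 := by simp [Int.even_add]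
    simp [this]

theorem entryPerm_mul (p q : ℚ) : entryPerm p * entryPerm q = entryPerm (p + q) := by
  ext1 κ
  simp [entryPerm, Pi.single_add, add_assoc, add_comm (Pi.single 0 q : ℤ → ℚ)]

theorem shiftPerm_mul (m n : ℤ) : shiftPerm m * shiftPerm n = shiftPerm (m + n) := by
  ext1 κ
  have : Even (κ.2 - 2 * n) ↔ Even κ.2 := by simp [Int.even_sub]
  simp only [shiftPerm, Equiv.Perm.coe_mul, Equiv.coe_fn_mk, Function.comp_apply, this]
  refine Prod.ext (funext fun j => ?_) ?_
  · dsimp only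
    split_ifs <;> ring_nf
  · dsimp only
    ring

theorem entryPerm_zero : entryPerm 0 = 1 := by
  ext1 κ
  simp [entryPerm]

theorem shiftPerm_zero : shiftPerm 0 = 1 := by
  ext1 κ
  simp [shiftPerm]

theorem flipPerm_mul_self : flipPerm * flipPerm = entryPerm 2 := by
  ext1 κ
  refine Prod.ext ?_ ?_
  · simp only [flipPerm, entryPerm, Equiv.Perm.coe_mul, Equiv.coe_fn_mk, Function.comp_apply]
    rw [add_assoc, ← Pi.single_add]
    congr 2
    push_cast
    ring
  · simp [flipPerm, entryPerm]

/-- Permutations `α i` satisfying `(α (i + 1) * α i) ^ 2 * α i ^ 2 = 1`. -/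
def ladderPerm (i : ℤ) : Equiv.Perm ((ℤ → ℚ) × ℤ) :=
  if i < 0 then entryPerm ((-2) ^ i) else if i = 0 then flipPerm else
    if i = 1 then Equiv.prodCongr (Equiv.refl _) (Equiv.addRight 1)
    else shiftPerm ((-2) ^ (i - 2).toNat)

theorem ladderPerm_relation (i : ℤ) :
    ladderPerm (i + 1) * ladderPerm i * ladderPerm (i + 1) * ladderPerm i *
      ladderPerm i * ladderPerm i = 1 := by
  rcases lt_trichotomy i (-1) with h | rfl | h
  · simp only [ladderPerm, if_pos (by omega : i < 0), if_pos (by omega : i + 1 < 0),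
      entryPerm_mul]
    rw [← entryPerm_zero, zpow_add₀ (by norm_num)]
    congr 1
    ring
  · ext1 κ
    refine Prod.ext ?_ ?_
    · simp only [ladderPerm, flipPerm, entryPerm]
      simp
      simp only [add_assoc, ← Pi.single_add]
      convert add_zero κ.1 using 2
      rw [Pi.single_eq_zero_iff]
      ring
    · simp [ladderPerm, flipPerm, entryPerm]
  · obtain rfl | rfl | h : i = 0 ∨ i = 1 ∨ 2 ≤ i := by omega
    · ext1 κ
      refine Prod.ext ?_ ?_
      · simp [ladderPerm, flipPerm]
        simp only [add_assoc, ← Pi.single_add]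
        convert add_zero κ.1 using 2
        rw [Pi.single_eq_zero_iff]
        ring
      · simp [ladderPerm, flipPerm]
    · ext1 κ
      refine Prod.ext (funext fun j => ?_) ?_
      · rcases Int.even_or_odd κ.2 with hk | hk
        · simp [ladderPerm, shiftPerm, hk, Int.not_odd_iff_even.2 hk]
        · simp [ladderPerm, shiftPerm, hk, Int.not_even_iff_odd.2 hk]
      · simp [ladderPerm, shiftPerm]
        ring
    · simp only [ladderPerm, if_neg (by omega : ¬ i < 0), if_neg (by omega : ¬ i = 0),
        if_neg (by omega : ¬ i + 1 = 0), if_neg (by omega : ¬ i + 1 = 1),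
        if_neg (by omega : ¬ i = 1), if_neg (by omega : ¬ i + 1 < 0), shiftPerm_mul]
      rw [← shiftPerm_zero, show (i + 1 - 2).toNat = (i - 2).toNat + 1 by omega, pow_succ]
      congr 1
      ring

/-- The conjugate of `x` by `t ^ n`. -/
def conjPow {G : Type*} [Group G] (t x : G) (n : ℕ) : G :=
  t ^ n * x * (t ^ n)⁻¹

/-- The image of the letter `t`. -/
def stablePerm : Equiv.Perm (((ℤ → ℚ) × ℤ) × ℤ) :=
  Equiv.prodCongr (Equiv.refl _) (Equiv.addRight 1)

/-- The permutation acting as `ladderPerm (-i)` on the copy with index `i`. -/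
def diagPerm : Equiv.Perm (((ℤ → ℚ) × ℤ) × ℤ) :=
  Equiv.prodCongrLeft fun i => ladderPerm (-i)

theorem conjPow_stablePerm_diagPerm_apply (n : ℕ) (κ : (ℤ → ℚ) × ℤ) (i : ℤ) :
    conjPow stablePerm diagPerm n (κ, i) = (ladderPerm (n - i) κ, i) := by
  have h : ∀ (n : ℕ) (κ : (ℤ → ℚ) × ℤ) (i : ℤ), (stablePerm ^ n) (κ, i) = (κ, i + n) := by
    intro n
    induction n with
    | zero => simp
    | succ n ih =>
      intro κ i
      rw [pow_succ, Equiv.Perm.mul_apply]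
      simp [stablePerm] at ih ⊢
      rw [ih]
      congr 1
      ring
  have h' : (stablePerm ^ n)⁻¹ (κ, i) = (κ, i - n) := by
    rw [Equiv.Perm.inv_eq_iff_eq, h]
    simp
  rw [conjPow, Equiv.Perm.mul_apply, h', Equiv.Perm.mul_apply,
    show diagPerm (κ, i - n) = (ladderPerm (-(i - n)) κ, i - n) from rfl, h]
  simp

theorem diagPerm_relation : (stablePerm * diagPerm * stablePerm⁻¹) * diagPerm *
    (stablePerm * diagPerm * stablePerm⁻¹) * diagPerm * diagPerm * diagPerm = 1 := by
  have h0 := conjPow_stablePerm_diagPerm_apply 0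
  have h1 := conjPow_stablePerm_diagPerm_apply 1
  simp only [conjPow, pow_zero, pow_one, inv_one, mul_one, one_mul, Nat.cast_zero, Nat.cast_one,
    zero_sub] at h0 h1
  ext1 ⟨κ, i⟩
  rw [Equiv.Perm.mul_apply, Equiv.Perm.mul_apply, Equiv.Perm.mul_apply, Equiv.Perm.mul_apply,
    Equiv.Perm.mul_apply, h0, h0, h0, h1, h0, h1]
  have := DFunLike.congr_fun (ladderPerm_relation (-i)) κ
  simp only [Equiv.Perm.mul_apply] at this
  rw [show 1 - i = -i + 1 by ring, this]
  rfl

/-- The permutation `g` acts on the sequences in the copy with index `i` as `F`, as long as the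
counter is even. -/
def ActsOnCopy (i : ℤ) (g : Equiv.Perm (((ℤ → ℚ) × ℤ) × ℤ)) (F : (ℤ → ℚ) → ℤ → ℚ) : Prop :=
  ∀ l m, ∃ m', g ((l, 2 * m), i) = ((F l, 2 * m'), i)

namespace ActsOnCopy

variable {i : ℤ} {g h : Equiv.Perm (((ℤ → ℚ) × ℤ) × ℤ)} {F H : (ℤ → ℚ) → ℤ → ℚ}

protected theorem one : ActsOnCopy i 1 id := fun _ m => ⟨m, rfl⟩

protected theorem mul (hg : ActsOnCopy i g F) (hh : ActsOnCopy i h H) :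
    ActsOnCopy i (g * h) (F ∘ H) := fun l m => by
  obtain ⟨m₁, h₁⟩ := hh l m
  obtain ⟨m₂, h₂⟩ := hg (H l) m₁
  exact ⟨m₂, by rw [Equiv.Perm.mul_apply, h₁, h₂]; rfl⟩

protected theorem pow (hg : ActsOnCopy i g F) (n : ℕ) : ActsOnCopy i (g ^ n) F^[n] := by
  induction n with
  | zero => exact .one
  | succ n ih =>
    rw [pow_succ, Function.iterate_succ]
    exact ih.mul hg

theorem eq (hg : ActsOnCopy i g F) (hg' : ActsOnCopy i g H) (l : ℤ → ℚ) : F l = H l := by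
  obtain ⟨m₁, h₁⟩ := hg l 0
  obtain ⟨m₂, h₂⟩ := hg' l 0
  have := h₁.symm.trans h₂
  simp only [Prod.mk.injEq] at this
  exact this.1.1

theorem list_prod {ι : Type*} {g : ι → Equiv.Perm (((ℤ → ℚ) × ℤ) × ℤ)}
    {F : ι → (ℤ → ℚ) → ℤ → ℚ} (hg : ∀ x, ActsOnCopy i (g x) (F x)) (L : List ι) :
    ActsOnCopy i (L.map g).prod fun l => L.foldr F l := by
  induction L with
  | nil => exact fun _ m => ⟨m, rfl⟩
  | cons x L ih =>
    rw [List.map_cons, List.prod_cons]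
    exact (hg x).mul ih

end ActsOnCopy

/-- Translation of a sequence. -/
def seqShift (n : ℤ) (l : ℤ → ℚ) : ℤ → ℚ := fun j => l (j - n)

theorem seqShift_iterate (n : ℤ) (k : ℕ) : (seqShift n)^[k] = seqShift (n * k) := by
  induction k with
  | zero =>
    ext l j
    simp [seqShift]
  | succ k ih =>
    rw [Function.iterate_succ', ih]
    ext l j
    simp only [seqShift, Function.comp_apply]
    congr 1
    push_cast
    ring

theorem add_single_iterate (q : ℚ) (k : ℕ) :
    (fun l : ℤ → ℚ => l + Pi.single 0 q)^[k] = fun l => l + Pi.single 0 (q * k) := by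
  induction k with
  | zero => simp [funext_iff]
  | succ k ih =>
    rw [Function.iterate_succ', ih]
    ext1 l
    simp only [Function.comp_apply, add_assoc, ← Pi.single_add]
    congr 2
    push_cast
    ring

/-- The permutation representing `t ^ n x t ^ (-n)`. -/
abbrev conjPerm (n : ℕ) : Equiv.Perm (((ℤ → ℚ) × ℤ) × ℤ) :=
  conjPow stablePerm diagPerm n

theorem actsOnCopy_conjPerm_sq {n : ℕ} {i : ℤ} {F : (ℤ → ℚ) → ℤ → ℚ}
    (h : ∀ l m, ∃ m', (ladderPerm (n - i) * ladderPerm (n - i)) (l, 2 * m) = (F l, 2 * m')) :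
    ActsOnCopy i (conjPerm n ^ 2) F := by
  intro l m
  obtain ⟨m', hm⟩ := h l m
  refine ⟨m', ?_⟩
  rw [pow_two, Equiv.Perm.mul_apply, conjPow_stablePerm_diagPerm_apply,
    conjPow_stablePerm_diagPerm_apply, ← Equiv.Perm.mul_apply, hm]

theorem ladderPerm_zero : ladderPerm 0 = flipPerm := by simp [ladderPerm]

theorem ladderPerm_two : ladderPerm 2 = shiftPerm 1 := by simp [ladderPerm]

theorem ladderPerm_three : ladderPerm 3 = shiftPerm (-2) := by simp [ladderPerm]

theorem ladderPerm_neg_one : ladderPerm (-1) = entryPerm (-1 / 2) := by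
  simp [ladderPerm]
  norm_num

theorem ladderPerm_one_sq_apply (κ : (ℤ → ℚ) × ℤ) :
    (ladderPerm 1 * ladderPerm 1) κ = (κ.1, κ.2 + 2) := by
  refine Prod.ext rfl ?_
  change κ.2 + 1 + 1 = _
  ring

theorem shiftPerm_apply_even (n : ℤ) (l : ℤ → ℚ) (m : ℤ) :
    shiftPerm n (l, 2 * m) = (seqShift n l, 2 * (m - n)) := by
  refine Prod.ext (funext fun j => ?_) (mul_sub _ _ _).symm
  simp [shiftPerm, seqShift]

theorem entryPerm_apply (q : ℚ) (l : ℤ → ℚ) (m : ℤ) :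
    entryPerm q (l, m) = (l + Pi.single 0 q, m) := rfl

theorem actsOnCopy_zero_push_pop (x y : ℕ) :
    ActsOnCopy 0 (pushWord (conjPerm 0 ^ 2) (conjPerm 1 ^ 2) (conjPerm 2 ^ 2) (conjPerm 3) x y)
      (fun l => seqShift (2 * (y + 1)) (l + Pi.single 0 2)) ∧
    ActsOnCopy 0 (popWord (conjPerm 0 ^ 2) (conjPerm 1 ^ 2) (conjPerm 2 ^ 2) (conjPerm 3) y)
      (fun l => seqShift (2 * (y + 1)) (l + Pi.single 0 2)) ∧
    ActsOnCopy 0 ((conjPerm 1 ^ 2) ^ x) id := by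
  have ha : ActsOnCopy 0 (conjPerm 0 ^ 2) (fun l => l + Pi.single 0 2) :=
    actsOnCopy_conjPerm_sq fun l m => ⟨m, by simp [ladderPerm_zero, flipPerm_mul_self]; rfl⟩
  have hb : ActsOnCopy 0 (conjPerm 1 ^ 2) id :=
    actsOnCopy_conjPerm_sq fun l m => ⟨m + 1, by
      simp only [Nat.cast_one, sub_zero, ladderPerm_one_sq_apply, id, mul_add, mul_one]⟩
  have hc : ActsOnCopy 0 (conjPerm 2 ^ 2) (seqShift 2) :=
    actsOnCopy_conjPerm_sq fun l m => ⟨m - 2, by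
      simp only [Nat.cast_ofNat, sub_zero, ladderPerm_two, shiftPerm_mul]
      exact shiftPerm_apply_even 2 l m⟩
  have hd : ActsOnCopy 0 (conjPerm 3) (seqShift (-2)) := fun l m => ⟨m + 2, by
    rw [conjPow_stablePerm_diagPerm_apply]
    simp only [Nat.cast_ofNat, sub_zero, ladderPerm_three, shiftPerm_apply_even, sub_neg_eq_add]⟩
  refine ⟨?_, ?_, ?_⟩
  · refine (congrArg (ActsOnCopy _ _) ?_).mp ((((hb.pow x).mul (hc.pow (y + 2))).mul hd).mul ha)
    ext l j
    simp only [seqShift_iterate, Function.iterate_id, Function.comp_apply, id, seqShift]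
    push_cast
    ring_nf
  · refine (congrArg (ActsOnCopy _ _) ?_).mp (((hd.mul (hc.pow 2)).mul ((hc.mul hb).pow y)).mul ha)
    ext l j
    simp only [seqShift_iterate, Function.comp_apply, Function.comp_id, seqShift]
    push_cast
    ring_nf
  · simpa using hb.pow x

theorem actsOnCopy_one_push_pop (x y : ℕ) :
    ActsOnCopy 1 (pushWord (conjPerm 0 ^ 2) (conjPerm 1 ^ 2) (conjPerm 2 ^ 2) (conjPerm 3) x y)
      (fun l => seqShift 1 (l + Pi.single 0 (-1)) + Pi.single 0 (2 * x : ℚ)) ∧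
    ActsOnCopy 1 (popWord (conjPerm 0 ^ 2) (conjPerm 1 ^ 2) (conjPerm 2 ^ 2) (conjPerm 3) y)
      (fun l => seqShift 1 (l + Pi.single 0 (-1) + Pi.single 0 (2 * y : ℚ))) ∧
    ActsOnCopy 1 ((conjPerm 1 ^ 2) ^ x) (fun l => l + Pi.single 0 (2 * x : ℚ)) := by
  have ha : ActsOnCopy 1 (conjPerm 0 ^ 2) (fun l => l + Pi.single 0 (-1)) :=
    actsOnCopy_conjPerm_sq fun l m => ⟨m, by
      simp only [Nat.cast_zero, zero_sub, ladderPerm_neg_one, entryPerm_mul, entryPerm_apply]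
      norm_num⟩
  have hb : ActsOnCopy 1 (conjPerm 1 ^ 2) (fun l => l + Pi.single 0 2) :=
    actsOnCopy_conjPerm_sq fun l m => ⟨m, by simp [ladderPerm_zero, flipPerm_mul_self]; rfl⟩
  have hc : ActsOnCopy 1 (conjPerm 2 ^ 2) id :=
    actsOnCopy_conjPerm_sq fun l m => ⟨m + 1, by
      rw [show ((2 : ℕ) : ℤ) - 1 = 1 by norm_num]
      simp only [ladderPerm_one_sq_apply, id, mul_add, mul_one]⟩
  have hd : ActsOnCopy 1 (conjPerm 3) (seqShift 1) := fun l m => ⟨m - 1, by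
    rw [conjPow_stablePerm_diagPerm_apply, show ((3 : ℕ) : ℤ) - 1 = 2 by norm_num]
    simp only [ladderPerm_two, shiftPerm_apply_even]⟩
  refine ⟨?_, ?_, ?_⟩
  · refine (congrArg (ActsOnCopy _ _) ?_).mp ((((hb.pow x).mul (hc.pow (y + 2))).mul hd).mul ha)
    rw [add_single_iterate]
    ext l j
    simp
  · refine (congrArg (ActsOnCopy _ _) ?_).mp (((hd.mul (hc.pow 2)).mul ((hc.mul hb).pow y)).mul ha)
    rw [Function.id_comp, add_single_iterate]
    ext l j
    simp
  · simpa only [add_single_iterate] using hb.pow x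

theorem foldr_seqShift_injective {L L' : List ℕ}
    (h : L.foldr (fun (y : ℕ) (l : ℤ → ℚ) => seqShift (2 * (y + 1)) (l + Pi.single 0 2)) 0 =
      L'.foldr (fun (y : ℕ) (l : ℤ → ℚ) => seqShift (2 * (y + 1)) (l + Pi.single 0 2)) 0) :
    L = L' := by
  let W : List ℕ → ℤ → ℚ := fun L =>
    L.foldr (fun (y : ℕ) (l : ℤ → ℚ) => seqShift (2 * (y + 1)) (l + Pi.single 0 2)) 0
  have hW : ∀ y L j, W (y :: L) j = W L (j - 2 * (y + 1)) +
      (Pi.single 0 2 : ℤ → ℚ) (j - 2 * (y + 1)) := fun _ _ _ => rfl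
  have hneg : ∀ L, ∀ j ≤ 0, W L j = 0 := by
    intro L
    induction L with
    | nil => exact fun _ _ => rfl
    | cons y L ih =>
      intro j hj
      rw [hW, ih _ (by omega), Pi.single_eq_of_ne (by omega), add_zero]
  have hlt : ∀ (y : ℕ) L (j : ℤ), j < 2 * (y + 1) → W (y :: L) j = 0 := by
    intro y L j hj
    rw [hW, hneg _ _ (by omega), Pi.single_eq_of_ne (by omega), add_zero]
  have heq : ∀ (y : ℕ) L, W (y :: L) (2 * (y + 1)) = 2 := by
    intro y L
    rw [hW, sub_self, hneg _ _ le_rfl, Pi.single_eq_same, zero_add]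
  change W L = W L' at h
  induction L generalizing L' with
  | nil =>
    cases L' with
    | nil => rfl
    | cons y L' =>
      have := heq y L'
      rw [← h] at this
      exact absurd this (by norm_num [W])
  | cons y L ih =>
    cases L' with
    | nil =>
      have := heq y L
      rw [h] at this
      exact absurd this (by norm_num [W])
    | cons y' L' =>
      have hy : y = y' := by
        rcases lt_trichotomy y y' with hy | hy | hy
        · have := heq y L
          rw [h, hlt _ _ (2 * (y + 1)) (by omega)] at this
          norm_num at this
        · exact hy
        · have := heq y' L'
          rw [← h, hlt _ _ (2 * (y' + 1)) (by omega)] at this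
          norm_num at this
      subst hy
      rw [ih (L' := L') (funext fun j => ?_)]
      have := congrFun h (j + 2 * (y + 1))
      rw [hW, hW, add_sub_cancel_right] at this
      exact add_right_cancel this

theorem reflTransGen_of_foldr_eq {rules : Set (ℕ × ℕ × ℕ × ℕ)} {L : List (ℕ × ℕ)}
    (hL : ∀ x ∈ L, AffineStep rules x.1 x.2) {x₀ : ℕ}
    (h : (L.map Prod.snd).foldr (fun (y : ℕ) (l : ℤ → ℚ) => seqShift 1 (l + Pi.single 0 (-1) +
        Pi.single 0 (2 * y : ℚ))) 0 + Pi.single 0 (2 * x₀ : ℚ) =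
      L.foldr (fun (x : ℕ × ℕ) (l : ℤ → ℚ) => seqShift 1 (l + Pi.single 0 (-1)) +
        Pi.single 0 (2 * x.1 : ℚ)) 0) :
    ReflTransGen (AffineStep rules) x₀ 0 := by
  let R : List (ℕ × ℕ) → ℤ → ℚ := fun L =>
    L.foldr (fun (x : ℕ × ℕ) (l : ℤ → ℚ) => seqShift 1 (l + Pi.single 0 (-1)) +
      Pi.single 0 (2 * x.1 : ℚ)) 0
  let Q : List ℕ → ℤ → ℚ := fun L =>
    L.foldr (fun (y : ℕ) (l : ℤ → ℚ) => seqShift 1 (l + Pi.single 0 (-1) +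
      Pi.single 0 (2 * y : ℚ))) 0
  have hR : ∀ x L j, R (x :: L) j = R L (j - 1) + (Pi.single 0 (-1) : ℤ → ℚ) (j - 1) +
      (Pi.single 0 (2 * x.1 : ℚ) : ℤ → ℚ) j := fun _ _ _ => rfl
  have hQ : ∀ y L j, Q (y :: L) j = Q L (j - 1) + (Pi.single 0 (-1) : ℤ → ℚ) (j - 1) +
      (Pi.single 0 (2 * y : ℚ) : ℤ → ℚ) (j - 1) := fun _ _ _ => rfl
  have hRneg : ∀ L, ∀ j < 0, R L j = 0 := by
    intro L
    induction L with
    | nil => exact fun _ _ => rfl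
    | cons x L ih =>
      intro j hj
      rw [hR, ih _ (by omega), Pi.single_eq_of_ne (by omega), Pi.single_eq_of_ne (by omega)]
      simp
  have hQneg : ∀ L, ∀ j < 0, Q L j = 0 := by
    intro L
    induction L with
    | nil => exact fun _ _ => rfl
    | cons x L ih =>
      intro j hj
      rw [hQ, ih _ (by omega), Pi.single_eq_of_ne (by omega), Pi.single_eq_of_ne (by omega)]
      simp
  change Q (L.map Prod.snd) + Pi.single 0 (2 * x₀ : ℚ) = R L at h
  induction L generalizing x₀ with
  | nil =>
    have := congrFun h 0
    simp only [List.map_nil, Q, R, List.foldr_nil, zero_add, Pi.single_eq_same, Pi.zero_apply,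
      mul_eq_zero, OfNat.ofNat_ne_zero, false_or, Nat.cast_eq_zero] at this
    subst this
    exact .refl
  | cons x L ih =>
    obtain ⟨x, y⟩ := x
    rw [List.forall_mem_cons] at hL
    have h' : ∀ j, Q (y :: L.map Prod.snd) j + (Pi.single 0 (2 * x₀ : ℚ) : ℤ → ℚ) j =
      R ((x, y) :: L) j := fun j => congrFun h j
    simp only [hQ, hR] at h'
    have hx : x₀ = x := by
      have := h' 0
      rw [hRneg _ _ (by omega), hQneg _ _ (by omega), Pi.single_eq_of_ne (by omega),
        Pi.single_eq_of_ne (by omega), Pi.single_eq_same, Pi.single_eq_same] at this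
      have : (x₀ : ℚ) = x := by linarith
      exact_mod_cast this
    subst hx
    refine .head hL.1 (ih hL.2 (funext fun j => ?_))
    have := h' (j + 1)
    rw [add_sub_cancel_right] at this
    rw [Pi.add_apply]
    linarith

/-- The permutation representation detects the computations of the affine rules. -/
theorem reflTransGen_of_conjPerm_eq {rules : Set (ℕ × ℕ × ℕ × ℕ)} {L : List (ℕ × ℕ)}
    (hL : ∀ x ∈ L, AffineStep rules x.1 x.2) {l : List ℕ} {x₀ : ℕ}
    (h : (conjPerm 1 ^ 2) ^ x₀ =
      (L.map fun x => pushWord (conjPerm 0 ^ 2) (conjPerm 1 ^ 2) (conjPerm 2 ^ 2) (conjPerm 3)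
        x.1 x.2).prod *
      (l.map fun y => (popWord (conjPerm 0 ^ 2) (conjPerm 1 ^ 2) (conjPerm 2 ^ 2) (conjPerm 3)
        y)⁻¹).prod) : ReflTransGen (AffineStep rules) x₀ 0 := by
  have hinv : (l.map fun y => (popWord (conjPerm 0 ^ 2) (conjPerm 1 ^ 2) (conjPerm 2 ^ 2)
      (conjPerm 3) y)⁻¹).prod = (l.reverse.map fun y => popWord (conjPerm 0 ^ 2) (conjPerm 1 ^ 2)
        (conjPerm 2 ^ 2) (conjPerm 3) y).prod⁻¹ := by
    rw [List.prod_inv_reverse, List.map_reverse, List.map_reverse, List.reverse_reverse,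
      List.map_map]
    rfl
  rw [hinv, eq_mul_inv_iff_mul_eq] at h
  have hl : l.reverse = L.map Prod.snd := by
    apply foldr_seqShift_injective
    have h1 := (actsOnCopy_zero_push_pop x₀ 0).2.2.mul
      (ActsOnCopy.list_prod (fun y => (actsOnCopy_zero_push_pop 0 y).2.1) l.reverse)
    rw [h] at h1
    have h2 := ActsOnCopy.list_prod
      (fun x : ℕ × ℕ => (actsOnCopy_zero_push_pop x.1 x.2).1) L
    have := h1.eq h2 0
    rw [List.foldr_map]
    exact this
  rw [hl] at h
  apply reflTransGen_of_foldr_eq hL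
  have h1 := (actsOnCopy_one_push_pop x₀ 0).2.2.mul
    (ActsOnCopy.list_prod (fun y => (actsOnCopy_one_push_pop 0 y).2.1) (L.map Prod.snd))
  rw [h] at h1
  exact h1.eq (ActsOnCopy.list_prod
    (fun x : ℕ × ℕ => (actsOnCopy_one_push_pop x.1 x.2).1) L) 0

section Conjugates

variable {G : Type*} [Group G] {t x : G}

theorem map_conjPow {H : Type*} [Group H] (f : G →* H) (n : ℕ) :
    f (conjPow t x n) = conjPow (f t) (f x) n := by
  simp [conjPow]

theorem commute_sq_conjPow
    (h : t * x * t⁻¹ * x * (t * x * t⁻¹) * x * x * x = 1) (n : ℕ) (k : ℕ) :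
    Commute (conjPow t x n ^ 2) (conjPow t x (n + 1) ^ k) := by
  have h₀ : Commute (x ^ 2) (t * x * t⁻¹) := by
    set u := t * x * t⁻¹
    have hsq : x ^ 2 = ((u * x) ^ 2)⁻¹ := eq_inv_of_mul_eq_one_right <| by
      simpa only [pow_two, mul_assoc] using h
    have h₁ : Commute (x ^ 2) (u * x) := by
      rw [hsq]
      exact ((Commute.refl _).pow_left 2).inv_left
    have h₂ : Commute (x ^ 2) (u * x * x⁻¹) := h₁.mul_right ((Commute.refl x).pow_left 2).inv_right
    rwa [mul_inv_cancel_right] at h₂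
  have h₁ := h₀.map (MulAut.conj (t ^ n))
  rw [map_pow] at h₁
  have h₂ : conjPow t x (n + 1) = MulAut.conj (t ^ n) (t * x * t⁻¹) := by
    simp only [conjPow, MulAut.conj_apply, pow_succ, mul_inv_rev, mul_assoc]
  rw [h₂]
  exact h₁.pow_right k

end Conjugates

theorem isUnit_of_relation {N : Type*} [Monoid N] {t z : N}
    (h : t * z * z * t * t * z * z * t * z * t * z * t = 1) : IsUnit t ∧ IsUnit z := by
  have ht : IsUnit t := isUnit_iff_exists_and_exists.2
    ⟨⟨z * (z * t * t * z * z * t * z * t * z * t), by simpa only [mul_assoc] using h⟩, ⟨_, h⟩⟩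
  obtain ⟨T, rfl⟩ := ht
  have h₁ : z * (z * T * T * z * z * T * z * T * z * T) = ↑T⁻¹ := by
    apply Units.eq_inv_of_mul_eq_one_left
    simpa only [mul_assoc] using h
  have h₂ : T * z * z * T * T * z * z * T * z * T * z = ↑T⁻¹ :=
    Units.eq_inv_of_mul_eq_one_right h
  refine ⟨T.isUnit, isUnit_iff_exists_and_exists.2
    ⟨⟨z * T * T * z * z * T * z * T * z * T * T, ?_⟩,
      ⟨T * (T * z * z * T * T * z * z * T * z * T), ?_⟩⟩⟩
  · rw [← mul_assoc, h₁, Units.inv_mul]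
  · rw [mul_assoc, h₂, Units.mul_inv]

section StackAction

variable {G : Type*}

/-- Left translation by `g` on elements of `G` with an empty stack, together with translation by
`n` of the top of a nonempty stack. -/
def stackShift [Group G] (g : G) (n : ℤ) : Function.End (Option (G × List ℤ))
  | some (γ, []) => some (g * γ, [])
  | some (γ, j :: l) => some (γ, (j + n) :: l)
  | none => none

/-- Removal of a zero from the stack. -/
def stackPop : Function.End (Option (G × List ℤ))
  | some (γ, j :: l) => if j = 0 then some (γ, l) else none
  | _ => none

/-- Addition of a zero to the stack. -/
def stackPush : Function.End (Option (G × List ℤ))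
  | some (γ, l) => some (γ, 0 :: l)
  | none => none

theorem stackShift_mul [Group G] (g h : G) (m n : ℤ) :
    stackShift g m * stackShift h n = stackShift (g * h) (m + n) := by
  funext x
  rcases x with _ | ⟨γ, _ | ⟨j, l⟩⟩
  · rfl
  · exact congrArg (fun γ => some (γ, [])) (mul_assoc g h γ).symm
  · exact congrArg (fun j => some (γ, j :: l)) (by ring)

theorem stackShift_one [Group G] : stackShift (1 : G) 0 = 1 := by
  funext x
  rcases x with _ | ⟨γ, _ | ⟨j, l⟩⟩ <;> simp [Function.End.one_def, stackShift]

theorem stackPop_mul_stackPush :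
    (stackPop : Function.End (Option (G × List ℤ))) * stackPush = 1 := by
  funext x
  rcases x with _ | ⟨γ, l⟩
  · rfl
  · change (if (0 : ℤ) = 0 then some (γ, l) else none) = some (γ, l)
    rw [if_pos rfl]

end StackAction

theorem mem_of_mem_simEdges {G : Type*} [Group G] {a b c d : G} (K : Subgroup G) (ha : a ∈ K)
    (hb : b ∈ K) (hc : c ∈ K) (hd : d ∈ K) {rules : Set (ℕ × ℕ × ℕ × ℕ)} {s e : ℕ} {g : G}
    (h : (s, g, e) ∈ simEdges a b c d rules) : g ∈ K := by
  rcases h with h | h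
  · simp only [Set.mem_insert_iff, Set.mem_singleton_iff, Prod.mk.injEq] at h
    rcases h with ⟨-, rfl, -⟩ | ⟨-, rfl, -⟩ | ⟨-, rfl, -⟩ | ⟨-, rfl, -⟩
    · exact K.one_mem
    · exact K.inv_mem ha
    · exact K.inv_mem (K.mul_mem hc hb)
    · exact K.inv_mem (K.mul_mem hd (K.pow_mem hc _))
  · obtain ⟨ρ, -, h⟩ := Set.mem_iUnion₂.1 h
    simp only [Set.mem_insert_iff, Set.mem_singleton_iff, Prod.mk.injEq] at h
    rcases h with ⟨-, rfl, -⟩ | ⟨-, rfl, -⟩ | ⟨-, rfl, -⟩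
    · exact K.one_mem
    · exact K.mul_mem (K.pow_mem hb _) (K.pow_mem hc _)
    · exact K.mul_mem (K.mul_mem (K.mul_mem (K.pow_mem hb _) (K.pow_mem hc _)) hd) ha

namespace SpecialMonoid

/-- The defining relator. -/
abbrev relator : List (Fin 3) := [2, 0, 1, 0, 1, 2, 2, 0, 1, 0, 1, 2, 0, 1, 2, 0, 1, 2]

/-- The one-relation monoid `Mon⟨p, q, t | t(pq)²t²(pq)²t(pq)t(pq)t = 1⟩`. -/
abbrev M := OneRelMonoid relator []

/-- The first generator. -/
def p : M := PresentedMonoid.of _ 0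

/-- The second generator. -/
def q : M := PresentedMonoid.of _ 1

/-- The third generator. -/
def t : M := PresentedMonoid.of _ 2

theorem lift_relator {N : Type*} [Monoid N] (f : Fin 3 → N)
    (h : f 2 * (f 0 * f 1) * (f 0 * f 1) * f 2 * f 2 * (f 0 * f 1) * (f 0 * f 1) * f 2 *
      (f 0 * f 1) * f 2 * (f 0 * f 1) * f 2 = 1) (x y : FreeMonoid (Fin 3))
    (hxy : x = FreeMonoid.ofList relator ∧ y = FreeMonoid.ofList []) :
    FreeMonoid.lift f x = FreeMonoid.lift f y := by
  obtain ⟨rfl, rfl⟩ := hxy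
  simpa [FreeMonoid.lift_ofList, mul_assoc] using h

/-- The homomorphism with prescribed values on the generators. -/
def lift {N : Type*} [Monoid N] (f : Fin 3 → N)
    (h : f 2 * (f 0 * f 1) * (f 0 * f 1) * f 2 * f 2 * (f 0 * f 1) * (f 0 * f 1) * f 2 *
      (f 0 * f 1) * f 2 * (f 0 * f 1) * f 2 = 1) : M →* N :=
  PresentedMonoid.lift f (lift_relator f h)

theorem relation : t * (p * q) * (p * q) * t * t * (p * q) * (p * q) * t *
    (p * q) * t * (p * q) * t = 1 := by
  have h : PresentedMonoid.mk (fun x y : FreeMonoid (Fin 3) =>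
    x = FreeMonoid.ofList relator ∧ y = FreeMonoid.ofList []) (FreeMonoid.ofList relator) =
      PresentedMonoid.mk _ (FreeMonoid.ofList []) :=
    PresentedMonoid.mk_eq_mk_of_rel ⟨rfl, rfl⟩
  simp only [mul_assoc]
  exact h

/-- The generator `t` as a unit. -/
noncomputable def T : Mˣ := (isUnit_of_relation relation).1.unit

/-- The product `p * q` as a unit. -/
noncomputable def Z : Mˣ := (isUnit_of_relation relation).2.unit

theorem coe_Z : (Z : M) = p * q := rfl

theorem units_relation :
    T * (Z * T) * T⁻¹ * (Z * T) * (T * (Z * T) * T⁻¹) * (Z * T) * (Z * T) * (Z * T) = 1 := by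
  rw [Units.ext_iff]
  have : T * (Z * T) * T⁻¹ * (Z * T) * (T * (Z * T) * T⁻¹) * (Z * T) * (Z * T) * (Z * T) =
      T * Z * Z * T * T * Z * Z * T * Z * T * Z * T := by group
  rw [this]
  exact relation

/-- The action of the monoid on stacks over its group of units. -/
noncomputable def stackHom : M →* Function.End (Option (Mˣ × List ℤ)) :=
  lift ![stackPop, stackPush * stackShift Z (-1), stackShift T 1] <| by
    have h : stackPop * (stackPush * stackShift Z (-1)) = stackShift Z (-1) := by
      rw [← mul_assoc, stackPop_mul_stackPush, one_mul]
    simp only [Matrix.cons_val]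
    simp only [h, stackShift_mul]
    rw [← stackShift_one]
    congr 1
    rw [← units_relation]
    group

theorem stackHom_p : stackHom p = stackPop := rfl

theorem stackHom_q : stackHom q = stackPush * stackShift Z (-1) := rfl

theorem stackHom_T : stackHom T = stackShift T 1 := rfl

theorem stackHom_Z : stackHom Z = stackShift Z (-1) := by
  rw [coe_Z, map_mul, stackHom_p, stackHom_q, ← mul_assoc, stackPop_mul_stackPush, one_mul]

theorem stackHom_inv {g : Mˣ} {n : ℤ} (h : stackHom g = stackShift g n) :
    stackHom ↑g⁻¹ = stackShift g⁻¹ (-n) := by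
  refine left_inv_eq_right_inv (a := stackHom g) ?_ ?_
  · rw [← map_mul, Units.inv_mul, map_one]
  · rw [h, stackShift_mul, mul_inv_cancel, add_neg_cancel, stackShift_one]

/-- The units which act on stacks by translations. -/
def shiftUnits : Subgroup Mˣ where
  carrier := {g | ∃ n, stackHom g = stackShift g n}
  one_mem' := ⟨0, by rw [Units.val_one, map_one, stackShift_one]⟩
  mul_mem' := by
    rintro g h ⟨m, hm⟩ ⟨n, hn⟩
    exact ⟨m + n, by rw [Units.val_mul, map_mul, hm, hn, stackShift_mul]⟩
  inv_mem' := fun ⟨n, hn⟩ => ⟨-n, stackHom_inv hn⟩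

theorem T_mem_shiftUnits : T ∈ shiftUnits := ⟨1, stackHom_T⟩

theorem Z_mem_shiftUnits : Z ∈ shiftUnits := ⟨-1, stackHom_Z⟩

theorem stackHom_T_pow (n : ℕ) : stackHom ↑(T ^ n) = stackShift (T ^ n) n := by
  induction n with
  | zero => simp [stackShift_one]
  | succ n ih => rw [pow_succ, Units.val_mul, map_mul, ih, stackHom_T, stackShift_mul,
    Nat.cast_succ]

/-- The right factor of a transition ending in the state `e`. -/
noncomputable def exitFactor (e : ℕ) : M := p * ↑(T ^ e)

/-- The left factor of a transition starting in the state `s`. -/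
noncomputable def entryFactor (s : ℕ) : M := ↑(T ^ s)⁻¹ * (q * ↑Z⁻¹)

theorem exitFactor_mul_entryFactor (e : ℕ) : exitFactor e * entryFactor e = 1 := by
  calc p * ↑(T ^ e) * (↑(T ^ e)⁻¹ * (q * ↑Z⁻¹))
      = p * (↑(T ^ e) * ↑(T ^ e)⁻¹) * q * ↑Z⁻¹ := by simp only [mul_assoc]
    _ = 1 := by rw [Units.mul_inv, mul_one, ← coe_Z, Units.mul_inv]

theorem stackHom_exitFactor (e : ℕ) :
    stackHom (exitFactor e) = stackPop * stackShift (T ^ e) e := by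
  rw [exitFactor, map_mul, stackHom_T_pow, stackHom_p]

theorem stackHom_entryFactor (s : ℕ) :
    stackHom (entryFactor s) = stackShift (T ^ s)⁻¹ (-s) * stackPush := by
  rw [entryFactor, map_mul, map_mul, stackHom_inv (stackHom_T_pow s), stackHom_inv stackHom_Z,
    stackHom_q, mul_assoc, stackShift_mul]
  simp [stackShift_one]

/-- The element of the monoid which represents the transition `x`. -/
noncomputable def transition (x : ℕ × Mˣ × ℕ) : M :=
  entryFactor x.1 * x.2.1 * exitFactor x.2.2

theorem transition_mul (s m e : ℕ) (g h : Mˣ) :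
    transition (s, g, m) * transition (m, h, e) = transition (s, g * h, e) := by
  calc entryFactor s * g * exitFactor m * (entryFactor m * h * exitFactor e)
      = entryFactor s * g * (exitFactor m * entryFactor m) * h * exitFactor e := by
        simp only [mul_assoc]
    _ = entryFactor s * (g * h : Mˣ) * exitFactor e := by
        rw [exitFactor_mul_entryFactor, mul_one, Units.val_mul, mul_assoc (entryFactor s)]

theorem stackHom_transition {g : Mˣ} (hg : g ∈ shiftUnits) (s e e' : ℕ) (γ : Mˣ) :
    stackHom (transition (s, g, e)) (some (γ, [-(e' : ℤ)])) =
      if e' = e then some (g * γ, [-(s : ℤ)]) else none := by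
  obtain ⟨n, hn⟩ := hg
  rw [transition, map_mul, map_mul, stackHom_exitFactor, stackHom_entryFactor, hn]
  change stackShift (T ^ s)⁻¹ (-s) (stackPush (stackShift g n (if -(e' : ℤ) + e = 0 then
    some (γ, []) else none))) = _
  by_cases h : e' = e
  · subst h
    rw [if_pos (by omega), if_pos rfl]
    simp [stackShift, stackPush]
  · rw [if_neg (by omega), if_neg h]
    rfl

theorem stackHom_transition_none {g : Mˣ} (hg : g ∈ shiftUnits) (s e : ℕ) :
    stackHom (transition (s, g, e)) none = none := by
  obtain ⟨n, hn⟩ := hg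
  rw [transition, map_mul, map_mul, stackHom_exitFactor, stackHom_entryFactor, hn]
  rfl

theorem groupPath_of_mem_closure {E : Set (ℕ × Mˣ × ℕ)}
    (hE : ∀ x ∈ E, x.2.1 ∈ shiftUnits) {s e : ℕ} {g : Mˣ} (hg : g ∈ shiftUnits)
    (h : transition (s, g, e) ∈ Submonoid.closure (transition '' E)) : GroupPath E s g e := by
  have H : ∀ m ∈ Submonoid.closure (transition '' E), stackHom m (some (1, [-(e : ℤ)])) = none ∨
      ∃ s g, GroupPath E s g e ∧ stackHom m (some (1, [-(e : ℤ)])) = some (g, [-(s : ℤ)]) := by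
    intro m hm
    induction hm using Submonoid.closure_induction_left with
    | one => exact Or.inr ⟨e, 1, .nil e, by rw [map_one]; rfl⟩
    | mul_left x hx y hy ih =>
      obtain ⟨⟨s', g', e'⟩, hx, rfl⟩ := hx
      rw [map_mul]
      change stackHom _ (stackHom y _) = none ∨
        ∃ s g, GroupPath E s g e ∧ stackHom _ (stackHom y _) = some (g, [-(s : ℤ)])
      rcases ih with ih | ⟨s, g, hp, ih⟩
      · exact Or.inl (by rw [ih, stackHom_transition_none (hE _ hx)])
      · rw [ih, stackHom_transition (hE _ hx)]
        by_cases hs : s = e'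
        · subst hs
          exact Or.inr ⟨s', g' * g, .cons hx hp, if_pos rfl⟩
        · exact Or.inl (if_neg hs)
  have h₁ := H _ h
  rw [stackHom_transition hg, if_pos rfl, mul_one] at h₁
  rcases h₁ with h₁ | ⟨s', g', hp, h₁⟩
  · simp at h₁
  · simp only [Option.some.injEq, Prod.mk.injEq, List.cons.injEq, neg_inj, Nat.cast_inj,
      and_true] at h₁
    obtain ⟨rfl, rfl⟩ := h₁
    exact hp

/-- The representation of the monoid by permutations. -/
def permHom : M →* Equiv.Perm (((ℤ → ℚ) × ℤ) × ℤ) :=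
  lift ![diagPerm * stablePerm⁻¹, 1, stablePerm] <| by
    convert diagPerm_relation using 1
    simp only [Matrix.cons_val]
    group

/-- Conjugates of `Z * T` by powers of `T`. -/
noncomputable abbrev conjUnit (n : ℕ) : Mˣ := conjPow T (Z * T) n

theorem conjUnit_mem_shiftUnits (n : ℕ) : conjUnit n ∈ shiftUnits :=
  have h := shiftUnits.pow_mem T_mem_shiftUnits n
  shiftUnits.mul_mem (shiftUnits.mul_mem h
    (shiftUnits.mul_mem Z_mem_shiftUnits T_mem_shiftUnits)) (shiftUnits.inv_mem h)

theorem permHom_conjUnit (n : ℕ) : permHom (conjUnit n) = conjPerm n := by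
  have hT : permHom (T : M) = stablePerm := rfl
  have hZ : permHom (Z : M) = diagPerm * stablePerm⁻¹ := by
    rw [coe_Z, map_mul]
    exact mul_one _
  have h := map_conjPow (permHom.comp (Units.coeHom M)) (t := T) (x := Z * T) n
  rw [map_mul, MonoidHom.comp_apply, MonoidHom.comp_apply, MonoidHom.comp_apply,
    Units.coeHom_apply, Units.coeHom_apply, Units.coeHom_apply, hT, hZ, inv_mul_cancel_right] at h
  exact h

/-- The transitions of the simulation of the given affine rules. -/
noncomputable abbrev transitions (rules : Set (ℕ × ℕ × ℕ × ℕ)) : Set (ℕ × Mˣ × ℕ) :=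
  simEdges (conjUnit 0 ^ 2) (conjUnit 1 ^ 2) (conjUnit 2 ^ 2) (conjUnit 3) rules

theorem transition_mem_closure_iff {rules : Set (ℕ × ℕ × ℕ × ℕ)} {x : ℕ} :
    transition (0, (conjUnit 1 ^ 2) ^ x, 1) ∈
      Submonoid.closure (transition '' transitions rules) ↔
        ReflTransGen (AffineStep rules) x 0 := by
  have hc := commute_sq_conjPow units_relation
  constructor
  · intro h
    have hm := fun n k => shiftUnits.pow_mem (conjUnit_mem_shiftUnits n) k
    have hp := groupPath_of_mem_closure (fun y hy => mem_of_mem_simEdges shiftUnits (hm 0 2)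
      (hm 1 2) (hm 2 2) (conjUnit_mem_shiftUnits 3) hy) (shiftUnits.pow_mem (hm 1 2) x) h
    obtain ⟨L, l, hL, h⟩ := hp.simEdges_shape (hc 1 2) rfl
    apply reflTransGen_of_conjPerm_eq hL (l := l)
    have h' := congrArg (permHom.comp (Units.coeHom M)) h
    have hconj : ∀ n, (permHom.comp (Units.coeHom M)) (conjUnit n) = conjPerm n := permHom_conjUnit
    simpa only [map_mul, map_list_prod, map_pow, map_inv, List.map_map, Function.comp_def, pushWord,
      popWord, hconj] using h'
  · intro h
    refine simEdges_induction (hc 0 2) (hc 1 2) ?_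
      (C := fun s g e => transition (s, g, e) ∈ Submonoid.closure (transition '' transitions rules))
      (fun s g e he => Submonoid.subset_closure ⟨_, he, rfl⟩) (fun s m e g h hg hh => ?_) h
    · simpa using hc 2 1
    · rw [← transition_mul s m e]
      exact mul_mem hg hh

theorem exists_word (m : M) : ∃ u, OneRelMonoid.eval relator [] u = m :=
  PresentedMonoid.inductionOn m fun u => ⟨u.toList, rfl⟩

theorem eval_append (u v : List (Fin 3)) : OneRelMonoid.eval relator [] (u ++ v) =
    OneRelMonoid.eval relator [] u * OneRelMonoid.eval relator [] v :=
  rfl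

theorem eval_flatMap_range (u : List (Fin 3)) (n : ℕ) :
    OneRelMonoid.eval relator [] ((List.range n).flatMap fun _ => u) =
      OneRelMonoid.eval relator [] u ^ n := by
  induction n with
  | zero => rfl
  | succ n ih =>
    rw [List.range_succ, List.flatMap_append, eval_append, ih, pow_succ, List.flatMap_singleton]

end SpecialMonoid

theorem computable_word (u v w : List (Fin 3)) (a b : ℕ) : Computable fun n : ℕ =>
    u ++ (List.range (a * 2 ^ n + b)).flatMap (fun _ => v) ++ w := by
  have hpow : Primrec fun n : ℕ => 2 ^ n :=
    (Primrec.nat_rec₁ 1 (Primrec.nat_mul.comp₂ Primrec₂.right (Primrec₂.const 2))).of_eq fun n => by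
      induction n with
      | zero => rfl
      | succ n ih => rw [pow_succ, ← ih]
  have hrange : Primrec fun n : ℕ => List.range (a * 2 ^ n + b) := Primrec.list_range.comp
    (Primrec.nat_add.comp (Primrec.nat_mul.comp (Primrec.const a) hpow) (Primrec.const b))
  exact (Primrec.list_append.comp (Primrec.list_append.comp (Primrec.const u)
    (Primrec.list_flatMap hrange (Primrec₂.const v))) (Primrec.const w)).to_comp

open SpecialMonoid in
/-- There exist a finite alphabet `A`, a positive word `w ∈ A*` and a finite subset `F`
of the special one-relation monoid `M = Mon⟨A | w = 1⟩` such that the membership problem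
for the submonoid of `M` generated by `F` is undecidable. -/
theorem exists_special_one_relation_monoid_undecidable_submonoid_membership :
    ∃ (k : ℕ) (w : List (Fin k)) (F : Finset (OneRelMonoid w [])),
      ¬ ComputablePred fun u : List (Fin k) =>
        OneRelMonoid.eval w [] u ∈ Submonoid.closure (F : Set (OneRelMonoid w [])) := by
  obtain ⟨rules, Q, r, hfin, hcomp⟩ := exists_affineRules_not_computablePred
  have hF : (transition '' transitions rules).Finite :=
    (finite_simEdges _ _ _ _ hfin).image transition
  refine ⟨3, relator, hF.toFinset, fun hc => hcomp ?_⟩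
  rw [Set.Finite.coe_toFinset] at hc
  obtain ⟨u₁, h₁⟩ := exists_word (entryFactor 0)
  obtain ⟨u₂, h₂⟩ := exists_word ↑(conjUnit 1 ^ 2)
  obtain ⟨u₃, h₃⟩ := exists_word (exitFactor 1)
  refine ComputablePred.computable_of_manyOneReducible
    ⟨_, computable_word u₁ u₂ u₃ Q r, fun n => ?_⟩ hc
  refine transition_mem_closure_iff.symm.trans ?_
  rw [eval_append, eval_append, eval_flatMap_range, h₁, h₂, h₃,
    ← Units.val_pow_eq_pow_val]
  rfl
end
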